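/- arXiv:1912.06483 — 3 statements merged into one kernel-verified Lean document; each statement's English description precedes it below -/
import Mathlib

section
/- For every integer n ≥ 2, every q₀ ≥ 0 and every n-system P on [q₀,∞), there exists a non-zero point u ∈ ℝ^n such that P − L_u is bounded on [q₀,∞); moreover, whenever P is an n-system on [q₀,∞), u ∈ ℝ^n is non-zero and P − L_u is bounded on [q₀,∞), the coordinates of u are linearly independent over ℚ if and only if P is proper. -/
open Set Filter

noncomputable section

/-- An `n`-system on the interval `I` (conditions (S1)–(S3)). -/
def IsNSystem (n : ℕ) (I : Set ℝ) (P : ℝ → Fin n → ℝ) : Prop :=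
  ∀ q ∈ I,
    ((∀ i, 0 ≤ P q i) ∧ Monotone (P q) ∧ (∑ i, P q i) = q) ∧
    ∃ ε > 0, ∃ k ℓ : Fin n,
      (∀ t ∈ I ∩ Icc (q - ε) q, P t = P q + Pi.single ℓ (t - q)) ∧
      (∀ t ∈ I ∩ Icc q (q + ε), P t = P q + Pi.single k (t - q)) ∧
      (q ∈ interior I → ℓ < k → ∀ i, ℓ ≤ i → i ≤ k → P q i = P q ℓ)

/-- `P` is proper: its first coordinate (equivalently, by (S1)/(G1), each of its
coordinates) tends to infinity with `q`. -/
def IsProper (n : ℕ) (P : ℝ → Fin n → ℝ) : Prop :=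
  ∀ i : Fin n, Tendsto (fun q => P q i) atTop atTop

open scoped RealInnerProductSpace

/-- The `i`-th successive minimum of the convex body
`C_u(q) = {x : ‖x‖ ≤ 1, |x·u| ≤ e^{-q}}` with respect to `ℤ^n`: the smallest
`λ ≥ 1` such that `λ C_u(q)` contains `i` linearly independent integer points. -/
def lamMin (n : ℕ) (u : EuclideanSpace ℝ (Fin n)) (q : ℝ) (i : ℕ) : ℝ :=
  sInf {lam : ℝ | 1 ≤ lam ∧ ∃ v : Fin i → EuclideanSpace ℝ (Fin n),
    LinearIndependent ℝ v ∧ ∀ j, (∀ k, ∃ m : ℤ, v j k = (m : ℝ)) ∧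
      ‖v j‖ ≤ lam ∧ |⟪v j, u⟫| ≤ lam * Real.exp (-q)}

/-- The map `L_u(q) = (log λ₁(q), …, log λₙ(q))`. -/
def Lu (n : ℕ) (u : EuclideanSpace ℝ (Fin n)) (q : ℝ) : Fin n → ℝ :=
  fun i => Real.log (lamMin n u q ((i : ℕ) + 1))

/-- Invariants of the lattice construction. -/
structure RInv {n : ℕ} {E : Type*} [NormedAddCommGroup E] [InnerProductSpace ℝ E]
    (δ : ℝ) (u0 : E) (x z : Fin n → E) (u : E) (a : Fin n → ℝ) (k : Fin n) : Prop where
  nx : ∀ j, j ≠ k → ‖x j‖ ≤ 2 * Real.exp (a j)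
  nk : ‖x k‖ ≤ 2 * Real.exp (a k - δ)
  gap : ∀ i j, i ≠ j → δ ≤ |a i - a j|
  zz : ∀ j, j ≠ k → ⟪z j, x j⟫ = 1
  zo : ∀ j, j ≠ k → ∀ h, h ≠ k → a h < a j → ⟪z j, x h⟫ = 0
  zn : ∀ j, j ≠ k → ‖z j‖ * Real.exp (a j) ≤ 4
  ze : ∀ j, j ≠ k → a k < a j →
    ‖z j‖ * Real.exp (a j) + Real.exp (a j - a k + δ) * |⟪z j, x k⟫| ≤ 4
  uo : ∀ j, j ≠ k → ⟪u, x j⟫ = 0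
  un : ‖u - u0‖ + Real.exp (-a k + δ) * |⟪u, x k⟫| ≤ 1 / 2

section
variable {n : ℕ} {E : Type*} [NormedAddCommGroup E] [InnerProductSpace ℝ E]

lemma new_vec (x : Fin n → E) (a : Fin n → ℝ) (k k' : Fin n) (δ : ℝ) (hδ0 : 0 < δ)
    (hli : LinearIndependent ℝ x) (hkk : k' ≠ k) (hak : a k' < a k)
    (hδ : 20 * (n : ℝ) * Real.exp (-δ) ≤ 1)
    (nx : ∀ j, j ≠ k → ‖x j‖ ≤ 2 * Real.exp (a j))
    (nk : ‖x k‖ ≤ 2 * Real.exp (a k - δ))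
    (gap : ∀ i j, i ≠ j → δ ≤ |a i - a j|) :
    ∃ (c : Fin n → ℤ) (ζ : E), c k = 1 ∧ (∀ h, h ≠ k → ¬ a h < a k → c h = 0) ∧
      ⟪ζ, ∑ h, (c h : ℝ) • x h⟫ = 1 ∧
      (∀ h, h ≠ k → h ≠ k' → a h < a k → ⟪ζ, x h⟫ = 0) ∧
      ‖ζ‖ * Real.exp (a k) ≤ 10 / 9 ∧ ‖∑ h, (c h : ℝ) • x h‖ ≤ 2 * Real.exp (a k) := by
  classical
  set v : Fin n → E := fun h => if h ≠ k ∧ h ≠ k' ∧ a h < a k then x h else 0 with hv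
  set U : Submodule ℝ E := Submodule.span ℝ (Set.range v) with hU
  have : FiniteDimensional ℝ U := FiniteDimensional.span_of_finite ℝ (Set.finite_range v)
  have hUle : U ≤ Submodule.span ℝ (Set.image x {h | h ≠ k'}) := by
    rw [hU, Submodule.span_le]
    rintro _ ⟨h, rfl⟩
    simp only [hv]
    split_ifs with hh
    · exact Submodule.subset_span ⟨h, hh.2.1, rfl⟩
    · exact Submodule.zero_mem _
  set p := x k' - U.starProjection (x k') with hp
  have hp0 : p ≠ 0 := by
    intro h0
    have h1 : x k' = U.starProjection (x k') := sub_eq_zero.mp h0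
    have h2 : x k' ∈ U := by rw [h1]; exact Submodule.starProjection_apply_mem _ _
    exact hli.notMem_span_image (s := {h | h ≠ k'}) (x := k') (by simp) (hUle h2)
  have hpn : 0 < ‖p‖ := norm_pos_iff.mpr hp0
  have hpU : ∀ h, h ≠ k → h ≠ k' → a h < a k → ⟪p, x h⟫ = 0 := by
    intro h h1 h2 h3
    have h4 := Submodule.sub_starProjection_mem_orthogonal (K := U) (x k')
    rw [Submodule.mem_orthogonal'] at h4
    apply h4
    apply Submodule.subset_span
    exact ⟨h, by simp [hv, h1, h2, h3]⟩
  obtain ⟨s, hs⟩ := (Submodule.mem_span_range_iff_exists_fun ℝ).mp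
    (Submodule.starProjection_apply_mem U (x k'))
  set R := Real.exp (a k) with hR
  have hRp : 0 < R := Real.exp_pos _
  set r := R / ‖p‖ with hr
  set t : Fin n → ℝ := fun h => if h = k' then r else
    if h ≠ k ∧ h ≠ k' ∧ a h < a k then -(r * s h) else 0 with ht
  have hy : r • p = ∑ h, t h • x h := by
    have h1 : ∀ h, t h • x h = (if h = k' then r • x h else 0) - r • (s h • v h) := by
      intro h
      by_cases h1 : h = k'
      · simp [ht, hv, h1]
      · by_cases h2 : h ≠ k ∧ h ≠ k' ∧ a h < a k
        · simp only [ht, hv, h1, if_false]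
          rw [if_pos h2, if_pos h2, neg_smul, smul_smul, zero_sub]
        · simp only [ht, hv, h1, if_false]
          rw [if_neg h2, if_neg h2]; simp
    rw [Finset.sum_congr rfl (fun h _ => h1 h), Finset.sum_sub_distrib, ← Finset.smul_sum, hs]
    simp [hp, smul_sub]
  set c : Fin n → ℤ := fun h => if h = k then 1 else round (t h) with hc
  have hdiff : ∀ h, ‖((c h : ℝ) - t h) • x h‖ ≤ 2 * Real.exp (a k - δ) := by
    intro h
    rw [norm_smul, Real.norm_eq_abs]
    have hgap : h ≠ k → a h < a k → Real.exp (a h) ≤ Real.exp (a k - δ) := by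
      intro h1 h2
      have := gap h k h1
      rw [abs_of_neg (by linarith)] at this
      exact Real.exp_le_exp.mpr (by linarith)
    have hround : |((round (t h) : ℤ) : ℝ) - t h| ≤ 1 := by
      rw [abs_sub_comm]; linarith [abs_sub_round (t h)]
    by_cases h1 : h = k
    · have : t h = 0 := by
        simp only [ht]; rw [if_neg (by rw [h1]; exact hkk.symm), if_neg (by simp [h1])]
      simp [hc, h1]
      rw [h1] at this
      rw [this]; simpa using nk
    · by_cases h2 : a h < a k
      · simp only [hc, h1, if_false]
        have := nx h h1
        have h3 := hgap h1 h2
        calc _ ≤ 1 * ‖x h‖ := by gcongr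
          _ ≤ _ := by linarith
      · have h3 : t h = 0 := by
          simp only [ht]
          rw [if_neg, if_neg]
          · tauto
          · rintro rfl; exact h2 hak
        simp [hc, h1, h3]; positivity
  have hXy : ‖∑ h, (c h : ℝ) • x h - r • p‖ ≤ R / 10 := by
    rw [hy, ← Finset.sum_sub_distrib]
    calc _ ≤ ∑ h, ‖(c h : ℝ) • x h - t h • x h‖ := norm_sum_le _ _
      _ ≤ ∑ h : Fin n, 2 * Real.exp (a k - δ) := by
        apply Finset.sum_le_sum; intro h _; rw [← sub_smul]; exact hdiff h
      _ = n * (2 * (R * Real.exp (-δ))) := by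
        simp [hR, ← Real.exp_add, sub_eq_add_neg]
      _ ≤ R / 10 := by nlinarith
  set X := ∑ h, (c h : ℝ) • x h with hX
  have hyn : ‖r • p‖ = R := by
    rw [norm_smul, Real.norm_eq_abs, abs_of_pos (by positivity), hr]; field_simp
  have hin : 9 / 10 * R * ‖p‖ ≤ ⟪p, X⟫ := by
    have h1 : ⟪p, X⟫ = ⟪p, X - r • p⟫ + ⟪p, r • p⟫ := by rw [← inner_add_right]; simp
    have h2 : ⟪p, r • p⟫ = R * ‖p‖ := by
      rw [inner_smul_right, real_inner_self_eq_norm_sq, hr]; field_simp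
    have h3 := abs_real_inner_le_norm p (X - r • p)
    have h4 := neg_le_of_abs_le h3
    rw [h1, h2]
    nlinarith
  have hin0 : 0 < ⟪p, X⟫ := lt_of_lt_of_le (by positivity) hin
  refine ⟨c, (⟪p, X⟫)⁻¹ • p, by simp [hc], ?_, ?_, ?_, ?_, ?_⟩
  · intro h h1 h2
    have h3 : t h = 0 := by
      simp only [ht]
      rw [if_neg, if_neg]
      · tauto
      · rintro rfl; exact h2 hak
    simp [hc, h1, h3]
  · rw [← hX, real_inner_smul_left]; field_simp
  · intro h h1 h2 h3
    rw [real_inner_smul_left, hpU h h1 h2 h3, mul_zero]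
  · rw [norm_smul, norm_inv, Real.norm_eq_abs, abs_of_pos hin0]
    rw [inv_mul_eq_div, div_mul_eq_mul_div, div_le_iff₀ hin0]
    nlinarith
  · have : X = (X - r • p) + r • p := by simp
    rw [← hX, this]
    calc _ ≤ ‖X - r • p‖ + ‖r • p‖ := norm_add_le _ _
      _ ≤ _ := by rw [hyn]; linarith

/-- Dual vector to the new vector `X`, orthogonal to the low ones (set `Lo`) and to those in `S`. -/
lemma dual_vec (x z : Fin n → E) (a : Fin n → ℝ) (k : Fin n) (Lo : Set (Fin n)) (δ : ℝ)
    (X ζ : E) (hD : 8 * (2 * 18 ^ n) * Real.exp (-δ) ≤ 1 / 2)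
    (hinj : Function.Injective a)
    (hζX : ⟪ζ, X⟫ = 1) (hζo : ∀ g ∈ Lo, ⟪ζ, x g⟫ = 0) (hζn : ‖ζ‖ * Real.exp (a k) ≤ 2)
    (S : Finset (Fin n))
    (hS : ∀ h ∈ S, ‖x h‖ ≤ 2 * Real.exp (a h) ∧ ⟪z h, x h⟫ = 1 ∧
      (∀ g ∈ Lo, ⟪z h, x g⟫ = 0) ∧ (∀ g ∈ S, a g < a h → ⟪z h, x g⟫ = 0) ∧
      ‖z h‖ * Real.exp (a h) ≤ 4 ∧ Real.exp (a h - a k + δ) * |⟪z h, X⟫| ≤ 4) :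
    ∃ w : E, ⟪w, X⟫ = 1 ∧ (∀ g ∈ Lo, ⟪w, x g⟫ = 0) ∧ (∀ g ∈ S, ⟪w, x g⟫ = 0) ∧
      ‖w‖ * Real.exp (a k) ≤ 2 * 18 ^ S.card := by
  classical
  revert hS
  refine Finset.induction_on_max_value a S ?_ ?_
  · intro _
    exact ⟨ζ, hζX, hζo, by simp, by simpa using hζn⟩
  · intro h s hs hmax ih hS
    obtain ⟨w, hwX, hwL, hwS, hwn⟩ := ih (fun g hg => by
      obtain ⟨h1, h2, h3, h4, h5, h6⟩ := hS g (Finset.mem_insert_of_mem hg)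
      exact ⟨h1, h2, h3, fun g' hg' => h4 g' (Finset.mem_insert_of_mem hg'), h5, h6⟩)
    obtain ⟨h1, h2, h3, h4, h5, h6⟩ := hS h (Finset.mem_insert_self _ _)
    have hcard : (18 : ℝ) ^ s.card ≤ 18 ^ n := by
      apply pow_le_pow_right₀ (by norm_num)
      simpa using Finset.card_le_univ s
    set D : ℝ := 2 * 18 ^ s.card with hDdef
    have hDp : 0 < D := by positivity
    have hDn : 8 * D * Real.exp (-δ) ≤ 1 / 2 := by
      refine le_trans ?_ hD
      gcongr
      rw [hDdef]
      linarith
    have e1 : |⟪w, x h⟫| ≤ 2 * (‖w‖ * Real.exp (a h)) := by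
      calc _ ≤ ‖w‖ * ‖x h‖ := abs_real_inner_le_norm _ _
        _ ≤ ‖w‖ * (2 * Real.exp (a h)) := by gcongr
        _ = _ := by ring
    have e2 : |⟪w, x h⟫| * Real.exp (a k) ≤ 2 * D * Real.exp (a h) := by
      calc _ ≤ (2 * (‖w‖ * Real.exp (a h))) * Real.exp (a k) := by gcongr
        _ = 2 * (‖w‖ * Real.exp (a k)) * Real.exp (a h) := by ring
        _ ≤ _ := by gcongr
    have e3 : |⟪w, x h⟫ * ⟪z h, X⟫| ≤ 1 / 2 := by
      have f1 : (|⟪w, x h⟫| * Real.exp (a k)) * (Real.exp (a h - a k + δ) * |⟪z h, X⟫|)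
          ≤ (2 * D * Real.exp (a h)) * 4 := by gcongr
      have f2 : Real.exp (a h - a k + δ) * Real.exp (a k) * Real.exp (-δ) = Real.exp (a h) := by
        rw [← Real.exp_add, ← Real.exp_add]; congr 1; ring
      have f3 : Real.exp (a h) * |⟪w, x h⟫ * ⟪z h, X⟫| ≤ Real.exp (a h) * (1 / 2) := by
        rw [abs_mul]
        calc _ = ((|⟪w, x h⟫| * Real.exp (a k)) * (Real.exp (a h - a k + δ) * |⟪z h, X⟫|))
              * Real.exp (-δ) := by rw [← f2]; ring
          _ ≤ ((2 * D * Real.exp (a h)) * 4) * Real.exp (-δ) := by gcongr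
          _ = Real.exp (a h) * (8 * D * Real.exp (-δ)) := by ring
          _ ≤ _ := by gcongr
      exact le_of_mul_le_mul_left f3 (Real.exp_pos _)
    set θ := ⟪w, x h⟫ * ⟪z h, X⟫ with hθ
    have hθ1 : 1 / 2 ≤ 1 - θ := by linarith [le_of_abs_le e3]
    have hθ0 : 0 < 1 - θ := by linarith
    refine ⟨(1 - θ)⁻¹ • (w - ⟪w, x h⟫ • z h), ?_, ?_, ?_, ?_⟩
    · rw [real_inner_smul_left, inner_sub_left, real_inner_smul_left, hwX, ← hθ]
      field_simp
    · intro g hg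
      rw [real_inner_smul_left, inner_sub_left, real_inner_smul_left, hwL g hg, h3 g hg]; simp
    · intro g hg
      rw [real_inner_smul_left, inner_sub_left, real_inner_smul_left]
      rcases Finset.mem_insert.mp hg with rfl | hg'
      · rw [h2]; simp
      · have : a g < a h := lt_of_le_of_ne (hmax g hg') (fun e => hs (hinj e ▸ hg'))
        rw [hwS g hg', h4 g hg this]; simp
    · rw [Finset.card_insert_of_notMem hs, norm_smul, norm_inv, Real.norm_eq_abs, abs_of_pos hθ0]
      have g1 : (1 - θ)⁻¹ ≤ 2 := by
        rw [inv_le_comm₀ hθ0 (by norm_num)]; linarith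
      have g2 : ‖w - ⟪w, x h⟫ • z h‖ ≤ ‖w‖ + |⟪w, x h⟫| * ‖z h‖ := by
        refine (norm_sub_le _ _).trans ?_
        rw [norm_smul, Real.norm_eq_abs]
      calc _ ≤ 2 * (‖w‖ + |⟪w, x h⟫| * ‖z h‖) * Real.exp (a k) := by gcongr
        _ = 2 * (‖w‖ * Real.exp (a k) + (|⟪w, x h⟫| * Real.exp (a k)) * ‖z h‖) := by ring
        _ ≤ 2 * (D + (2 * D * Real.exp (a h)) * ‖z h‖) := by gcongr
        _ = 2 * (D + 2 * D * (‖z h‖ * Real.exp (a h))) := by ring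
        _ ≤ 2 * (D + 2 * D * 4) := by gcongr
        _ = _ := by rw [hDdef]; ring

lemma switch_step (δ : ℝ) (hδ0 : 0 < δ) (hδ1 : 20 * (n : ℝ) * Real.exp (-δ) ≤ 1)
    (hD : 8 * (2 * 18 ^ n) * Real.exp (-δ) ≤ 1 / 2)
    (u0 : E) (x z : Fin n → E) (u : E) (a : Fin n → ℝ) (k : Fin n)
    (hI : RInv δ u0 x z u a k) (hli : LinearIndependent ℝ x)
    (k' : Fin n) (hkk : k' ≠ k) (hak : a k' < a k) (a' : ℝ) (ha' : a k' + δ ≤ a')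
    (hgap : ∀ j, j ≠ k' → δ ≤ |a j - a'|) :
    ∃ (c : Fin n → ℤ) (z' : Fin n → E) (u' : E), c k = 1 ∧
      RInv δ u0 (Function.update x k (∑ h, (c h : ℝ) • x h)) z' u' (Function.update a k' a') k' ∧
      ‖u' - u‖ ≤ |⟪u, x k⟫| * (2 * 18 ^ n) * Real.exp (-a k) := by
  classical
  obtain ⟨c, ζ, hck, hc0, hζX, hζo, hζn, hXn⟩ :=
    new_vec x a k k' δ hδ0 hli hkk hak hδ1 hI.nx hI.nk hI.gap
  set X := ∑ h, (c h : ℝ) • x h with hX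
  have hinj : Function.Injective a := by
    intro i j hij
    by_contra hne
    have := hI.gap i j hne
    rw [hij] at this; simp at this; linarith
  have hinX : ∀ y : E, (∀ g, g ≠ k → a g < a k → ⟪y, x g⟫ = 0) → ⟪y, X⟫ = ⟪y, x k⟫ := by
    intro y hy
    rw [hX, inner_sum, Finset.sum_eq_single k]
    · rw [inner_smul_right, hck]; simp
    · intro g _ hg
      rw [inner_smul_right]
      by_cases h1 : a g < a k
      · rw [hy g hg h1, mul_zero]
      · rw [hc0 g hg h1]; simp
    · simp
  have hzX : ∀ h, h ≠ k → a k < a h → ⟪z h, X⟫ = ⟪z h, x k⟫ := fun h h1 h2 =>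
    hinX _ (fun g hg hg' => hI.zo h h1 g hg (hg'.trans h2))
  have huX : ⟪u, X⟫ = ⟪u, x k⟫ := hinX _ (fun g hg _ => hI.uo g hg)
  obtain ⟨w, hwX, hwL, hwS, hwn⟩ := dual_vec x z a k {g | g ≠ k ∧ g ≠ k' ∧ a g < a k} δ X ζ hD hinj
    hζX (fun g hg => hζo g hg.1 hg.2.1 hg.2.2) (by linarith)
    (Finset.univ.filter (fun h => a k < a h)) (by
      intro h hh
      have hh' : a k < a h := by simpa using hh
      have hhk : h ≠ k := by rintro rfl; exact lt_irrefl _ hh'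
      refine ⟨hI.nx h hhk, hI.zz h hhk, ?_, ?_, hI.zn h hhk, ?_⟩
      · intro g hg; exact hI.zo h hhk g hg.1 (hg.2.2.trans hh')
      · intro g hg hg'
        have : a k < a g := by simpa using hg
        exact hI.zo h hhk g (by rintro rfl; exact lt_irrefl _ this) hg'
      · rw [hzX h hhk hh']
        have := hI.ze h hhk hh'
        have : 0 ≤ ‖z h‖ * Real.exp (a h) := by positivity
        linarith)
  have hwV : ∀ g, g ≠ k → g ≠ k' → ⟪w, x g⟫ = 0 := by
    intro g h1 h2
    rcases lt_trichotomy (a g) (a k) with h | h | h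
    · exact hwL g ⟨h1, h2, h⟩
    · exact absurd (hinj h) h1
    · exact hwS g (by simpa using h)
  set D : ℝ := 2 * 18 ^ n with hDdef
  have hDp : 0 < D := by positivity
  have hwn' : ‖w‖ * Real.exp (a k) ≤ D := by
    refine hwn.trans ?_
    rw [hDdef]
    gcongr
    · norm_num
    · simpa using Finset.card_le_univ (Finset.univ.filter (fun h => a k < a h))
  have hwn2 : ‖w‖ ≤ D * Real.exp (-a k) := by
    rw [Real.exp_neg, ← div_eq_mul_inv, le_div_iff₀ (Real.exp_pos _)]; exact hwn'
  have hDe : 3 * D * Real.exp (-δ) ≤ 1 := by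
    have : 0 < D * Real.exp (-δ) := by positivity
    linarith
  have hwk' : |⟪w, x k'⟫| ≤ D * Real.exp (-a k) * (2 * Real.exp (a k')) :=
    (abs_real_inner_le_norm _ _).trans (mul_le_mul hwn2 (hI.nx k' hkk) (norm_nonneg _)
      (by positivity))
  have pot : ∀ (s σ : ℝ), 0 ≤ σ → σ * ‖w‖ * Real.exp s +
      Real.exp (s - a' + δ) * (σ * |⟪w, x k'⟫|) ≤ Real.exp (s - a k + δ) * σ := by
    intro s σ hσ
    have f1 : Real.exp (s - a' + δ) ≤ Real.exp (s - a k') := Real.exp_le_exp.mpr (by linarith)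
    have f2 : Real.exp (s - a k') * (Real.exp (-a k) * Real.exp (a k')) =
        Real.exp (s - a k + δ) * Real.exp (-δ) := by
      rw [← Real.exp_add, ← Real.exp_add, ← Real.exp_add]; congr 1; ring
    have f3 : Real.exp (-a k) * Real.exp s = Real.exp (s - a k + δ) * Real.exp (-δ) := by
      rw [← Real.exp_add, ← Real.exp_add]; congr 1; ring
    calc _ ≤ σ * (D * Real.exp (-a k)) * Real.exp s +
        Real.exp (s - a k') * (σ * (D * Real.exp (-a k) * (2 * Real.exp (a k')))) := by gcongr
      _ = σ * D * (Real.exp (-a k) * Real.exp s) + 2 * (σ * D) *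
        (Real.exp (s - a k') * (Real.exp (-a k) * Real.exp (a k'))) := by ring
      _ = Real.exp (s - a k + δ) * σ * (3 * D * Real.exp (-δ)) := by rw [f2, f3]; ring
      _ ≤ Real.exp (s - a k + δ) * σ * 1 := by gcongr
      _ = _ := by ring
  set z' : Fin n → E := fun j => if j = k then ζ else if a k < a j then z j - ⟪z j, x k⟫ • w
    else z j with hz'
  set u' : E := u - ⟪u, x k⟫ • w with hu'
  have hxk : Function.update x k X k = X := Function.update_self ..
  have hxne : ∀ j, j ≠ k → Function.update x k X j = x j := fun j hj =>
    Function.update_of_ne hj ..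
  have hak' : Function.update a k' a' k' = a' := Function.update_self ..
  have hane : ∀ j, j ≠ k' → Function.update a k' a' j = a j := fun j hj =>
    Function.update_of_ne hj ..
  have zlow : ∀ j, j ≠ k → ¬ a k < a j → z' j = z j := by
    intro j h1 h2; simp [hz', h1, h2]
  have zhigh : ∀ j, j ≠ k → a k < a j → z' j = z j - ⟪z j, x k⟫ • w := by
    intro j h1 h2; simp [hz', h1, h2]
  have zk : z' k = ζ := by simp [hz']
  have zhn : ∀ j, ‖z j - ⟪z j, x k⟫ • w‖ ≤ ‖z j‖ + |⟪z j, x k⟫| * ‖w‖ := by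
    intro j
    refine (norm_sub_le _ _).trans ?_
    rw [norm_smul, Real.norm_eq_abs]
  refine ⟨c, z', u', hck, ⟨?_, ?_, ?_, ?_, ?_, ?_, ?_, ?_, ?_⟩, ?_⟩
  · intro j hj
    rw [hane j hj]
    by_cases h1 : j = k
    · rw [h1, hxk]; exact hXn
    · rw [hxne j h1]; exact hI.nx j h1
  · rw [hak', hxne k' hkk]
    refine (hI.nx k' hkk).trans ?_
    gcongr; linarith
  · intro i j hij
    by_cases hi : i = k'
    · rw [hi, hak', hane j (by rintro rfl; exact hij hi), abs_sub_comm]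
      exact hgap j (by rintro rfl; exact hij hi)
    · by_cases hj : j = k'
      · rw [hj, hak', hane i hi]; exact hgap i hi
      · rw [hane i hi, hane j hj]; exact hI.gap i j hij
  · intro j hj
    by_cases h1 : j = k
    · rw [h1, hxk, zk]; exact hζX
    · rw [hxne j h1]
      by_cases h2 : a k < a j
      · rw [zhigh j h1 h2, inner_sub_left, real_inner_smul_left, hwV j h1 hj, hI.zz j h1]; simp
      · rw [zlow j h1 h2]; exact hI.zz j h1
  · intro j hj h hh hlt
    rw [hane j hj, hane h hh] at hlt
    by_cases h1 : j = k
    · subst h1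
      have : h ≠ j := by rintro rfl; exact lt_irrefl _ hlt
      rw [hxne h this, zk]; exact hζo h this hh hlt
    · by_cases h2 : a k < a j
      · rw [zhigh j h1 h2, inner_sub_left, real_inner_smul_left]
        by_cases h3 : h = k
        · rw [h3, hxk, hwX, hzX j h1 h2]; ring
        · rw [hxne h h3, hwV h h3 hh, hI.zo j h1 h h3 hlt]; simp
      · have h3 : h ≠ k := by rintro rfl; exact h2 hlt
        rw [zlow j h1 h2, hxne h h3]; exact hI.zo j h1 h h3 hlt
  · intro j hj
    rw [hane j hj]
    by_cases h1 : j = k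
    · rw [h1, zk]; linarith
    · by_cases h2 : a k < a j
      · rw [zhigh j h1 h2]
        have p1 := pot (a j) |⟪z j, x k⟫| (abs_nonneg _)
        have p2 := hI.ze j h1 h2
        have p3 : 0 ≤ Real.exp (a j - a' + δ) * (|⟪z j, x k⟫| * |⟪w, x k'⟫|) := by positivity
        have p4 := mul_le_mul_of_nonneg_right (zhn j) (Real.exp_pos (a j)).le
        linarith
      · rw [zlow j h1 h2]; exact hI.zn j h1
  · intro j hj hlt
    rw [hak', hane j hj] at hlt
    rw [hak', hane j hj, hxne k' hkk]
    by_cases h1 : j = k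
    · subst h1
      rw [zk]
      have p1 : |⟪ζ, x k'⟫| ≤ ‖ζ‖ * (2 * Real.exp (a k')) :=
        (abs_real_inner_le_norm _ _).trans (by gcongr; exact hI.nx k' hkk)
      have p2 : Real.exp (a j - a' + δ) ≤ Real.exp (a j - a k') := Real.exp_le_exp.mpr (by linarith)
      have p3 : Real.exp (a j - a k') * Real.exp (a k') = Real.exp (a j) := by
        rw [← Real.exp_add]; congr 1; ring
      have p4 : Real.exp (a j - a' + δ) * |⟪ζ, x k'⟫| ≤ 2 * (‖ζ‖ * Real.exp (a j)) := by
        calc _ ≤ Real.exp (a j - a k') * (‖ζ‖ * (2 * Real.exp (a k'))) := by gcongr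
          _ = 2 * (‖ζ‖ * (Real.exp (a j - a k') * Real.exp (a k'))) := by ring
          _ = _ := by rw [p3]
      linarith
    · have hk'j : a k' < a j := by linarith
      by_cases h2 : a k < a j
      · rw [zhigh j h1 h2, inner_sub_left, real_inner_smul_left, hI.zo j h1 k' hkk hk'j, zero_sub,
          abs_neg, abs_mul]
        have p1 := pot (a j) |⟪z j, x k⟫| (abs_nonneg _)
        have p2 := hI.ze j h1 h2
        have p4 := mul_le_mul_of_nonneg_right (zhn j) (Real.exp_pos (a j)).le
        linarith
      · rw [zlow j h1 h2, hI.zo j h1 k' hkk hk'j]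
        have := hI.zn j h1
        simpa using this
  · intro j hj
    rw [hu', inner_sub_left, real_inner_smul_left]
    by_cases h1 : j = k
    · rw [h1, hxk, hwX, huX]; ring
    · rw [hxne j h1, hI.uo j h1, hwV j h1 hj]; simp
  · rw [hak', hxne k' hkk, hu', inner_sub_left, real_inner_smul_left, hI.uo k' hkk, zero_sub,
      abs_neg, abs_mul]
    have p1 := pot 0 |⟪u, x k⟫| (abs_nonneg _)
    simp only [Real.exp_zero, mul_one, zero_sub] at p1
    have p2 := hI.un
    have p3 : ‖u - ⟪u, x k⟫ • w - u0‖ ≤ ‖u - u0‖ + |⟪u, x k⟫| * ‖w‖ := by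
      have : u - ⟪u, x k⟫ • w - u0 = (u - u0) - ⟪u, x k⟫ • w := by abel
      rw [this]
      refine (norm_sub_le _ _).trans ?_
      rw [norm_smul, Real.norm_eq_abs]
    linarith
  · have : u' - u = -(⟪u, x k⟫ • w) := by rw [hu']; abel
    rw [this, norm_neg, norm_smul, Real.norm_eq_abs, mul_assoc]
    gcongr

lemma rise_step (δ : ℝ) (u0 : E) (x z : Fin n → E) (u : E) (a : Fin n → ℝ) (k : Fin n)
    (hI : RInv δ u0 x z u a k) (a' : ℝ) (ha' : a k ≤ a')
    (hgap : ∀ j, j ≠ k → δ ≤ |a j - a'|) :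
    RInv δ u0 x z u (Function.update a k a') k := by
  have hak' : Function.update a k a' k = a' := Function.update_self ..
  have hane : ∀ j, j ≠ k → Function.update a k a' j = a j := fun j hj =>
    Function.update_of_ne hj ..
  refine ⟨?_, ?_, ?_, hI.zz, ?_, ?_, ?_, hI.uo, ?_⟩
  · intro j hj; rw [hane j hj]; exact hI.nx j hj
  · rw [hak']; refine hI.nk.trans ?_; gcongr
  · intro i j hij
    by_cases hi : i = k
    · rw [hi, hak', hane j (by rintro rfl; exact hij hi), abs_sub_comm]
      exact hgap j (by rintro rfl; exact hij hi)
    · by_cases hj : j = k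
      · rw [hj, hak', hane i hi]; exact hgap i hi
      · rw [hane i hi, hane j hj]; exact hI.gap i j hij
  · intro j hj h hh hlt
    rw [hane j hj, hane h hh] at hlt
    exact hI.zo j hj h hh hlt
  · intro j hj; rw [hane j hj]; exact hI.zn j hj
  · intro j hj hlt
    rw [hak', hane j hj] at hlt
    rw [hak', hane j hj]
    refine le_trans ?_ (hI.ze j hj (by linarith))
    gcongr
  · rw [hak']
    refine le_trans ?_ hI.un
    gcongr
end

lemma det_tri {m : Type*} [Fintype m] [DecidableEq m] (M : Matrix m m ℝ) (b : m → ℝ)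
    (hb : Function.Injective b) (hM : ∀ i j, b j < b i → M i j = 0) : M.det = ∏ i, M i i := by
  let _ : LinearOrder m := LinearOrder.lift' b hb
  apply Matrix.det_of_isUpperTriangular
  intro i j hij
  exact hM i j hij

lemma det_row_bound {n : ℕ} (b : Matrix (Fin n) (Fin n) ℝ) (r : Fin n → ℝ)
    (hr : ∀ i j, |b i j| ≤ r i) : |b.det| ≤ (n.factorial : ℝ) * ∏ i, r i := by
  rw [Matrix.det_apply]
  refine (Finset.abs_sum_le_sum_abs _ _).trans ?_
  calc _ ≤ ∑ σ : Equiv.Perm (Fin n), ∏ i, r i := by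
        apply Finset.sum_le_sum
        intro σ _
        have h1 : |Equiv.Perm.sign σ • ∏ i, b (σ i) i| = ∏ i, |b (σ i) i| := by
          rw [← Finset.abs_prod]
          rcases Int.units_eq_one_or (Equiv.Perm.sign σ) with h | h <;> simp [h]
        rw [h1, ← Equiv.prod_comp σ r]
        exact Finset.prod_le_prod (fun i _ => abs_nonneg _) (fun i _ => hr _ _)
    _ = _ := by
        simp [Fintype.card_perm]

lemma pairing_bound {n : ℕ} (x z : Fin n → EuclideanSpace ℝ (Fin n))
    (u u0 : EuclideanSpace ℝ (Fin n)) (a : Fin n → ℝ) (k : Fin n) (δ : ℝ) (hδ : 0 < δ)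
    (hI : RInv δ u0 x z u a k) (hu0 : ‖u0‖ = 1) (dX : ℝ) (hpos : 0 < dX)
    (hdX : (Matrix.of fun i j => x i j).det = dX) :
    |⟪u, x k⟫| ≤ (n.factorial * 4 ^ n * dX) * Real.exp (a k - ∑ j, a j) := by
  classical
  have hinj : ∀ i j, i ≠ j → a i ≠ a j := by
    intro i j hij h
    have := hI.gap i j hij
    rw [h, sub_self, abs_zero] at this
    linarith
  set Z : Matrix (Fin n) (Fin n) ℝ := Matrix.of fun i j => if i = k then u j else z i j with hZ
  set X : Matrix (Fin n) (Fin n) ℝ := Matrix.of fun i j => x i j with hX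
  have hT : ∀ i j, (Z * X.transpose) i j = if i = k then ⟪u, x j⟫ else ⟪z i, x j⟫ := by
    intro i j
    simp only [Matrix.mul_apply, hZ, hX, Matrix.of_apply, Matrix.transpose_apply, PiLp.inner_apply]
    split_ifs with h <;> simp [mul_comm]
  set b : Fin n → ℝ := Function.update a k (1 + ∑ j, |a j|) with hb
  have hle : ∀ j, a j < 1 + ∑ j, |a j| := by
    intro j
    have := Finset.single_le_sum (f := fun j => |a j|) (fun i _ => abs_nonneg _) (Finset.mem_univ j)
    have := le_abs_self (a j)
    simp only at *
    linarith
  have hbi : Function.Injective b := by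
    intro i j hij
    by_contra hne
    simp only [hb, Function.update_apply] at hij
    split_ifs at hij with h1 h2 h2
    · exact hne (h1.trans h2.symm)
    · exact absurd hij (hle j).ne'
    · exact absurd hij (hle i).ne
    · exact hinj i j hne hij
  have hdet : (Z * X.transpose).det = ⟪u, x k⟫ := by
    rw [det_tri _ b hbi]
    · rw [Finset.prod_eq_single k]
      · rw [hT]; simp
      · intro i _ hi
        rw [hT, if_neg hi, hI.zz i hi]
      · simp
    · intro i j hij
      rw [hT]
      simp only [hb, Function.update_apply] at hij
      by_cases h1 : j = k
      · rw [if_pos h1] at hij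
        by_cases h2 : i = k
        · rw [if_pos h2] at hij
          exact absurd hij (lt_irrefl _)
        · rw [if_neg h2] at hij
          exact absurd hij (not_lt.2 (hle i).le)
      · by_cases h2 : i = k
        · rw [if_pos h2]
          exact hI.uo j h1
        · rw [if_neg h1, if_neg h2] at hij
          rw [if_neg h2]
          exact hI.zo i h2 j h1 hij
  rw [Matrix.det_mul, Matrix.det_transpose, hdX] at hdet
  have hZb : |Z.det| ≤ (n.factorial : ℝ) * ∏ i, (4 * Real.exp (-(Function.update a k 0 i))) := by
    apply det_row_bound
    intro i j
    simp only [hZ, Matrix.of_apply, Function.update_apply]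
    split_ifs with h
    · have h1 : ‖u j‖ ≤ ‖u‖ := PiLp.norm_apply_le u j
      rw [Real.norm_eq_abs] at h1
      have h2 := hI.un
      have h3 : 0 ≤ Real.exp (-a k + δ) * |⟪u, x k⟫| := by positivity
      have h4 : ‖u‖ ≤ ‖u - u0‖ + ‖u0‖ := by simpa using norm_add_le (u - u0) u0
      simp
      linarith
    · have h1 : ‖z i j‖ ≤ ‖z i‖ := PiLp.norm_apply_le (z i) j
      rw [Real.norm_eq_abs] at h1
      have h2 := hI.zn i h
      rw [Real.exp_neg, ← div_eq_mul_inv, le_div_iff₀ (Real.exp_pos _)]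
      refine le_trans ?_ h2
      gcongr
  have hprod : ∏ i, (4 * Real.exp (-(Function.update a k 0 i))) = 4 ^ n * Real.exp (a k - ∑ j, a j) := by
    rw [Finset.prod_mul_distrib, ← Real.exp_sum]
    congr 1
    · simp
    · congr 1
      rw [Finset.sum_neg_distrib, Finset.sum_update_of_mem (Finset.mem_univ k), ← Finset.add_sum_erase _ a (Finset.mem_univ k)]
      rw [Finset.sdiff_singleton_eq_erase]
      ring
  rw [hprod] at hZb
  rw [← hdet, abs_mul, abs_of_pos hpos]
  calc _ ≤ ((n.factorial : ℝ) * (4 ^ n * Real.exp (a k - ∑ j, a j))) * dX := by gcongr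
    _ = _ := by ring

/-- Discrete description of an `n`-system: times that can be reached by finitely many short
linear pieces, together with the label of the last piece. -/
inductive Reach {n : ℕ} (P : ℝ → Fin n → ℝ) (q0 : ℝ) (κ0 : Fin n) : ℝ → Fin n → Prop
  | base : Reach P q0 κ0 q0 κ0
  | step (q q' : ℝ) (κ κ' : Fin n) : Reach P q0 κ0 q κ → q < q' → q' ≤ q + 1 →
      (∀ t ∈ Icc q q', P t = P q + Pi.single κ' (t - q)) → P q κ' ≤ P q κ →
      Reach P q0 κ0 q' κ'

lemma single_inj_aux {n : ℕ} {k l : Fin n} {s : ℝ} (hs : s ≠ 0)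
    (h : (Pi.single k s : Fin n → ℝ) = Pi.single l s) : k = l := by
  by_contra hne
  have := congrFun h k
  rw [Pi.single_eq_same, Pi.single_eq_of_ne hne] at this
  exact hs this

lemma Reach.left {n : ℕ} {P : ℝ → Fin n → ℝ} {q0 : ℝ} {κ0 : Fin n} {Q : ℝ} {κ : Fin n}
    (h : Reach P q0 κ0 Q κ) : q0 ≤ Q ∧ ((Q = q0 ∧ κ = κ0) ∨
      ∃ q, q0 ≤ q ∧ q < Q ∧ ∀ t ∈ Icc q Q, P t = P Q + Pi.single κ (t - Q)) := by
  induction h with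
  | base => exact ⟨le_rfl, Or.inl ⟨rfl, rfl⟩⟩
  | step q q' κ κ' h1 h2 h3 h4 h5 ih =>
    refine ⟨ih.1.trans h2.le, Or.inr ⟨q, ih.1, h2, fun t ht => ?_⟩⟩
    rw [h4 t ht, h4 q' ⟨h2.le, le_rfl⟩, add_assoc, ← Pi.single_add]
    congr 2
    ring

lemma Reach.extend {n : ℕ} {P : ℝ → Fin n → ℝ} {q0 : ℝ} {κ0 : Fin n} {q q' : ℝ} {κ κ' : Fin n}
    (hP : IsNSystem n (Ici q0) P) (hκ0 : ∃ ε > 0, ∀ t ∈ Icc q0 (q0 + ε), P t = P q0 + Pi.single κ0 (t - q0))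
    (h : Reach P q0 κ0 q κ) (h1 : q < q') (h2 : q' ≤ q + 1)
    (h3 : ∀ t ∈ Icc q q', P t = P q + Pi.single κ' (t - q)) : Reach P q0 κ0 q' κ' := by
  refine Reach.step q q' κ κ' h h1 h2 h3 ?_
  obtain ⟨hq, h4 | ⟨p, hp, hpq, hl⟩⟩ := h.left
  · obtain ⟨rfl, rfl⟩ := h4
    obtain ⟨ε, hε, h5⟩ := hκ0
    have hm : 0 < min ε (q' - q) := lt_min hε (by linarith)
    have e1 := h5 (q + min ε (q' - q)) ⟨by linarith, by linarith [min_le_left ε (q' - q)]⟩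
    have e2 := h3 (q + min ε (q' - q)) ⟨by linarith, by linarith [min_le_right ε (q' - q)]⟩
    rw [e1, add_right_inj, add_sub_cancel_left] at e2
    rw [single_inj_aux hm.ne' e2]
  · obtain ⟨⟨-, hmono, -⟩, ε, hε, k, l, hL, hR, h5⟩ := hP q hq
    have hk : k = κ' := by
      have hm : 0 < min ε (q' - q) := lt_min hε (by linarith)
      have e1 := hR (q + min ε (q' - q)) ⟨by simp only [mem_Ici]; linarith, by linarith, by linarith [min_le_left ε (q' - q)]⟩
      have e2 := h3 (q + min ε (q' - q)) ⟨by linarith, by linarith [min_le_right ε (q' - q)]⟩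
      rw [e1, add_right_inj, add_sub_cancel_left] at e2
      exact single_inj_aux hm.ne' e2
    have hlk : l = κ := by
      have hm : 0 < min ε (q - p) := lt_min hε (by linarith)
      have hm2 := min_le_right ε (q - p)
      have e1 := hL (q - min ε (q - p)) ⟨by simp only [mem_Ici]; linarith, by linarith [min_le_left ε (q - p)], by linarith⟩
      have e2 := hl (q - min ε (q - p)) ⟨by linarith, by linarith⟩
      rw [e1, add_right_inj] at e2
      refine single_inj_aux ?_ e2
      intro h; linarith
    subst hk hlk
    by_cases hc : l < k
    · exact (h5 (by rw [interior_Ici]; exact lt_of_le_of_lt hp hpq) hc k hc.le le_rfl).le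
    · exact hmono (not_lt.1 hc)

lemma reach_all {n : ℕ} {P : ℝ → Fin n → ℝ} {q0 : ℝ} (hP : IsNSystem n (Ici q0) P) :
    ∃ κ0, ∀ Q, q0 ≤ Q → ∃ κ, Reach P q0 κ0 Q κ := by
  obtain ⟨-, ε0, hε0, κ0, -, -, hR0, -⟩ := hP q0 (mem_Ici.2 le_rfl)
  have hκ0 : ∃ ε > 0, ∀ t ∈ Icc q0 (q0 + ε), P t = P q0 + Pi.single κ0 (t - q0) :=
    ⟨ε0, hε0, fun t ht => hR0 t ⟨ht.1, ht⟩⟩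
  refine ⟨κ0, fun Q hQ => ?_⟩
  by_contra hcon
  set S : Set ℝ := {q | q ≤ Q ∧ ∃ κ, Reach P q0 κ0 q κ} with hS
  have hne : S.Nonempty := ⟨q0, hQ, κ0, Reach.base⟩
  have hbdd : BddAbove S := ⟨Q, fun q hq => hq.1⟩
  set s := sSup S with hs
  have hsQ : s ≤ Q := csSup_le hne (fun q hq => hq.1)
  have hs0 : q0 ≤ s := le_csSup hbdd ⟨hQ, κ0, Reach.base⟩
  obtain ⟨-, ε, hε, k, l, hL, hR, -⟩ := hP s hs0
  have hm : 0 < min ε 1 := lt_min hε one_pos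
  have hsS : ∃ κ, Reach P q0 κ0 s κ := by
    obtain ⟨q, ⟨hqQ, κ, hq⟩, hqs⟩ := exists_lt_of_lt_csSup hne (show s - min ε 1 < sSup S by rw [← hs]; linarith)
    have hqs' : q ≤ s := le_csSup hbdd ⟨hqQ, κ, hq⟩
    rcases eq_or_lt_of_le hqs' with rfl | hlt
    · exact ⟨κ, hq⟩
    · refine ⟨l, hq.extend hP hκ0 hlt (by linarith [min_le_right ε 1]) ?_⟩
      intro t ht
      have h1 := min_le_left ε 1
      have hq0 := hq.left.1
      rw [hL t ⟨hq0.trans ht.1, by linarith [ht.1], ht.2⟩, hL q ⟨hq0, by linarith, hqs'⟩, add_assoc,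
        ← Pi.single_add]
      congr 2
      ring
  obtain ⟨κ, hκ⟩ := hsS
  have hlt : s < Q := lt_of_le_of_ne hsQ (fun h => hcon ⟨κ, h ▸ hκ⟩)
  set r := min (s + min ε 1) Q with hr
  have hsr : s < r := lt_min (by linarith) hlt
  have hr1 : r ≤ s + min ε 1 := min_le_left _ _
  have : Reach P q0 κ0 r k := by
    refine hκ.extend hP hκ0 hsr (by linarith [min_le_right ε 1]) ?_
    intro t ht
    exact hR t ⟨hs0.trans ht.1, ht.1, by linarith [ht.2, min_le_left ε 1]⟩
  have := le_csSup hbdd (show r ∈ S from ⟨min_le_right _ _, k, this⟩)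
  linarith

/-- The scaled integer vector. -/
def bvec {n : ℕ} (d : Fin n → ℝ) (v : Fin n → ℤ) : EuclideanSpace ℝ (Fin n) :=
  WithLp.toLp 2 (fun l => d l * (v l : ℝ))

lemma bvec_sum {n : ℕ} (d : Fin n → ℝ) (c : Fin n → ℤ) (M : Fin n → Fin n → ℤ) :
    bvec d (∑ h, c h • M h) = ∑ h, (c h : ℝ) • bvec d (M h) := by
  ext l
  simp only [bvec, Finset.sum_apply, Pi.smul_apply, smul_eq_mul, Int.cast_sum, Int.cast_mul,
    WithLp.ofLp_sum, WithLp.ofLp_smul, Finset.mul_sum]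
  refine Finset.sum_congr rfl fun i _ => by ring

lemma bvec_det {n : ℕ} (d : Fin n → ℝ) (M : Matrix (Fin n) (Fin n) ℤ) (hM : M.det = 1) :
    (Matrix.of fun i j => bvec d (M i) j).det = ∏ l, d l := by
  have h1 : (Matrix.of fun i j => bvec d (M i) j) =
      Matrix.of fun i j => d j * (M.map (Int.castRingHom ℝ)) i j := by
    ext i j
    simp [bvec]
  rw [h1, Matrix.det_mul_row, ← RingHom.mapMatrix_apply, ← RingHom.map_det, hM]
  simp

lemma bvec_li {n : ℕ} (d : Fin n → ℝ) (hd : ∀ l, 0 < d l) (M : Matrix (Fin n) (Fin n) ℤ)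
    (hM : M.det = 1) : LinearIndependent ℝ (fun j => bvec d (M j)) := by
  have h := bvec_det d M hM
  have h2 : IsUnit (Matrix.of fun i j => bvec d (M i) j) := by
    rw [Matrix.isUnit_iff_isUnit_det, h]
    exact (Finset.prod_pos fun l _ => hd l).ne'.isUnit
  rw [← Matrix.linearIndependent_rows_iff_isUnit] at h2
  have h3 := h2.map' (WithLp.linearEquiv 2 ℝ (Fin n → ℝ)).symm.toLinearMap (LinearEquiv.ker _)
  exact h3

/-- number of indices on a level at least that of `j` -/
def cnt {n : ℕ} (m : Fin n → ℤ) (j : Fin n) : ℕ := (Finset.univ.filter fun h => m j ≤ m h).card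

lemma cnt_le {n : ℕ} (m : Fin n → ℤ) (j : Fin n) : (cnt m j : ℝ) ≤ n := by
  have := Finset.card_le_univ (Finset.univ.filter fun h => m j ≤ m h)
  rw [Fintype.card_fin] at this
  exact_mod_cast this

lemma one_le_cnt {n : ℕ} (m : Fin n → ℤ) (j : Fin n) : (1 : ℝ) ≤ cnt m j := by
  have : 0 < cnt m j := Finset.card_pos.2 ⟨j, by simp⟩
  exact_mod_cast this

lemma level_update {n : ℕ} {δ Δ : ℝ} (hδ : 0 < δ) (hΔ : Δ = n * δ) (m m' : Fin n → ℤ) (a : Fin n → ℝ)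
    (k : Fin n) (hlo : ∀ j, Δ * m j ≤ a j) (hhi : ∀ j, a j ≤ Δ * m j + δ * ((cnt m j : ℝ) - 1))
    (hm : ∀ j, j ≠ k → m' j = m j) (hk : m k < m' k) (a' : ℝ)
    (ha' : a' = Δ * m' k + δ * ((cnt m' k : ℝ) - 1)) :
    (∀ j, j ≠ k → δ ≤ |a j - a'|) ∧ (∀ j, j ≠ k → m' j ≤ m' k → a j < a') ∧ a k + δ ≤ a' ∧
    (∀ j, Δ * m' j ≤ Function.update a k a' j) ∧
    (∀ j, Function.update a k a' j ≤ Δ * m' j + δ * ((cnt m' j : ℝ) - 1)) := by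
  have hn : (0 : ℝ) ≤ n := Nat.cast_nonneg n
  have hΔ0 : 0 ≤ Δ := by rw [hΔ]; positivity
  have hhi' : ∀ j, a j ≤ Δ * m j + Δ - δ := by
    intro j
    have h1 := hhi j
    have h2 : δ * ((cnt m j : ℝ) - 1) ≤ δ * (n - 1) := by
      have := cnt_le m j
      gcongr
    rw [hΔ] at *
    linarith
  have ha1 : Δ * m' k ≤ a' := by
    have := one_le_cnt m' k
    have : 0 ≤ δ * ((cnt m' k : ℝ) - 1) := mul_nonneg hδ.le (by linarith)
    linarith
  have ha2 : a' ≤ Δ * m' k + Δ - δ := by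
    have h2 : δ * ((cnt m' k : ℝ) - 1) ≤ δ * (n - 1) := by
      have := cnt_le m' k
      gcongr
    rw [hΔ] at *
    linarith
  have hstep : ∀ r s : ℤ, r < s → Δ * r + Δ ≤ Δ * s := by
    intro r s h
    have : (r : ℝ) + 1 ≤ s := by exact_mod_cast h
    nlinarith
  have hlow : ∀ j, j ≠ k → m j ≤ m' k → a j + δ ≤ a' := by
    intro j hj h
    rcases lt_or_eq_of_le h with h | h
    · have := hhi' j
      have := hstep _ _ h
      linarith
    · have h1 : (cnt m j : ℝ) + 1 ≤ cnt m' k := by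
        have : cnt m j + 1 ≤ cnt m' k := by
          unfold cnt
          rw [Nat.succ_le_iff]
          apply Finset.card_lt_card
          rw [Finset.ssubset_iff_of_subset]
          · refine ⟨k, by simp, ?_⟩
            simp only [Finset.mem_filter, Finset.mem_univ, true_and, not_le]
            omega
          · intro i hi
            simp only [Finset.mem_filter, Finset.mem_univ, true_and] at hi ⊢
            by_cases hik : i = k
            · subst hik; exact le_rfl
            · rw [hm i hik]; omega
        exact_mod_cast this
      have h2 := hhi j
      have h3 : δ * ((cnt m j : ℝ) + 1) ≤ δ * cnt m' k := by gcongr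
      rw [ha', ← h]
      linarith
  have hhigh : ∀ j, j ≠ k → m' k < m j → a' + δ ≤ a j := by
    intro j hj h
    have := hlo j
    have := hstep _ _ h
    linarith
  refine ⟨?_, ?_, ?_, ?_, ?_⟩
  · intro j hj
    rcases le_or_gt (m j) (m' k) with h | h
    · have := hlow j hj h
      rw [abs_of_nonpos (by linarith)]
      linarith
    · have := hhigh j hj h
      rw [abs_of_nonneg (by linarith)]
      linarith
  · intro j hj h
    rw [hm j hj] at h
    have := hlow j hj h
    linarith
  · have := hhi' k
    have := hstep _ _ hk
    linarith
  · intro j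
    by_cases hj : j = k
    · subst hj; simpa using ha1
    · rw [Function.update_of_ne hj, hm j hj]; exact hlo j
  · intro j
    by_cases hj : j = k
    · subst hj; simp [ha']
    · rw [Function.update_of_ne hj, hm j hj]
      refine (hhi j).trans ?_
      have : (cnt m j : ℝ) ≤ cnt m' j := by
        have : cnt m j ≤ cnt m' j := by
          apply Finset.card_le_card
          intro i hi
          simp only [Finset.mem_filter, Finset.mem_univ, true_and] at hi ⊢
          rw [hm j hj]
          by_cases hik : i = k
          · subst hik; exact hi.trans hk.le
          · rw [hm i hik]; exact hi
        exact_mod_cast this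
      gcongr

lemma level_start {n : ℕ} {δ Δ : ℝ} (hδ : 0 < δ) (hΔ : Δ = n * δ) (m : Fin n → ℤ) (k : Fin n) :
    ∃ a : Fin n → ℝ, (∀ j, Δ * m j ≤ a j) ∧ (∀ j, a j ≤ Δ * m j + δ * ((cnt m j : ℝ) - 1)) ∧
      (∀ i j, i ≠ j → δ ≤ |a i - a j|) ∧ (∀ j, j ≠ k → m j ≤ m k → a j < a k) := by
  set e : Fin n → ℕ := fun j => if j = k then n else j with he
  have heinj : ∀ i j, i ≠ j → e i ≠ e j := by
    intro i j hij h
    simp only [he] at h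
    have := i.2
    have := j.2
    split_ifs at h with h1 h2 h2
    · exact hij (h1.trans h2.symm)
    · omega
    · omega
    · exact hij (Fin.ext h)
  set R : Fin n → Finset (Fin n) := fun j =>
    Finset.univ.filter fun h => m j < m h ∨ (m h = m j ∧ e h < e j) with hR
  have hRc : ∀ j, ((R j).card : ℝ) ≤ (cnt m j : ℝ) - 1 := by
    intro j
    have : (R j).card + 1 ≤ cnt m j := by
      rw [Nat.succ_le_iff]
      apply Finset.card_lt_card
      rw [Finset.ssubset_iff_of_subset]
      · exact ⟨j, by simp, by simp [hR]⟩
      · intro i hi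
        simp only [hR, Finset.mem_filter, Finset.mem_univ, true_and] at hi ⊢
        omega
    have : ((R j).card : ℝ) + 1 ≤ cnt m j := by exact_mod_cast this
    linarith
  have hgap : ∀ i j, i ≠ j → (m i < m j ∨ (m i = m j ∧ e i < e j)) →
      (Δ * m i + δ * (R i).card) + δ ≤ Δ * m j + δ * (R j).card := by
    intro i j hij h
    rcases h with h | ⟨h, h'⟩
    · have h1 : (m i : ℝ) + 1 ≤ m j := by exact_mod_cast h
      have h2 : δ * (R i).card ≤ δ * (n - 1) := by
        have := hRc i
        have := cnt_le m i
        gcongr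
        linarith
      have h3 : 0 ≤ δ * (R j).card := by positivity
      have h4 : (n * δ) * ((m i : ℝ) + 1) ≤ (n * δ) * m j := by gcongr
      rw [hΔ]
      nlinarith
    · have h1 : ((R i).card : ℝ) + 1 ≤ (R j).card := by
        have : (R i).card + 1 ≤ (R j).card := by
          rw [Nat.succ_le_iff]
          apply Finset.card_lt_card
          rw [Finset.ssubset_iff_of_subset]
          · exact ⟨i, by simp [hR, h, h'], by simp [hR]⟩
          · intro g hg
            simp only [hR, Finset.mem_filter, Finset.mem_univ, true_and] at hg ⊢
            omega
        exact_mod_cast this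
      have : δ * (((R i).card : ℝ) + 1) ≤ δ * (R j).card := by gcongr
      rw [h]
      linarith
  refine ⟨fun j => Δ * m j + δ * (R j).card, ?_, ?_, ?_, ?_⟩
  · intro j
    have : 0 ≤ δ * (R j).card := by positivity
    simp only
    linarith
  · intro j
    have := hRc j
    simp only
    gcongr
  · intro i j hij
    simp only
    have := heinj i j hij
    by_cases h : m i < m j ∨ (m i = m j ∧ e i < e j)
    · have := hgap i j hij h
      rw [abs_of_nonpos (by linarith)]
      linarith
    · have := hgap j i hij.symm (by omega)
      rw [abs_of_nonneg (by linarith)]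
      linarith
  · intro j hj h
    simp only
    have h1 : e j < e k := by
      simp only [he, if_neg hj, if_true]
      exact j.2
    have := hgap j k hj (by omega)
    linarith

/-- record at time `t` -/
def Rec {n : ℕ} (d : Fin n → ℝ) (P : ℝ → Fin n → ℝ) (Kn K W : ℝ) (u : EuclideanSpace ℝ (Fin n))
    (t : ℝ) : Prop :=
  ∃ M : Matrix (Fin n) (Fin n) ℤ, M.det = 1 ∧ ∀ j, ‖bvec d (M j)‖ ≤ Kn * Real.exp (P t j) ∧
    |⟪u, bvec d (M j)⟫| ≤ Real.exp (P t j) * (K * Real.exp (-t) - W)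

/-- level of the coordinates -/
def lev {n : ℕ} (Δ : ℝ) (p : Fin n → ℝ) : Fin n → ℤ := fun j => ⌊p j / Δ⌋

lemma lev_le {n : ℕ} {Δ : ℝ} (hΔ : 0 < Δ) (p : Fin n → ℝ) (j : Fin n) : Δ * lev Δ p j ≤ p j := by
  have := Int.floor_le (p j / Δ)
  rw [le_div_iff₀ hΔ] at this
  unfold lev
  linarith

lemma lt_lev {n : ℕ} {Δ : ℝ} (hΔ : 0 < Δ) (p : Fin n → ℝ) (j : Fin n) : p j < Δ * lev Δ p j + Δ := by
  have := Int.lt_floor_add_one (p j / Δ)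
  rw [div_lt_iff₀ hΔ] at this
  unfold lev
  linarith

lemma lev_mono {n : ℕ} {Δ : ℝ} (hΔ : 0 < Δ) (p p' : Fin n → ℝ) (i j : Fin n) (h : p i ≤ p' j) :
    lev Δ p i ≤ lev Δ p' j := by
  apply Int.floor_le_floor
  gcongr

/-- State of the construction, without history. -/
structure St {n : ℕ} (δ Δ : ℝ) (d : Fin n → ℝ) (u0 : EuclideanSpace ℝ (Fin n)) (m : Fin n → ℤ)
    (κ : Fin n) (M : Matrix (Fin n) (Fin n) ℤ) (z : Fin n → EuclideanSpace ℝ (Fin n))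
    (u : EuclideanSpace ℝ (Fin n)) (a : Fin n → ℝ) (k : Fin n) : Prop where
  det : M.det = 1
  inv : RInv δ u0 (fun j => bvec d (M j)) z u a k
  lo : ∀ j, Δ * m j ≤ a j
  hi : ∀ j, a j ≤ Δ * m j + δ * ((cnt m j : ℝ) - 1)
  mlab : m κ ≤ m k
  ak : ∀ j, j ≠ k → m j ≤ m k → a j < a k

section
variable {n : ℕ} {δ Δ : ℝ} (hδ : 0 < δ) (hΔ : Δ = n * δ) (d : Fin n → ℝ) (hd : ∀ l, 0 < d l)
  (u0 : EuclideanSpace ℝ (Fin n)) (hu0 : ‖u0‖ = 1)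

lemma St.hi' {m : Fin n → ℤ} {κ : Fin n} {M : Matrix (Fin n) (Fin n) ℤ}
    {z : Fin n → EuclideanSpace ℝ (Fin n)} {u : EuclideanSpace ℝ (Fin n)} {a : Fin n → ℝ} {k : Fin n}
    (hδ : 0 < δ) (hΔ : Δ = n * δ) (hS : St δ Δ d u0 m κ M z u a k) (j : Fin n) :
    a j ≤ Δ * m j + Δ := by
  have h1 := hS.hi j
  have h2 : δ * ((cnt m j : ℝ) - 1) ≤ δ * (n - 1) := by
    have := cnt_le m j
    gcongr
  rw [hΔ] at *
  linarith

lemma St.rec_ext {κ : Fin n} {M : Matrix (Fin n) (Fin n) ℤ}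
    {z : Fin n → EuclideanSpace ℝ (Fin n)} {u : EuclideanSpace ℝ (Fin n)} {a : Fin n → ℝ} {k : Fin n}
    (hδ : 0 < δ) (hΔ : Δ = n * δ) (hn : 0 < n) (hd : ∀ l, 0 < d l) (hu0 : ‖u0‖ = 1)
    {P : ℝ → Fin n → ℝ} {q t : ℝ}
    (hS : St δ Δ d u0 (lev Δ (P q)) κ M z u a k) (hsum : ∑ j, P q j = q) (ht : t ≤ q + 1)
    (hP : ∀ j, P q j ≤ P t j) {Kn K L C2 : ℝ} (hC2 : C2 = n.factorial * 4 ^ n * ∏ l, d l)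
    (hKn : Kn = 2 * Real.exp Δ) (hL : 0 ≤ L)
    (hK : K = (C2 * Real.exp Δ + L) * Real.exp (n * Δ + 1)) :
    Rec d P Kn K (L * Real.exp (-∑ j, a j)) u t := by
  have hn' : (0 : ℝ) < n := by exact_mod_cast hn
  have hΔ0 : 0 < Δ := by rw [hΔ]; positivity
  have hC20 : 0 ≤ C2 := by
    rw [hC2]
    have : 0 ≤ ∏ l, d l := Finset.prod_nonneg fun l _ => (hd l).le
    positivity
  have haP : ∀ j, a j ≤ P t j + Δ := by
    intro j
    have h1 := hS.hi' d u0 hδ hΔ j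
    have h2 := lev_le hΔ0 (P q) j
    linarith [hP j]
  have hA : t - (n * Δ + 1) ≤ ∑ j, a j := by
    have h1 : ∑ j, (P q j - Δ) ≤ ∑ j, a j := by
      apply Finset.sum_le_sum
      intro j _
      have := hS.lo j
      have := lt_lev hΔ0 (P q) j
      linarith
    rw [Finset.sum_sub_distrib, hsum] at h1
    simp at h1
    linarith
  have hKA : (C2 * Real.exp Δ + L) * Real.exp (-∑ j, a j) ≤ K * Real.exp (-t) := by
    rw [hK, mul_assoc, ← Real.exp_add]
    gcongr
    linarith
  refine ⟨M, hS.det, fun j => ⟨?_, ?_⟩⟩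
  · have h1 : ‖bvec d (M j)‖ ≤ 2 * Real.exp (a j) := by
      by_cases hj : j = k
      · subst hj
        refine hS.inv.nk.trans ?_
        gcongr
        linarith
      · exact hS.inv.nx j hj
    refine h1.trans ?_
    rw [hKn, mul_assoc, ← Real.exp_add]
    gcongr
    linarith [haP j]
  · by_cases hj : j = k
    · subst hj
      have h1 := pairing_bound _ z u u0 a j δ hδ hS.inv hu0 _ (Finset.prod_pos fun l _ => hd l)
        (bvec_det d M hS.det)
      rw [← hC2] at h1
      refine h1.trans ?_
      have h2 : C2 * Real.exp (a j - ∑ j, a j) ≤ C2 * Real.exp (P t j + Δ - ∑ j, a j) := by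
        gcongr
        exact haP j
      refine h2.trans ?_
      have h3 : C2 * Real.exp (P t j + Δ - ∑ j, a j) =
          Real.exp (P t j) * (C2 * Real.exp Δ * Real.exp (-∑ j, a j)) := by
        rw [sub_eq_add_neg, Real.exp_add, Real.exp_add]; ring
      rw [h3]
      gcongr
      linarith
    · have h0 : ⟪u, bvec d (M j)⟫ = 0 := hS.inv.uo j hj
      rw [h0, abs_zero]
      apply mul_nonneg (Real.exp_pos _).le
      have : 0 ≤ C2 * Real.exp Δ * Real.exp (-∑ j, a j) := by positivity
      linarith

lemma Rec.mono {P : ℝ → Fin n → ℝ} {Kn K W W' ρ t : ℝ} {u u' : EuclideanSpace ℝ (Fin n)}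
    (h : Rec d P Kn K W u t) (hu : ‖u' - u‖ ≤ ρ) (hρ : W' + Kn * ρ ≤ W) :
    Rec d P Kn K W' u' t := by
  obtain ⟨M, hM, hr⟩ := h
  refine ⟨M, hM, fun j => ⟨(hr j).1, ?_⟩⟩
  obtain ⟨h1, h2⟩ := hr j
  have e1 : ⟪u', bvec d (M j)⟫ = ⟪u, bvec d (M j)⟫ + ⟪u' - u, bvec d (M j)⟫ := by
    rw [← inner_add_left]; congr 1; abel
  have e2 : |⟪u' - u, bvec d (M j)⟫| ≤ ρ * (Kn * Real.exp (P t j)) :=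
    (abs_real_inner_le_norm _ _).trans (mul_le_mul hu h1 (norm_nonneg _) ((norm_nonneg _).trans hu))
  rw [e1]
  refine (abs_add_le _ _).trans ?_
  have := mul_le_mul_of_nonneg_left hρ (Real.exp_pos (P t j)).le
  nlinarith

lemma St.step {m m' : Fin n → ℤ} {κ κ' : Fin n} {M : Matrix (Fin n) (Fin n) ℤ}
    {z : Fin n → EuclideanSpace ℝ (Fin n)} {u : EuclideanSpace ℝ (Fin n)} {a : Fin n → ℝ} {k : Fin n}
    (hδ : 0 < δ) (hΔ : Δ = n * δ) (hd : ∀ l, 0 < d l) (hu0 : ‖u0‖ = 1)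
    (hδ1 : 20 * (n : ℝ) * Real.exp (-δ) ≤ 1) (hD : 8 * (2 * 18 ^ n) * Real.exp (-δ) ≤ 1 / 2)
    (hS : St δ Δ d u0 m κ M z u a k) (hκ : m κ' ≤ m κ) (hm : ∀ j, j ≠ κ' → m' j = m j)
    (hm' : m κ' ≤ m' κ') {C2 : ℝ} (hC2 : C2 = n.factorial * 4 ^ n * ∏ l, d l) :
    ∃ M' z' u' a' k', St δ Δ d u0 m' κ' M' z' u' a' k' ∧
      ((u' = u ∧ ∑ j, a j ≤ ∑ j, a' j) ∨ (‖u' - u‖ ≤ C2 * (2 * 18 ^ n) * Real.exp (-∑ j, a j) ∧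
        ∑ j, a j + δ ≤ ∑ j, a' j)) := by
  rcases eq_or_lt_of_le hm' with hEq | hlt
  · have : m' = m := by
      funext j
      by_cases hj : j = κ'
      · subst hj; exact hEq.symm
      · exact hm j hj
    subst this
    exact ⟨M, z, u, a, k, ⟨hS.det, hS.inv, hS.lo, hS.hi, hκ.trans hS.mlab, hS.ak⟩, Or.inl ⟨rfl, le_rfl⟩⟩
  · set b : ℝ := Δ * m' κ' + δ * ((cnt m' κ' : ℝ) - 1) with hb
    obtain ⟨g1, g2, g3, g4, g5⟩ := level_update hδ hΔ m m' a κ' hS.lo hS.hi hm hlt b hb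
    have hsum : ∑ j, a j + δ ≤ ∑ j, Function.update a κ' b j := by
      rw [Finset.sum_update_of_mem (Finset.mem_univ κ'), Finset.sdiff_singleton_eq_erase,
        ← Finset.add_sum_erase _ a (Finset.mem_univ κ')]
      linarith
    have g6 : ∀ j, j ≠ κ' → m' j ≤ m' κ' → Function.update a κ' b j < Function.update a κ' b κ' := by
      intro j hj h
      rw [Function.update_self, Function.update_of_ne hj]
      exact g2 j hj h
    by_cases hk : κ' = k
    · subst hk
      refine ⟨M, z, u, Function.update a κ' b, κ', ⟨hS.det, ?_, g4, g5, le_rfl, g6⟩,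
        Or.inl ⟨rfl, by linarith⟩⟩
      exact rise_step δ u0 _ z u a κ' hS.inv b (by linarith) g1
    · have hak := hS.ak κ' hk (hκ.trans hS.mlab)
      obtain ⟨c, z', u', hc, hI', hu'⟩ := switch_step δ hδ hδ1 hD u0 _ z u a k hS.inv
        (bvec_li d hd M hS.det) κ' hk hak b g3 g1
      refine ⟨M.updateRow k (∑ h, c h • M h), z', u', Function.update a κ' b, κ',
        ⟨?_, ?_, g4, g5, le_rfl, g6⟩, Or.inr ⟨?_, hsum⟩⟩
      · rw [Matrix.det_updateRow_sum, hc, hS.det, one_smul]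
      · have : (fun j => bvec d (M.updateRow k (∑ h, c h • M h) j)) =
            Function.update (fun j => bvec d (M j)) k (∑ h, (c h : ℝ) • bvec d (M h)) := by
          funext j
          by_cases hj : j = k
          · subst hj
            rw [Matrix.updateRow_self, Function.update_self]
            exact bvec_sum d c M
          · rw [Matrix.updateRow_ne hj, Function.update_of_ne hj]
        rw [this]
        exact hI'
      · have h1 := pairing_bound _ z u u0 a k δ hδ hS.inv hu0 _ (Finset.prod_pos fun l _ => hd l)
          (bvec_det d M hS.det)
        rw [← hC2] at h1
        refine hu'.trans ?_
        calc _ ≤ (C2 * Real.exp (a k - ∑ j, a j)) * (2 * 18 ^ n) * Real.exp (-a k) := by gcongr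
          _ = C2 * (2 * 18 ^ n) * (Real.exp (a k - ∑ j, a j) * Real.exp (-a k)) := by ring
          _ = _ := by
            rw [← Real.exp_add]; congr 2; ring
end

lemma St.start {n : ℕ} {δ Δ : ℝ} (hδ : 0 < δ) (hΔ : Δ = n * δ) (m : Fin n → ℤ) (κ : Fin n) :
    ∃ d : Fin n → ℝ, (∀ l, 0 < d l) ∧ ∃ u0, ‖u0‖ = 1 ∧ ∃ M z u a k, St δ Δ d u0 m κ M z u a k := by
  obtain ⟨a, h1, h2, h3, h4⟩ := level_start hδ hΔ m κ
  set d : Fin n → ℝ := fun l => if l = κ then Real.exp (a l - δ - 1) else Real.exp (a l) with hd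
  have hdpos : ∀ l, 0 < d l := by
    intro l; simp only [hd]; split_ifs <;> positivity
  have hx : ∀ j, bvec d ((1 : Matrix (Fin n) (Fin n) ℤ) j) = EuclideanSpace.single j (d j) := by
    intro j
    ext l
    simp only [bvec, Matrix.one_apply, PiLp.single_apply, eq_comm]
    split_ifs with h
    · simp [h]
    · simp
  have hin : ∀ i j : Fin n, ∀ r s : ℝ, i ≠ j →
      ⟪EuclideanSpace.single i r, EuclideanSpace.single j s⟫ = 0 := by
    intro i j r s hij
    simp [EuclideanSpace.inner_single_left, hij]
  have hin' : ∀ i : Fin n, ∀ r s : ℝ,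
      ⟪EuclideanSpace.single i r, EuclideanSpace.single i s⟫ = r * s := by
    intro i r s
    simp [EuclideanSpace.inner_single_left]
  refine ⟨d, hdpos, EuclideanSpace.single κ 1, by simp, 1, fun j => EuclideanSpace.single j (Real.exp (-a j)),
    EuclideanSpace.single κ 1, a, κ, ⟨Matrix.det_one, ?_, h1, h2, le_rfl, h4⟩⟩
  refine ⟨?_, ?_, h3, ?_, ?_, ?_, ?_, ?_, ?_⟩
  · intro j hj
    simp only [hx]
    simp only [PiLp.norm_single, Real.norm_eq_abs, abs_of_pos (hdpos j)]
    simp only [hd, if_neg hj]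
    linarith [Real.exp_pos (a j)]
  · simp only [hx]
    simp only [PiLp.norm_single, Real.norm_eq_abs, abs_of_pos (hdpos κ)]
    simp only [hd, if_true]
    have : Real.exp (a κ - δ - 1) ≤ Real.exp (a κ - δ) := Real.exp_le_exp.2 (by linarith)
    linarith [Real.exp_pos (a κ - δ)]
  · intro j hj
    simp only [hx, hin']
    simp only [hd, if_neg hj]
    rw [← Real.exp_add]; simp
  · intro j hj h hh hlt
    simp only [hx]
    apply hin
    rintro rfl
    exact lt_irrefl _ hlt
  · intro j hj
    simp only [PiLp.norm_single, Real.norm_eq_abs, Real.abs_exp, ← Real.exp_add]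
    norm_num
  · intro j hj hlt
    simp only [hx, hin j κ _ _ hj]
    simp only [PiLp.norm_single, Real.norm_eq_abs, Real.abs_exp, ← Real.exp_add]
    norm_num
  · intro j hj
    simp only [hx]
    exact hin _ _ _ _ hj.symm
  · simp only [hx, hin', sub_self, norm_zero, one_mul, abs_of_pos (hdpos κ)]
    simp only [hd, if_true, ← Real.exp_add]
    have h : -a κ + δ + (a κ - δ - 1) = -1 := by ring
    rw [h, zero_add, Real.exp_neg, one_div]
    apply inv_anti₀ (by norm_num)
    have := Real.add_one_le_exp (1 : ℝ)
    linarith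

lemma exists_delta (n : ℕ) : ∃ δ : ℝ, 0 < δ ∧ 20 * (n : ℝ) * Real.exp (-δ) ≤ 1 ∧
    8 * (2 * 18 ^ n) * Real.exp (-δ) ≤ 1 / 2 ∧ Real.exp (-δ) ≤ 1 / 2 := by
  have hX : (1 : ℝ) < 20 * n + 32 * 18 ^ n + 2 := by
    have : (0 : ℝ) ≤ 20 * n + 32 * 18 ^ n := by positivity
    linarith
  refine ⟨Real.log (20 * n + 32 * 18 ^ n + 2), Real.log_pos hX, ?_⟩
  have h0 : (0 : ℝ) < 20 * n + 32 * 18 ^ n + 2 := by linarith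
  rw [Real.exp_neg, Real.exp_log h0]
  have h1 : (0 : ℝ) ≤ n := Nat.cast_nonneg n
  have h2 : (0 : ℝ) < 18 ^ n := by positivity
  rw [← div_eq_mul_inv, ← div_eq_mul_inv, ← one_div]
  refine ⟨?_, ?_, ?_⟩
  · rw [div_le_one h0]; linarith
  · rw [div_le_div_iff₀ h0 (by norm_num)]; linarith
  · rw [div_le_div_iff₀ h0 (by norm_num)]; linarith

lemma main_finite {n : ℕ} (hn : 0 < n) {P : ℝ → Fin n → ℝ} {q0 : ℝ} (hP : IsNSystem n (Ici q0) P) :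
    ∃ d : Fin n → ℝ, (∀ l, 0 < d l) ∧ ∃ Kn K : ℝ, ∀ Q, q0 ≤ Q →
      ∃ u : EuclideanSpace ℝ (Fin n), 1 / 2 ≤ ‖u‖ ∧ ∀ t ∈ Icc q0 Q, Rec d P Kn K 0 u t := by
  obtain ⟨κ0, hreach⟩ := reach_all hP
  obtain ⟨δ, hδ, hδ1, hδ2, hδ3⟩ := exists_delta n
  obtain ⟨Δ, hΔ⟩ : ∃ Δ : ℝ, Δ = n * δ := ⟨_, rfl⟩
  have hn' : (0 : ℝ) < n := by exact_mod_cast hn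
  have hΔ0 : 0 < Δ := by rw [hΔ]; positivity
  obtain ⟨d, hd, u0, hu0, hstart⟩ := St.start hδ hΔ (lev Δ (P q0)) κ0
  obtain ⟨C2, hC2⟩ : ∃ C2 : ℝ, C2 = n.factorial * 4 ^ n * ∏ l, d l := ⟨_, rfl⟩
  have hC20 : 0 ≤ C2 := by
    rw [hC2]
    have : 0 ≤ ∏ l, d l := Finset.prod_nonneg fun l _ => (hd l).le
    positivity
  obtain ⟨Kn, hKn⟩ : ∃ Kn : ℝ, Kn = 2 * Real.exp Δ := ⟨_, rfl⟩
  have hKn0 : 0 ≤ Kn := by rw [hKn]; positivity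
  obtain ⟨L, hLdef⟩ : ∃ L : ℝ, L = 2 * (Kn * (C2 * (2 * 18 ^ n))) := ⟨_, rfl⟩
  have hL : 0 ≤ L := by rw [hLdef]; positivity
  obtain ⟨K, hK⟩ : ∃ K : ℝ, K = (C2 * Real.exp Δ + L) * Real.exp (n * Δ + 1) := ⟨_, rfl⟩
  have key : ∀ q κ, Reach P q0 κ0 q κ → ∃ M z u a k, St δ Δ d u0 (lev Δ (P q)) κ M z u a k ∧
      ∀ t ∈ Icc q0 q, Rec d P Kn K (L * Real.exp (-∑ j, a j)) u t := by
    intro q κ h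
    induction h with
    | base =>
      obtain ⟨M, z, u, a, k, hS⟩ := hstart
      refine ⟨M, z, u, a, k, hS, fun t ht => ?_⟩
      have : t = q0 := le_antisymm ht.2 ht.1
      subst this
      exact hS.rec_ext d u0 hδ hΔ hn hd hu0 (hP t (mem_Ici.2 le_rfl)).1.2.2 (by linarith) (fun j => le_rfl)
        hC2 hKn hL hK
    | step q q' κ κ' hr h1 h2 h3 h4 ih =>
      obtain ⟨M, z, u, a, k, hS, hrec⟩ := ih
      have hq := hr.left.1
      have hmono : ∀ t ∈ Icc q q', ∀ j, P q j ≤ P t j := by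
        intro t ht j
        rw [h3 t ht]
        have : (0 : ℝ) ≤ (Pi.single κ' (t - q) : Fin n → ℝ) j := by
          by_cases hj : j = κ'
          · subst hj; simp [ht.1]
          · simp [Pi.single_eq_of_ne hj]
        simp only [Pi.add_apply]
        linarith
      have hrec' : ∀ t ∈ Icc q0 q', Rec d P Kn K (L * Real.exp (-∑ j, a j)) u t := by
        intro t ht
        rcases le_total t q with htq | htq
        · exact hrec t ⟨ht.1, htq⟩
        · exact hS.rec_ext d u0 hδ hΔ hn hd hu0 (hP q hq).1.2.2 (by linarith [ht.2])
            (hmono t ⟨htq, ht.2⟩) hC2 hKn hL hK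
      have hother : ∀ j, j ≠ κ' → lev Δ (P q') j = lev Δ (P q) j := by
        intro j hj
        unfold lev
        rw [h3 q' ⟨h1.le, le_rfl⟩]
        simp [Pi.single_eq_of_ne hj]
      obtain ⟨M', z', u', a', k', hS', hcase⟩ := hS.step d u0 hδ hΔ hd hu0 hδ1 hδ2
        (m' := lev Δ (P q')) (lev_mono hΔ0 _ _ _ _ h4) hother
        (lev_mono hΔ0 _ _ _ _ (hmono q' ⟨h1.le, le_rfl⟩ κ')) hC2
      refine ⟨M', z', u', a', k', hS', fun t ht => ?_⟩
      rcases hcase with ⟨rfl, hA⟩ | ⟨hu, hA⟩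
      · refine (hrec' t ht).mono d (ρ := 0) (by simp) ?_
        rw [mul_zero, add_zero]
        gcongr
      · refine (hrec' t ht).mono d hu ?_
        have e1 : Real.exp (-∑ j, a' j) ≤ Real.exp (-∑ j, a j) * (1 / 2) := by
          calc _ ≤ Real.exp (-∑ j, a j + -δ) := Real.exp_le_exp.2 (by linarith)
            _ = Real.exp (-∑ j, a j) * Real.exp (-δ) := Real.exp_add _ _
            _ ≤ _ := by gcongr
        have e2 : L * Real.exp (-∑ j, a' j) ≤ L * (Real.exp (-∑ j, a j) * (1 / 2)) := by gcongr
        have e3 : Kn * (C2 * (2 * 18 ^ n) * Real.exp (-∑ j, a j)) = L * (Real.exp (-∑ j, a j) * (1 / 2)) := by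
          rw [hLdef]; ring
        rw [e3]
        linarith
  refine ⟨d, hd, Kn, K, fun Q hQ => ?_⟩
  obtain ⟨κ, hκ⟩ := hreach Q hQ
  obtain ⟨M, z, u, a, k, hS, hrec⟩ := key Q κ hκ
  refine ⟨u, ?_, fun t ht => (hrec t ht).mono d (ρ := 0) (by simp) ?_⟩
  · have h1 := hS.inv.un
    have h2 : 0 ≤ Real.exp (-a k + δ) * |⟪u, bvec d (M k)⟫| := by positivity
    have h3 : ‖u0‖ ≤ ‖u - u0‖ + ‖u‖ := by
      have := norm_sub_le u (u - u0)
      rw [sub_sub_cancel] at this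
      linarith
    linarith
  · rw [mul_zero, add_zero]
    positivity

lemma rec_closed {n : ℕ} (d : Fin n → ℝ) (hd : ∀ l, 0 < d l) (P : ℝ → Fin n → ℝ) (Kn K t : ℝ) :
    IsClosed {u : EuclideanSpace ℝ (Fin n) | Rec d P Kn K 0 u t} := by
  set F : Set (Fin n → Fin n → ℤ) := {M | ∀ j, ‖bvec d (M j)‖ ≤ Kn * Real.exp (P t j)} with hF
  have hfin : F.Finite := by
    refine (Set.finite_Icc (fun j l => -⌈Kn * Real.exp (P t j) / d l⌉ : Fin n → Fin n → ℤ)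
      (fun j l => ⌈Kn * Real.exp (P t j) / d l⌉)).subset ?_
    intro M hM
    have key : ∀ j l, |(M j l : ℝ)| ≤ ⌈Kn * Real.exp (P t j) / d l⌉ := by
      intro j l
      have h1 := (PiLp.norm_apply_le (bvec d (M j)) l).trans (hM j)
      simp only [bvec, Real.norm_eq_abs, abs_mul, abs_of_pos (hd l)] at h1
      refine le_trans ?_ (Int.le_ceil _)
      rw [le_div_iff₀ (hd l)]
      linarith
    constructor
    · intro j l
      have := (abs_le.1 (key j l)).1
      exact_mod_cast this
    · intro j l
      have := (abs_le.1 (key j l)).2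
      exact_mod_cast this
  have hfin2 : ({M : Matrix (Fin n) (Fin n) ℤ | M.det = 1 ∧ ∀ j, ‖bvec d (M j)‖ ≤ Kn * Real.exp (P t j)}).Finite :=
    hfin.subset fun M hM => hM.2
  have : {u : EuclideanSpace ℝ (Fin n) | Rec d P Kn K 0 u t} =
      ⋃ M ∈ {M : Matrix (Fin n) (Fin n) ℤ | M.det = 1 ∧ ∀ j, ‖bvec d (M j)‖ ≤ Kn * Real.exp (P t j)},
        {u : EuclideanSpace ℝ (Fin n) | ∀ j, |⟪u, bvec d (M j)⟫| ≤ Real.exp (P t j) * (K * Real.exp (-t) - 0)} := by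
    ext u
    simp only [Rec, Set.mem_ofPred_eq, mem_iUnion, exists_prop]
    constructor
    · rintro ⟨M, h1, h2⟩
      exact ⟨M, ⟨h1, fun j => (h2 j).1⟩, fun j => (h2 j).2⟩
    · rintro ⟨M, ⟨h1, h2⟩, h3⟩
      exact ⟨M, h1, fun j => ⟨h2 j, h3 j⟩⟩
  rw [this]
  refine hfin2.isClosed_biUnion fun M _ => ?_
  rw [Set.ofPred_forall]
  refine isClosed_iInter fun j => ?_
  apply isClosed_le
  · fun_prop
  · fun_prop

lemma main_inf {n : ℕ} (hn : 0 < n) {P : ℝ → Fin n → ℝ} {q0 : ℝ} (hP : IsNSystem n (Ici q0) P) :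
    ∃ d : Fin n → ℝ, (∀ l, 0 < d l) ∧ ∃ Kn K : ℝ, 
      ∃ u : EuclideanSpace ℝ (Fin n), ‖u‖ = 1 ∧ ∀ t, q0 ≤ t → Rec d P Kn K 0 u t := by
  obtain ⟨d, hd, Kn, K, h⟩ := main_finite hn hP
  refine ⟨d, hd, Kn, 2 * K, ?_⟩
  have := (isCompact_sphere (0 : EuclideanSpace ℝ (Fin n)) 1).inter_iInter_nonempty
    (fun t : Ici q0 => {u : EuclideanSpace ℝ (Fin n) | Rec d P Kn (2 * K) 0 u t})
    (fun t => rec_closed d hd P Kn (2 * K) t) ?_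
  · obtain ⟨u, hu, hu2⟩ := this
    refine ⟨u, by simpa using hu, fun t ht => ?_⟩
    exact mem_iInter.1 hu2 ⟨t, ht⟩
  · intro s
    obtain ⟨Q, hQ0, hQ⟩ : ∃ Q, q0 ≤ Q ∧ ∀ t ∈ s, (t : ℝ) ≤ Q := by
      obtain ⟨Q, hQ⟩ := (s.image (fun t : Ici q0 => (t : ℝ))).bddAbove
      refine ⟨max q0 Q, le_max_left _ _, fun t ht => le_max_of_le_right (hQ ?_)⟩
      simp only [Finset.coe_image, mem_image, Finset.mem_coe]
      exact ⟨t, ht, rfl⟩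
    obtain ⟨u, hu, hr⟩ := h Q hQ0
    have hu0 : 0 < ‖u‖ := by linarith
    refine ⟨‖u‖⁻¹ • u, ?_, ?_⟩
    · simp [norm_smul, hu0.ne']
    · simp only [mem_iInter]
      intro t ht
      obtain ⟨M, hM, hj⟩ := hr t ⟨t.2, hQ t ht⟩
      refine ⟨M, hM, fun j => ⟨(hj j).1, ?_⟩⟩
      have h1 := (hj j).2
      rw [real_inner_smul_left, abs_mul, abs_of_pos (inv_pos.2 hu0)]
      have h2 : ‖u‖⁻¹ ≤ 2 := by
        rw [inv_le_comm₀ hu0 (by norm_num)]; linarith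
      calc _ ≤ 2 * (Real.exp (P t j) * (K * Real.exp (-t) - 0)) :=
            mul_le_mul h2 h1 (abs_nonneg _) (by norm_num)
        _ = _ := by ring

/-- integer vector as a real vector -/
def ivec {n : ℕ} (v : Fin n → ℤ) : EuclideanSpace ℝ (Fin n) := WithLp.toLp 2 (fun l => (v l : ℝ))

lemma main_exists {n : ℕ} (hn : 0 < n) {P : ℝ → Fin n → ℝ} {q0 : ℝ} (hP : IsNSystem n (Ici q0) P) :
    ∃ u : EuclideanSpace ℝ (Fin n), u ≠ 0 ∧ ∃ K : ℝ, 1 ≤ K ∧ ∀ q, q0 ≤ q →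
      ∃ M : Matrix (Fin n) (Fin n) ℤ, M.det = 1 ∧ ∀ j, ‖ivec (M j)‖ ≤ K * Real.exp (P q j) ∧
        |⟪ivec (M j), u⟫| ≤ K * Real.exp (P q j) * Real.exp (-q) := by
  obtain ⟨d, hd, Kn, K, u, hu, hr⟩ := main_inf hn hP
  have hnorm : ∀ v : Fin n → ℤ, ‖ivec v‖ ≤ (∑ l, (d l)⁻¹) * ‖bvec d v‖ := by
    intro v
    have hc : ∀ l, (d l)⁻¹ ≤ ∑ l, (d l)⁻¹ := fun l =>
      Finset.single_le_sum (f := fun l => (d l)⁻¹) (fun i _ => (inv_pos.2 (hd i)).le) (Finset.mem_univ l)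
    have hc0 : 0 ≤ ∑ l, (d l)⁻¹ := Finset.sum_nonneg fun i _ => (inv_pos.2 (hd i)).le
    apply le_of_sq_le_sq _ (by positivity)
    rw [mul_pow, EuclideanSpace.norm_sq_eq, EuclideanSpace.norm_sq_eq, Finset.mul_sum]
    apply Finset.sum_le_sum
    intro l _
    rw [← mul_pow]
    simp only [ivec, bvec, norm_mul, Real.norm_eq_abs, abs_of_pos (hd l)]
    gcongr
    have := hc l
    calc |(v l : ℝ)| = (d l)⁻¹ * (d l * |(v l : ℝ)|) := by
          rw [← mul_assoc, inv_mul_cancel₀ (hd l).ne', one_mul]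
      _ ≤ _ := by
          have := hd l
          gcongr
  have hinner : ∀ v : Fin n → ℤ, ⟪ivec v, WithLp.toLp 2 (fun l => d l * u l)⟫ = ⟪u, bvec d v⟫ := by
    intro v
    simp only [ivec, bvec, PiLp.inner_apply]
    refine Finset.sum_congr rfl fun l _ => ?_
    simp
    ring
  have hc0 : 0 ≤ ∑ l, (d l)⁻¹ := Finset.sum_nonneg fun i _ => (inv_pos.2 (hd i)).le
  refine ⟨WithLp.toLp 2 (fun l => d l * u l), ?_, 1 + (∑ l, (d l)⁻¹) * |Kn| + |K|, ?_, ?_⟩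
  · intro h
    have : u = 0 := by
      ext l
      have := congrArg (fun w : EuclideanSpace ℝ (Fin n) => w l) h
      simpa [(hd l).ne'] using this
    rw [this] at hu
    simp at hu
  · have : 0 ≤ (∑ l, (d l)⁻¹) * |Kn| := by positivity
    linarith [abs_nonneg K]
  · intro q hq
    obtain ⟨M, hM, hj⟩ := hr q hq
    refine ⟨M, hM, fun j => ⟨?_, ?_⟩⟩
    · refine (hnorm (M j)).trans ?_
      calc _ ≤ (∑ l, (d l)⁻¹) * (|Kn| * Real.exp (P q j)) := by
            have := (hj j).1.trans (mul_le_mul_of_nonneg_right (le_abs_self Kn) (Real.exp_pos (P q j)).le)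
            gcongr
        _ = ((∑ l, (d l)⁻¹) * |Kn|) * Real.exp (P q j) := by ring
        _ ≤ _ := by
            gcongr
            linarith [abs_nonneg K]
    · rw [hinner]
      refine (hj j).2.trans ?_
      rw [sub_zero]
      calc _ = K * (Real.exp (P q j) * Real.exp (-q)) := by ring
        _ ≤ (1 + (∑ l, (d l)⁻¹) * |Kn| + |K|) * (Real.exp (P q j) * Real.exp (-q)) := by
            gcongr
            have : 0 ≤ (∑ l, (d l)⁻¹) * |Kn| := by positivity
            linarith [le_abs_self K]
        _ = _ := by ring

lemma ivec_eq {n : ℕ} (v : Fin n → ℤ) : ivec v = bvec (fun _ => 1) v := by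
  simp [ivec, bvec]

lemma ivec_li {n : ℕ} (M : Matrix (Fin n) (Fin n) ℤ)
    (hM : M.det = 1) : LinearIndependent ℝ (fun j => ivec (M j)) := by
  simp only [ivec_eq]
  exact bvec_li _ (fun _ => one_pos) M hM

lemma lamMin_upper {n : ℕ} (u : EuclideanSpace ℝ (Fin n)) (q K : ℝ) (p : Fin n → ℝ) (hK : 1 ≤ K)
    (hp0 : ∀ i, 0 ≤ p i) (hp : Monotone p) (M : Matrix (Fin n) (Fin n) ℤ) (hM : M.det = 1)
    (h1 : ∀ j, ‖ivec (M j)‖ ≤ K * Real.exp (p j))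
    (h2 : ∀ j, |⟪ivec (M j), u⟫| ≤ K * Real.exp (p j) * Real.exp (-q)) (i : Fin n) :
    lamMin n u q ((i : ℕ) + 1) ≤ K * Real.exp (p i) := by
  apply csInf_le ⟨1, fun l hl => hl.1⟩
  refine ⟨?_, fun j => ivec (M (Fin.castLE i.2 j)), ?_, ?_⟩
  · have : 1 ≤ Real.exp (p i) := Real.one_le_exp (hp0 i)
    nlinarith
  · exact (ivec_li M hM).comp _ (Fin.castLE_injective _)
  · intro j
    have hj : p (Fin.castLE i.2 j) ≤ p i := hp (by
      rw [Fin.le_def]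
      have := j.2
      simp only [Fin.val_castLE]
      omega)
    have hj2 : K * Real.exp (p (Fin.castLE i.2 j)) ≤ K * Real.exp (p i) := by gcongr
    refine ⟨fun k => ⟨M (Fin.castLE i.2 j) k, rfl⟩, (h1 _).trans hj2, (h2 _).trans ?_⟩
    gcongr

lemma exists_row {n : ℕ} (M : Matrix (Fin n) (Fin n) ℤ) (hM : M.det = 1) (i : Fin n)
    (w : Fin ((i : ℕ) + 1) → Fin n → ℤ) (hw : LinearIndependent ℝ (fun s => ivec (w s))) :
    ∃ s h, i ≤ h ∧ (M.updateRow h (w s)).det ≠ 0 := by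
  by_contra hcon
  push Not at hcon
  have hexp : ∀ s, ivec (w s) = ∑ h, ((M.updateRow h (w s)).det : ℝ) • ivec (M h) := by
    intro s
    have h1 : M.transpose.mulVec (M.transpose.cramer (w s)) = w s := by
      rw [Matrix.mulVec_cramer, Matrix.det_transpose, hM, one_smul]
    ext l
    have h2 := congrFun h1 l
    simp only [Matrix.mulVec, dotProduct, Matrix.cramer_transpose_apply, Matrix.transpose_apply] at h2
    simp only [ivec, WithLp.ofLp_sum, WithLp.ofLp_smul, Finset.sum_apply, Pi.smul_apply, smul_eq_mul]
    rw [← h2]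
    push_cast
    refine Finset.sum_congr rfl fun j _ => by ring
  classical
  set T : Finset (EuclideanSpace ℝ (Fin n)) :=
    (Finset.Iio i).image (fun h => ivec (M h)) with hT
  have hspan : range (fun s => ivec (w s)) ≤ Submodule.span ℝ (T : Set (EuclideanSpace ℝ (Fin n))) := by
    rintro _ ⟨s, rfl⟩
    simp only
    rw [hexp s]
    refine Submodule.sum_mem _ fun h _ => ?_
    by_cases hh : i ≤ h
    · rw [hcon s h hh]; simp
    · apply Submodule.smul_mem
      apply Submodule.subset_span
      rw [hT, Finset.coe_image]
      exact ⟨h, by simpa using hh, rfl⟩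
  have hc := linearIndependent_le_span' _ hw (T : Set (EuclideanSpace ℝ (Fin n))) hspan
  have hTc : T.card ≤ i := by
    refine Finset.card_image_le.trans ?_
    rw [Fin.card_Iio]
  simp only [Cardinal.mk_fin, Fintype.card_coe, Finset.coe_sort_coe] at hc
  have : (i : ℕ) + 1 ≤ T.card := by exact_mod_cast hc
  omega

lemma lam_lower {n : ℕ} (u : EuclideanSpace ℝ (Fin n)) (s0 : Fin n) (q K : ℝ)
    (p : Fin n → ℝ) (hK : 1 ≤ K)
    (hp : Monotone p) (hsum : ∑ i, p i = q) (M : Matrix (Fin n) (Fin n) ℤ) (hM : M.det = 1)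
    (h1 : ∀ j, ‖ivec (M j)‖ ≤ K * Real.exp (p j))
    (h2 : ∀ j, |⟪ivec (M j), u⟫| ≤ K * Real.exp (p j) * Real.exp (-q)) (i : Fin n) (lam : ℝ)
    (hlam : 1 ≤ lam) (v : Fin ((i : ℕ) + 1) → EuclideanSpace ℝ (Fin n)) (hv : LinearIndependent ℝ v)
    (hv2 : ∀ j, (∀ k, ∃ m : ℤ, v j k = (m : ℝ)) ∧
      ‖v j‖ ≤ lam ∧ |⟪v j, u⟫| ≤ lam * Real.exp (-q)) :
    |u s0| * Real.exp (p i) ≤ n.factorial * K ^ n * lam := by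
  choose w hw using fun j => (hv2 j).1
  have hvw : ∀ j, v j = ivec (w j) := by
    intro j
    ext k
    exact hw j k
  have hv' : LinearIndependent ℝ (fun s => ivec (w s)) := by
    have : v = (fun s => ivec (w s)) := funext hvw
    rwa [← this]
  obtain ⟨s, h, hih, hdet⟩ := exists_row M hM i w hv'
  set N : Matrix (Fin n) (Fin n) ℤ := M.updateRow h (w s) with hN
  set b : Fin n → ℝ := fun j => K * Real.exp (p j) * (if j = h then lam * Real.exp (-p h) else 1) with hb
  have hbh : lam ≤ b h := by
    simp only [hb, if_true]
    calc lam = 1 * lam * (Real.exp (p h) * Real.exp (-p h)) := by rw [← Real.exp_add]; simp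
      _ ≤ K * lam * (Real.exp (p h) * Real.exp (-p h)) := by gcongr
      _ = _ := by ring
  have hrow : ∀ j, ‖ivec (N j)‖ ≤ b j ∧ |⟪ivec (N j), u⟫| ≤ b j * Real.exp (-q) := by
    intro j
    by_cases hj : j = h
    · subst hj
      have e : ivec (N j) = v s := by
        rw [hvw]; simp only [hN, Matrix.updateRow_self]
      rw [e]
      refine ⟨(hv2 s).2.1.trans hbh, (hv2 s).2.2.trans ?_⟩
      gcongr
    · have e : ivec (N j) = ivec (M j) := by
        simp only [hN, Matrix.updateRow_ne hj]
      rw [e]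
      simp only [hb, if_neg hj, mul_one]
      exact ⟨h1 j, h2 j⟩
  set R : Matrix (Fin n) (Fin n) ℝ := N.map (Int.castRingHom ℝ) with hR
  have hRdet : R.det = (N.det : ℝ) := by
    rw [hR, ← RingHom.mapMatrix_apply, ← RingHom.map_det]; simp
  have hR1 : 1 ≤ |R.det| := by
    rw [hRdet]
    have : 1 ≤ |N.det| := Int.one_le_abs hdet
    exact_mod_cast this
  have hmv : ∀ j, R.mulVec u j = ⟪ivec (N j), u⟫ := by
    intro j
    simp only [Matrix.mulVec, dotProduct, hR, Matrix.map_apply, ivec, PiLp.inner_apply]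
    refine Finset.sum_congr rfl fun l _ => ?_
    simp [mul_comm]
  have hcr : (R.updateCol s0 (R.mulVec u)).det = R.det * u s0 := by
    rw [← Matrix.cramer_apply, Matrix.cramer_eq_adjugate_mulVec, Matrix.mulVec_mulVec,
      Matrix.adjugate_mul, Matrix.smul_mulVec, Matrix.one_mulVec]
    simp
  set S : Matrix (Fin n) (Fin n) ℝ := R.updateCol s0 (fun j => Real.exp q * R.mulVec u j) with hS
  have hSR : R.updateCol s0 (R.mulVec u) = Matrix.of fun i j => (if j = s0 then Real.exp (-q) else 1) * S i j := by
    ext i j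
    simp only [Matrix.of_apply, hS, Matrix.updateCol_apply]
    split_ifs with hj
    · rw [← mul_assoc, ← Real.exp_add]; simp
    · simp
  have hSdet : |S.det| ≤ (n.factorial : ℝ) * ∏ j, b j := by
    apply det_row_bound
    intro i j
    simp only [hS, Matrix.updateCol_apply]
    split_ifs with hj
    · rw [hmv, abs_mul, Real.abs_exp]
      calc _ ≤ Real.exp q * (b i * Real.exp (-q)) := by
            have := (hrow i).2
            gcongr
        _ = b i * (Real.exp q * Real.exp (-q)) := by ring
        _ = b i := by rw [← Real.exp_add]; simp
    · exact (PiLp.norm_apply_le (ivec (N i)) j).trans (hrow i).1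
  have hprod : ∏ j, b j = K ^ n * Real.exp q * (lam * Real.exp (-p h)) := by
    simp only [hb]
    rw [Finset.prod_mul_distrib, Finset.prod_mul_distrib, ← Real.exp_sum, hsum]
    simp
  have hfin : |u s0| ≤ Real.exp (-q) * ((n.factorial : ℝ) * (K ^ n * Real.exp q * (lam * Real.exp (-p h)))) := by
    calc |u s0| ≤ |R.det| * |u s0| := by
          have := abs_nonneg (u s0)
          nlinarith
      _ = |(R.updateCol s0 (R.mulVec u)).det| := by rw [hcr, abs_mul]
      _ = Real.exp (-q) * |S.det| := by
          rw [hSR, Matrix.det_mul_row, abs_mul]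
          simp
      _ ≤ _ := by
          rw [hprod] at hSdet
          gcongr
  have e1 : Real.exp (-q) * ((n.factorial : ℝ) * (K ^ n * Real.exp q * (lam * Real.exp (-p h)))) =
      (n.factorial * K ^ n * lam) * Real.exp (-p h) * (Real.exp (-q) * Real.exp q) := by ring
  rw [e1, ← Real.exp_add, neg_add_cancel, Real.exp_zero, mul_one] at hfin
  calc |u s0| * Real.exp (p i) ≤ |u s0| * Real.exp (p h) := by
        have := hp hih
        gcongr
    _ ≤ (n.factorial * K ^ n * lam) * Real.exp (-p h) * Real.exp (p h) := by gcongr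
    _ = (n.factorial * K ^ n * lam) * (Real.exp (-p h) * Real.exp (p h)) := by ring
    _ = _ := by rw [← Real.exp_add]; simp

lemma lamMin_nonempty {n : ℕ} (u : EuclideanSpace ℝ (Fin n)) (q : ℝ) (i : ℕ) (hi : i ≤ n) :
    {lam : ℝ | 1 ≤ lam ∧ ∃ v : Fin i → EuclideanSpace ℝ (Fin n),
    LinearIndependent ℝ v ∧ ∀ j, (∀ k, ∃ m : ℤ, v j k = (m : ℝ)) ∧
      ‖v j‖ ≤ lam ∧ |⟪v j, u⟫| ≤ lam * Real.exp (-q)}.Nonempty := by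
  set v : Fin i → EuclideanSpace ℝ (Fin n) := fun j => ivec ((1 : Matrix (Fin n) (Fin n) ℤ) (Fin.castLE hi j)) with hv
  refine ⟨1 + ∑ j, ‖v j‖ + ∑ j, |⟪v j, u⟫| * Real.exp q, ?_, v, ?_, ?_⟩
  · have h1 : 0 ≤ ∑ j, ‖v j‖ := Finset.sum_nonneg fun _ _ => norm_nonneg _
    have h2 : 0 ≤ ∑ j, |⟪v j, u⟫| * Real.exp q := Finset.sum_nonneg fun _ _ => by positivity
    linarith
  · exact (ivec_li 1 Matrix.det_one).comp _ (Fin.castLE_injective _)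
  · intro j
    have h1 : 0 ≤ ∑ j, ‖v j‖ := Finset.sum_nonneg fun _ _ => norm_nonneg _
    have h2 : 0 ≤ ∑ j, |⟪v j, u⟫| * Real.exp q := Finset.sum_nonneg fun _ _ => by positivity
    have h3 := Finset.single_le_sum (f := fun j => ‖v j‖) (fun i _ => norm_nonneg _) (Finset.mem_univ j)
    have h4 := Finset.single_le_sum (f := fun j => |⟪v j, u⟫| * Real.exp q) (fun i _ => by positivity) (Finset.mem_univ j)
    refine ⟨fun k => ⟨_, rfl⟩, by linarith, ?_⟩
    rw [Real.exp_neg, ← div_eq_mul_inv, le_div_iff₀ (Real.exp_pos _)]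
    linarith

lemma first_claim {n : ℕ} (hn : 0 < n) {P : ℝ → Fin n → ℝ} {q0 : ℝ}
    (hP : IsNSystem n (Ici q0) P) : ∃ u : EuclideanSpace ℝ (Fin n), u ≠ 0 ∧
        ∃ C : ℝ, ∀ q, q0 ≤ q → ∀ i, |P q i - Lu n u q i| ≤ C := by
  obtain ⟨u, hu, K, hK, h⟩ := main_exists hn hP
  obtain ⟨s0, hs0⟩ : ∃ s, u s ≠ 0 := by
    by_contra hcon
    push Not at hcon
    exact hu (by ext s; simpa using hcon s)
  set c : ℝ := |u s0| / (n.factorial * K ^ n) with hc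
  have hK0 : 0 < K := by linarith
  have hden : (0 : ℝ) < n.factorial * K ^ n := by
    have : (0 : ℝ) < n.factorial := by exact_mod_cast n.factorial_pos
    positivity
  have hc0 : 0 < c := div_pos (abs_pos.2 hs0) hden
  refine ⟨u, hu, |Real.log c| + |Real.log K|, fun q hq i => ?_⟩
  obtain ⟨M, hM, hMr⟩ := h q hq
  obtain ⟨⟨hp0, hmono, hsum⟩, -⟩ := hP q hq
  have hup := lamMin_upper u q K (P q) hK hp0 hmono M hM (fun j => (hMr j).1) (fun j => (hMr j).2) i
  have hlow : c * Real.exp (P q i) ≤ lamMin n u q ((i : ℕ) + 1) := by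
    apply le_csInf (lamMin_nonempty u q _ i.2)
    rintro lam ⟨hl1, v, hv, hv2⟩
    have := lam_lower u s0 q K (P q) hK hmono hsum M hM (fun j => (hMr j).1)
      (fun j => (hMr j).2) i lam hl1 v hv hv2
    rw [hc, div_mul_eq_mul_div, div_le_iff₀ hden]
    linarith
  have hpos : 0 < c * Real.exp (P q i) := by positivity
  have l1 := Real.log_le_log hpos hlow
  have l2 := Real.log_le_log (hpos.trans_le hlow) hup
  rw [Real.log_mul hc0.ne' (Real.exp_pos _).ne', Real.log_exp] at l1
  rw [Real.log_mul hK0.ne' (Real.exp_pos _).ne', Real.log_exp] at l2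
  unfold Lu
  rw [abs_le]
  have := neg_abs_le (Real.log c)
  have := le_abs_self (Real.log K)
  have := abs_nonneg (Real.log c)
  have := abs_nonneg (Real.log K)
  constructor <;> linarith

lemma one_le_lamMin {n : ℕ} (u : EuclideanSpace ℝ (Fin n)) (q : ℝ) (i : ℕ) (hi : i ≤ n) :
    1 ≤ lamMin n u q i := le_csInf (lamMin_nonempty u q i hi) fun _ h => h.1

lemma ivec_inner {n : ℕ} (g : Fin n → ℤ) (u : EuclideanSpace ℝ (Fin n)) :
    ⟪ivec g, u⟫ = ∑ l, g l • u l := by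
  simp only [ivec, PiLp.inner_apply]
  refine Finset.sum_congr rfl fun l _ => ?_
  simp [mul_comm]

lemma ivec_ne {n : ℕ} (g : Fin n → ℤ) (hg : g ≠ 0) : ivec g ≠ 0 := by
  intro h
  apply hg
  funext l
  have := congrArg (fun w : EuclideanSpace ℝ (Fin n) => w l) h
  simpa [ivec] using this

lemma ivec_finite {n : ℕ} (R : ℝ) : {g : Fin n → ℤ | ‖ivec g‖ ≤ R}.Finite := by
  refine (Set.finite_Icc (fun _ => -⌈R⌉ : Fin n → ℤ) (fun _ => ⌈R⌉)).subset ?_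
  intro g hg
  have key : ∀ l, |(g l : ℝ)| ≤ ⌈R⌉ := by
    intro l
    exact ((PiLp.norm_apply_le (ivec g) l).trans hg).trans (Int.le_ceil _)
  constructor
  · intro l
    have := (abs_le.1 (key l)).1
    exact_mod_cast this
  · intro l
    have := (abs_le.1 (key l)).2
    exact_mod_cast this

lemma li_iff_int {n : ℕ} (u : EuclideanSpace ℝ (Fin n)) :
    LinearIndependent ℚ (fun i : Fin n => u i) ↔ ∀ g : Fin n → ℤ, ⟪ivec g, u⟫ = 0 → g = 0 := by
  rw [← LinearIndependent.iff_fractionRing ℤ ℚ, Fintype.linearIndependent_iff]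
  simp only [ivec_inner, funext_iff, Pi.zero_apply]

lemma second_claim {n : ℕ} (hn : 0 < n) {P : ℝ → Fin n → ℝ} {q0 : ℝ}
    (u : EuclideanSpace ℝ (Fin n)) (C : ℝ) (hC : ∀ q, q0 ≤ q → ∀ i, |P q i - Lu n u q i| ≤ C) :
    LinearIndependent ℚ (fun i : Fin n => u i) ↔ IsProper n P := by
  rw [li_iff_int]
  constructor
  · intro hli i
    rw [tendsto_atTop]
    intro b
    set R : ℝ := Real.exp (b + C) with hR
    have hev : ∀ᶠ q in atTop, ∀ g ∈ {g : Fin n → ℤ | ‖ivec g‖ ≤ R}, g ≠ 0 →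
        R * Real.exp (-q) < |⟪ivec g, u⟫| := by
      rw [eventually_all_finite (ivec_finite R)]
      intro g _
      by_cases hg : g = 0
      · simp [hg]
      · have hpos : 0 < |⟪ivec g, u⟫| := abs_pos.2 fun h => hg (hli g h)
        have ht : Tendsto (fun q : ℝ => R * Real.exp (-q)) atTop (nhds (R * 0)) :=
          Tendsto.const_mul R Real.tendsto_exp_neg_atTop_nhds_zero
        rw [mul_zero] at ht
        filter_upwards [ht.eventually_lt_const hpos] with q hq _ using hq
    filter_upwards [hev, eventually_ge_atTop q0] with q hq hq0
    have h1 : R ≤ lamMin n u q ((i : ℕ) + 1) := by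
      apply le_csInf (lamMin_nonempty u q _ i.2)
      rintro lam ⟨hl1, v, hv, hv2⟩
      by_contra hlt
      push Not at hlt
      obtain ⟨h2, h3, h4⟩ := hv2 0
      choose w hw using h2
      have hvw : v 0 = ivec w := by
        ext k
        exact hw k
      have hne := hv.ne_zero 0
      rw [hvw] at h3 h4 hne
      have h5 := hq w (h3.trans hlt.le) (by
        rintro rfl
        apply hne
        ext l
        simp [ivec])
      have h6 : lam * Real.exp (-q) ≤ R * Real.exp (-q) := by gcongr
      linarith
    have h2 : b + C ≤ Lu n u q i := by
      unfold Lu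
      rw [Real.le_log_iff_exp_le (lt_of_lt_of_le one_pos (one_le_lamMin u q _ i.2))]
      exact h1
    have h3 := (abs_le.1 (hC q hq0 i)).1
    linarith
  · intro hprop g hg
    by_contra hne
    set i0 : Fin n := ⟨0, hn⟩
    have h1 := (hprop i0).eventually_ge_atTop (C + Real.log (max 1 ‖ivec g‖) + 1)
    obtain ⟨q, hq, hq0⟩ := (h1.and (eventually_ge_atTop q0)).exists
    have h2 : lamMin n u q ((i0 : ℕ) + 1) ≤ max 1 ‖ivec g‖ := by
      apply csInf_le ⟨1, fun l hl => hl.1⟩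
      refine ⟨le_max_left _ _, fun _ => ivec g, ?_, ?_⟩
      · have : Subsingleton (Fin ((i0 : ℕ) + 1)) := ⟨fun x y => by
          apply Fin.ext
          have hx := x.2
          have hy := y.2
          simp only [i0] at hx hy
          omega⟩
        exact LinearIndependent.of_subsingleton 0 (ivec_ne g hne)
      · intro j
        refine ⟨fun k => ⟨g k, rfl⟩, le_max_right _ _, ?_⟩
        rw [hg, abs_zero]
        positivity
    have h3 : Lu n u q i0 ≤ Real.log (max 1 ‖ivec g‖) := by
      unfold Lu
      exact Real.log_le_log (lt_of_lt_of_le one_pos (one_le_lamMin u q _ i0.2)) h2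
    have h4 := (abs_le.1 (hC q hq0 i0)).2
    linarith

theorem stmt_1 (n : ℕ) (hn : 2 ≤ n) (q₀ : ℝ) (hq₀ : 0 ≤ q₀)
    (P : ℝ → Fin n → ℝ) (hP : IsNSystem n (Ici q₀) P) :
    (∃ u : EuclideanSpace ℝ (Fin n), u ≠ 0 ∧
        ∃ C : ℝ, ∀ q, q₀ ≤ q → ∀ i, |P q i - Lu n u q i| ≤ C) ∧
    (∀ u : EuclideanSpace ℝ (Fin n), u ≠ 0 →
      (∃ C : ℝ, ∀ q, q₀ ≤ q → ∀ i, |P q i - Lu n u q i| ≤ C) →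
      (LinearIndependent ℚ (fun i : Fin n => u i) ↔ IsProper n P)) := by
  have hn0 : 0 < n := by omega
  exact ⟨first_claim hn0 hP, fun u _ ⟨C, hC⟩ => second_claim hn0 u C hC⟩
end
end

section
/- For every integer n ≥ 2, every closed subinterval I of [0,∞) with nonempty interior, every generalized n-system P on I and every ε > 0, there exists an n-system Q on I such that ‖P(q) − Q(q)‖ ≤ ε for all q ∈ I; in other words, every generalized n-system is a uniform limit of n-systems. -/
open Set Filter

noncomputable section

/-- `f` is, on `H`, convex and piecewise linear with slopes `0` then `1`. -/
def SlopeZeroOneOn (H : Set ℝ) (f : ℝ → ℝ) : Prop :=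
  ∃ c v : ℝ, ∀ t ∈ H, f t = v + max (t - c) 0

/-- A generalized `n`-system on `I`: a continuous piecewise linear map
satisfying (G1), (G2) and (G3). -/
def IsGenNSystem (n : ℕ) (I : Set ℝ) (P : ℝ → Fin n → ℝ) : Prop :=
  ContinuousOn P I ∧
  (∀ q ∈ I, ∃ ε > 0, ∃ a b c d : Fin n → ℝ,
    (∀ t ∈ I ∩ Icc (q - ε) q, ∀ i, P t i = a i * t + b i) ∧
    (∀ t ∈ I ∩ Icc q (q + ε), ∀ i, P t i = c i * t + d i)) ∧
  (∀ q ∈ I, (∀ i, 0 ≤ P q i) ∧ Monotone (P q) ∧ (∑ i, P q i) = q) ∧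
  (∀ i : Fin n, MonotoneOn (fun q => P q i) I ∧ LipschitzOnWith 1 (fun q => P q i) I) ∧
  (∀ j : ℕ, ∀ hj : j + 1 < n, ∀ H : Set ℝ, H ⊆ I → H.OrdConnected →
    (∀ q ∈ H, P q ⟨j, Nat.lt_of_succ_lt hj⟩ < P q ⟨j + 1, hj⟩) →
    SlopeZeroOneOn H fun q => ∑ i : Fin n, if (i : ℕ) ≤ j then P q i else 0)

/-- partial sums of the first `j` components -/
def MM {n : ℕ} (P : ℝ → Fin n → ℝ) (q : ℝ) (j : ℕ) : ℝ :=
  ∑ i : Fin n, if (i : ℕ) < j then P q i else 0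

theorem MM_zero {n : ℕ} (P : ℝ → Fin n → ℝ) (q : ℝ) : MM P q 0 = 0 := by
  simp [MM]

theorem MM_top {n : ℕ} (P : ℝ → Fin n → ℝ) (q : ℝ) : MM P q n = ∑ i, P q i := by
  simp [MM]

theorem MM_succ {n : ℕ} (P : ℝ → Fin n → ℝ) (q : ℝ) (i : Fin n) :
    MM P q (i + 1) = MM P q i + P q i := by
  have h : P q i = ∑ x : Fin n, if x = i then P q x else 0 := by simp
  rw [h]
  unfold MM
  rw [← Finset.sum_add_distrib]
  apply Finset.sum_congr rfl
  intro x _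
  rcases lt_trichotomy x i with h | h | h
  · have h1 : (x : ℕ) < i := h
    have h2 : x ≠ i := ne_of_lt h
    have h3 : (x : ℕ) < i + 1 := by omega
    simp [h1, h2, h3]
  · subst h; simp
  · have h1 : (i : ℕ) < x := h
    have h2 : x ≠ i := ne_of_gt h
    have h3 : ¬ (x : ℕ) < i + 1 := by omega
    have h4 : ¬ (x : ℕ) < i := by omega
    simp [h2, h3, h4]

theorem MM_diff {n : ℕ} (P : ℝ → Fin n → ℝ) (s u : ℝ) (h : ∀ i, P s i ≤ P u i)
    {j j' : ℕ} (hj : j ≤ j') : MM P u j - MM P s j ≤ MM P u j' - MM P s j' := by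
  unfold MM
  rw [← Finset.sum_sub_distrib, ← Finset.sum_sub_distrib]
  apply Finset.sum_le_sum
  intro i _
  have := h i
  split_ifs <;> first | omega | linarith

theorem exists_switch (p : ℕ → Prop) (n : ℕ) (h0 : p 0) (hn : ¬ p n) :
    ∃ l, l < n ∧ p l ∧ ¬ p (l + 1) := by
  induction n with
  | zero => exact absurd h0 hn
  | succ m ih =>
    by_cases h : p m
    · exact ⟨m, by omega, h, hn⟩
    · obtain ⟨l, h1, h2⟩ := ih h
      exact ⟨l, by omega, h2⟩

/-- the partial sums of the approximating system -/
def SS {n : ℕ} (P : ℝ → Fin n → ℝ) (lo hi : ℝ → ℝ) (q : ℝ) (j : ℕ) : ℝ :=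
  max (MM P (lo q) j) (MM P (hi q) j - (hi q - q))

/-- the approximating system -/
def QQ {n : ℕ} (P : ℝ → Fin n → ℝ) (lo hi : ℝ → ℝ) (q : ℝ) (i : Fin n) : ℝ :=
  SS P lo hi q (i + 1) - SS P lo hi q i

theorem QQ_single {n : ℕ} (P : ℝ → Fin n → ℝ) (lo hi : ℝ → ℝ) (q t : ℝ) (l : Fin n)
    (h : ∀ j, j ≤ n → SS P lo hi t j = SS P lo hi q j + if (l : ℕ) < j then t - q else 0) :
    QQ P lo hi t = QQ P lo hi q + Pi.single l (t - q) := by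
  funext i
  simp only [QQ, Pi.add_apply]
  rw [h (i + 1) i.2, h i i.2.le]
  rcases lt_trichotomy l i with h | h | h
  · have h1 : (l : ℕ) < i := h
    have h2 : i ≠ l := ne_of_gt h
    have h3 : (l : ℕ) < i + 1 := by omega
    simp [h1, h2, h3]
  · subst h; simp; ring
  · have h1 : (i : ℕ) < l := h
    have h2 : i ≠ l := ne_of_lt h
    have h3 : ¬ (l : ℕ) < i + 1 := by omega
    have h4 : ¬ (l : ℕ) < i := by omega
    simp [h2, h3, h4]

theorem core (n : ℕ) (hn : 0 < n) (I D : Set ℝ) (P : ℝ → Fin n → ℝ) (lo hi : ℝ → ℝ)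
    (hconn : I.OrdConnected)
    (hP0 : ∀ q ∈ I, (∀ i, 0 ≤ P q i) ∧ Monotone (P q) ∧ (∑ i, P q i) = q)
    (hPm : ∀ i : Fin n, MonotoneOn (fun q => P q i) I)
    (hDI : D ⊆ I)
    (hlo : ∀ q ∈ I, lo q ∈ D ∧ lo q ≤ q ∧ ∀ x ∈ D, x ≤ q → x ≤ lo q)
    (hhi : ∀ q ∈ I, hi q ∈ D ∧ q ≤ hi q ∧ ∀ x ∈ D, q ≤ x → hi q ≤ x)
    (hiso : ∀ q ∈ I, ∃ δ > 0, ∀ x ∈ D, |x - q| < δ → x = q)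
    (hG : ∀ s ∈ D, ∀ q ∈ D, ∀ u ∈ D, s < q → q < u → (∀ x ∈ D, ¬ (s < x ∧ x < q)) →
      (∀ x ∈ D, ¬ (q < x ∧ x < u)) → ∀ j : ℕ, ∀ hj : j + 1 < n,
      MM P s (j + 1) < MM P q (j + 1) → MM P u (j + 1) - MM P q (j + 1) < u - q →
      P q ⟨j, Nat.lt_of_succ_lt hj⟩ = P q ⟨j + 1, hj⟩) :
    IsNSystem n I (QQ P lo hi) := by
  have hPle : ∀ s ∈ D, ∀ u ∈ D, s ≤ u → ∀ i, P s i ≤ P u i := fun s hs u hu h i =>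
    hPm i (hDI hs) (hDI hu) h
  have hM0 : ∀ s ∈ D, ∀ u ∈ D, s ≤ u → ∀ j, MM P s j ≤ MM P u j := by
    intro s hs u hu h j
    have := MM_diff P s u (hPle s hs u hu h) (Nat.zero_le j)
    simp only [MM_zero] at this
    linarith
  have hM1 : ∀ s ∈ D, ∀ u ∈ D, s ≤ u → ∀ j, j ≤ n → MM P u j - MM P s j ≤ u - s := by
    intro s hs u hu h j hj
    have := MM_diff P s u (hPle s hs u hu h) hj
    rw [MM_top, MM_top, (hP0 s (hDI hs)).2.2, (hP0 u (hDI hu)).2.2] at this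
    exact this
  -- the formula on any gap
  have hS : ∀ s ∈ D, ∀ u ∈ D, (∀ x ∈ D, ¬ (s < x ∧ x < u)) → ∀ t, s ≤ t → t ≤ u →
      ∀ j, j ≤ n → SS P lo hi t j = max (MM P s j) (MM P u j - (u - t)) := by
    intro s hs u hu hgap t hst htu j hj
    have htI : t ∈ I := hconn.out (hDI hs) (hDI hu) ⟨hst, htu⟩
    obtain ⟨a1, a2, a3⟩ := hlo t htI
    obtain ⟨b1, b2, b3⟩ := hhi t htI
    have hsu := hst.trans htu
    have e0 := hM0 s hs u hu hsu j
    have e1 := hM1 s hs u hu hsu j hj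
    unfold SS
    by_cases htD : t ∈ D
    · have h1 : lo t = t := le_antisymm a2 (a3 t htD le_rfl)
      have h2 : hi t = t := le_antisymm (b3 t htD le_rfl) b2
      rw [h1, h2]
      rcases eq_or_lt_of_le hst with h | h
      · subst h
        rw [max_eq_left (by linarith), max_eq_left (by linarith)]
      · have : t = u := by
          by_contra hne
          exact hgap t htD ⟨h, lt_of_le_of_ne htu hne⟩
        subst this
        rw [max_eq_left (by linarith), max_eq_right (by linarith)]
        ring
    · have h1 : lo t = s := by
        have := a3 s hs hst
        rcases eq_or_lt_of_le this with h | h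
        · exact h.symm
        · exfalso
          have h3 : lo t ≠ t := fun h => htD (h ▸ a1)
          exact hgap _ a1 ⟨h, lt_of_lt_of_le (lt_of_le_of_ne a2 h3) htu⟩
      have h2 : hi t = u := by
        have := b3 u hu htu
        rcases eq_or_lt_of_le this with h | h
        · exact h
        · exfalso
          have h3 : t ≠ hi t := fun h => htD (h ▸ b1)
          exact hgap _ b1 ⟨lt_of_le_of_lt hst (lt_of_le_of_ne b2 h3), h⟩
      rw [h1, h2]
  have hgap0 : ∀ z ∈ I, ∀ x ∈ D, ¬ (lo z < x ∧ x < hi z) := by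
    rintro z hz x hx ⟨h1, h2⟩
    rcases le_total x z with h | h
    · exact absurd ((hlo z hz).2.2 x hx h) (not_le.2 h1)
    · exact absurd ((hhi z hz).2.2 x hx h) (not_le.2 h2)
  have hleft : ∀ q ∈ I, (∃ z ∈ I, z < q) → ∃ s ∈ D, ∃ u ∈ D, s < q ∧ q ≤ u ∧
      (∀ x ∈ D, ¬ (s < x ∧ x < u)) := by
    rintro q hq ⟨z0, hz0, hzq⟩
    obtain ⟨δ, hδ, hi1⟩ := hiso q hq
    set z := max z0 (q - δ / 2) with hz
    have hzq' : z < q := max_lt hzq (by linarith)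
    have hzI : z ∈ I := hconn.out hz0 hq ⟨le_max_left _ _, hzq'.le⟩
    have hzd : q - δ / 2 ≤ z := le_max_right _ _
    obtain ⟨a1, a2, a3⟩ := hlo z hzI
    obtain ⟨b1, b2, b3⟩ := hhi z hzI
    refine ⟨lo z, a1, hi z, b1, by linarith, ?_, hgap0 z hzI⟩
    by_contra h
    push Not at h
    have := hi1 _ b1 (by rw [abs_lt]; constructor <;> linarith)
    linarith
  have hright : ∀ q ∈ I, (∃ z ∈ I, q < z) → ∃ s ∈ D, ∃ u ∈ D, s ≤ q ∧ q < u ∧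
      (∀ x ∈ D, ¬ (s < x ∧ x < u)) := by
    rintro q hq ⟨z0, hz0, hzq⟩
    obtain ⟨δ, hδ, hi1⟩ := hiso q hq
    set z := min z0 (q + δ / 2) with hz
    have hzq' : q < z := lt_min hzq (by linarith)
    have hzI : z ∈ I := hconn.out hq hz0 ⟨hzq'.le, min_le_left _ _⟩
    have hzd : z ≤ q + δ / 2 := min_le_right _ _
    obtain ⟨a1, a2, a3⟩ := hlo z hzI
    obtain ⟨b1, b2, b3⟩ := hhi z hzI
    refine ⟨lo z, a1, hi z, b1, ?_, by linarith, hgap0 z hzI⟩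
    by_contra h
    push Not at h
    have := hi1 _ a1 (by rw [abs_lt]; constructor <;> linarith)
    linarith
  -- thresholds
  have hc0 : ∀ s u, MM P s 0 - MM P u 0 + u = u := by
    intro s u; simp [MM_zero]
  have hcn : ∀ s ∈ D, ∀ u ∈ D, MM P s n - MM P u n + u = s := by
    intro s hs u hu
    rw [MM_top, MM_top, (hP0 s (hDI hs)).2.2, (hP0 u (hDI hu)).2.2]; ring
  -- left structure
  have hL : ∀ q ∈ I, ∃ l : Fin n, ∃ ε > 0,
      (∀ t ∈ I ∩ Icc (q - ε) q, QQ P lo hi t = QQ P lo hi q + Pi.single l (t - q)) ∧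
      ((∃ z ∈ I, z < q) → ∃ s ∈ D, ∃ u ∈ D, s < q ∧ q ≤ u ∧ (∀ x ∈ D, ¬ (s < x ∧ x < u)) ∧
        ∀ j, j ≤ n → (l : ℕ) < j → MM P s j - MM P u j + u < q) := by
    intro q hq
    by_cases hz : ∃ z ∈ I, z < q
    · obtain ⟨s, hs, u, hu, hsq, hqu, hgap⟩ := hleft q hq hz
      obtain ⟨l, hln, hl1, hl2⟩ := exists_switch (fun j => q ≤ MM P s j - MM P u j + u) n
        (by simp only [hc0]; exact hqu) (by simp only [hcn s hs u hu]; linarith)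
      push Not at hl2
      have hsu : s ≤ u := by linarith
      have hdj := fun {j j' : ℕ} (h : j ≤ j') => MM_diff P s u (hPle s hs u hu hsu) h
      have hsl := hM1 s hs u hu hsu (l + 1) hln
      refine ⟨⟨l, hln⟩, q - (MM P s (l + 1) - MM P u (l + 1) + u), by linarith, ?_,
        fun _ => ⟨s, hs, u, hu, hsq, hqu, hgap, ?_⟩⟩
      · rintro t ⟨htI, ht1, ht2⟩
        apply QQ_single
        intro j hj
        rw [hS s hs u hu hgap t (by linarith) (by linarith) j hj,
          hS s hs u hu hgap q (by linarith) (by linarith) j hj]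
        simp only
        split_ifs with hlj
        · have := hdj (show l + 1 ≤ j from hlj)
          rw [max_eq_right (by linarith), max_eq_right (by linarith)]; ring
        · have := hdj (show j ≤ l by omega)
          rw [max_eq_left (by linarith), max_eq_left (by linarith)]; ring
      · intro j hj hlj
        have := hdj (show l + 1 ≤ j from hlj)
        linarith
    · refine ⟨⟨0, hn⟩, 1, one_pos, ?_, fun h => absurd h hz⟩
      rintro t ⟨htI, ht1, ht2⟩
      have : t = q := by
        by_contra hne
        exact hz ⟨t, htI, lt_of_le_of_ne ht2 hne⟩
      subst this
      simp
  have hR : ∀ q ∈ I, ∃ k : Fin n, ∃ ε > 0,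
      (∀ t ∈ I ∩ Icc q (q + ε), QQ P lo hi t = QQ P lo hi q + Pi.single k (t - q)) ∧
      ((∃ z ∈ I, q < z) → ∃ s ∈ D, ∃ u ∈ D, s ≤ q ∧ q < u ∧ (∀ x ∈ D, ¬ (s < x ∧ x < u)) ∧
        ∀ j : ℕ, j ≤ k → q < MM P s j - MM P u j + u) := by
    intro q hq
    by_cases hz : ∃ z ∈ I, q < z
    · obtain ⟨s, hs, u, hu, hsq, hqu, hgap⟩ := hright q hq hz
      obtain ⟨l, hln, hl1, hl2⟩ := exists_switch (fun j => q < MM P s j - MM P u j + u) n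
        (by simp only [hc0]; exact hqu) (by simp only [hcn s hs u hu]; linarith)
      push Not at hl2
      have hsu : s ≤ u := by linarith
      have hdj := fun {j j' : ℕ} (h : j ≤ j') => MM_diff P s u (hPle s hs u hu hsu) h
      have hsl := hM0 s hs u hu hsu l
      refine ⟨⟨l, hln⟩, (MM P s l - MM P u l + u) - q, by linarith, ?_,
        fun _ => ⟨s, hs, u, hu, hsq, hqu, hgap, ?_⟩⟩
      · rintro t ⟨htI, ht1, ht2⟩
        apply QQ_single
        intro j hj
        rw [hS s hs u hu hgap t (by linarith) (by linarith) j hj,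
          hS s hs u hu hgap q (by linarith) (by linarith) j hj]
        simp only
        split_ifs with hlj
        · have := hdj (show l + 1 ≤ j from hlj)
          rw [max_eq_right (by linarith), max_eq_right (by linarith)]; ring
        · have := hdj (show j ≤ l by omega)
          rw [max_eq_left (by linarith), max_eq_left (by linarith)]; ring
      · intro j hlj
        have := hdj (show j ≤ l from hlj)
        linarith
    · refine ⟨⟨0, hn⟩, 1, one_pos, ?_, fun h => absurd h hz⟩
      rintro t ⟨htI, ht1, ht2⟩
      have : t = q := by
        by_contra hne
        exact hz ⟨t, htI, lt_of_le_of_ne ht1 (Ne.symm hne)⟩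
      subst this
      simp
  intro q hq
  constructor
  · obtain ⟨a1, a2, a3⟩ := hlo q hq
    obtain ⟨b1, b2, b3⟩ := hhi q hq
    obtain ⟨p1, p2, p3⟩ := hP0 _ (hDI a1)
    obtain ⟨r1, r2, r3⟩ := hP0 _ (hDI b1)
    refine ⟨?_, ?_, ?_⟩
    · intro i
      simp only [QQ, SS, MM_succ]
      have := p1 i
      have := r1 i
      rw [sub_nonneg]
      apply max_le_max <;> linarith
    · obtain ⟨m, rfl⟩ : ∃ m, n = m + 1 := ⟨n - 1, by omega⟩
      rw [Fin.monotone_iff_le_succ]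
      intro i
      have e1 := fun x => MM_succ P x i.castSucc
      have e2 := fun x => MM_succ P x i.succ
      have f1 := p2 (Fin.castSucc_lt_succ (i := i)).le
      have f2 := r2 (Fin.castSucc_lt_succ (i := i)).le
      simp only [Fin.val_castSucc, Fin.val_succ] at e1 e2
      simp only [QQ, SS, Fin.val_castSucc, Fin.val_succ]
      have g1 := e1 (lo q)
      have g2 := e1 (hi q)
      have g3 := e2 (lo q)
      have g4 := e2 (hi q)
      have k1 := le_max_left (MM P (lo q) i) (MM P (hi q) i - (hi q - q))
      have k2 := le_max_right (MM P (lo q) i) (MM P (hi q) i - (hi q - q))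
      have k3 := le_max_left (MM P (lo q) (i + 1 + 1)) (MM P (hi q) (i + 1 + 1) - (hi q - q))
      have k4 := le_max_right (MM P (lo q) (i + 1 + 1)) (MM P (hi q) (i + 1 + 1) - (hi q - q))
      rcases max_choice (MM P (lo q) (i + 1)) (MM P (hi q) (i + 1) - (hi q - q)) with h | h <;>
      rw [h] <;> linarith
    · simp only [QQ]
      rw [Fin.sum_univ_eq_sum_range (fun i => SS P lo hi q (i + 1) - SS P lo hi q i) n,
        Finset.sum_range_sub]
      simp only [SS, MM_zero, MM_top, p3, r3]
      rw [max_eq_right (by linarith), max_eq_left (by linarith)]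
      ring
  · obtain ⟨l, ε1, hε1, hL1, hL2⟩ := hL q hq
    obtain ⟨k, ε2, hε2, hR1, hR2⟩ := hR q hq
    refine ⟨min ε1 ε2, lt_min hε1 hε2, k, l, ?_, ?_, ?_⟩
    · rintro t ⟨htI, ht1, ht2⟩
      exact hL1 t ⟨htI, by linarith [min_le_left ε1 ε2], ht2⟩
    · rintro t ⟨htI, ht1, ht2⟩
      exact hR1 t ⟨htI, ht1, by linarith [min_le_right ε1 ε2]⟩
    · intro hqi hlk
      obtain ⟨δ, hδ, hball⟩ := Metric.isOpen_iff.1 isOpen_interior q hqi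
      have hb : ∀ x, |x - q| < δ → x ∈ I := fun x hx =>
        interior_subset (hball (by rw [Metric.mem_ball, Real.dist_eq]; exact hx))
      obtain ⟨s, hs, u, hu, hsq, hqu, hgap, hA⟩ := hL2 ⟨q - δ / 2, hb _ (by
        rw [abs_lt]; constructor <;> linarith), by linarith⟩
      obtain ⟨s', hs', u', hu', hsq', hqu', hgap', hB⟩ := hR2 ⟨q + δ / 2, hb _ (by
        rw [abs_lt]; constructor <;> linarith), by linarith⟩
      by_cases hqD : q ∈ D
      · have h1 : u = q := by
          by_contra hne
          exact hgap q hqD ⟨hsq, lt_of_le_of_ne hqu (Ne.symm hne)⟩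
        have h2 : s' = q := by
          by_contra hne
          exact hgap' q hqD ⟨lt_of_le_of_ne hsq' hne, hqu'⟩
        subst h1
        subst h2
        have hlo' : lo s' = s' := le_antisymm (hlo s' hq).2.1 ((hlo s' hq).2.2 s' hqD le_rfl)
        have hhi' : hi s' = s' := le_antisymm ((hhi s' hq).2.2 s' hqD le_rfl) (hhi s' hq).2.1
        have hQ : ∀ i, QQ P lo hi s' i = P s' i := by
          intro i
          simp only [QQ, SS, hlo', hhi', MM_succ]
          simp
        have key : ∀ m : ℕ, ∀ hm : (l : ℕ) + m ≤ k,
            P s' ⟨l + m, lt_of_le_of_lt hm k.2⟩ = P s' l := by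
          intro m
          induction m with
          | zero => intro hm; rfl
          | succ m ih =>
            intro hm
            rw [← ih (by omega)]
            have h1 := hA (l + m + 1) (by omega) (by omega)
            have h2 := hB (l + m + 1) (by omega)
            exact (hG s hs s' hqD u' hu' hsq hqu' hgap hgap' (l + m) (by omega)
              (by linarith) (by linarith)).symm
        intro i hli hik
        rw [hQ, hQ]
        have h1 : (l : ℕ) ≤ i := hli
        have h2 : (i : ℕ) ≤ k := hik
        have := key (i - l) (by omega)
        rw [← this]
        congr 1
        ext
        simp only
        omega
      · exfalso
        have hne : ∀ x ∈ D, x ≠ q := fun x hx h => hqD (h ▸ hx)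
        have h1 : q < u := lt_of_le_of_ne hqu (Ne.symm (hne u hu))
        have h2 : s' < q := lt_of_le_of_ne hsq' (hne s' hs')
        have h3 : s = s' := by
          rcases lt_trichotomy s s' with h | h | h
          · exact absurd ⟨h, h2.trans h1⟩ (hgap s' hs')
          · exact h
          · exact absurd ⟨h, hsq.trans hqu'⟩ (hgap' s hs)
        have h4 : u = u' := by
          rcases lt_trichotomy u u' with h | h | h
          · exact absurd ⟨h2.trans h1, h⟩ (hgap' u hu)
          · exact h
          · exact absurd ⟨hsq.trans hqu', h⟩ (hgap u' hu')
        subst h3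
        subst h4
        have h5 := hA k k.2.le hlk
        have h6 := hB k le_rfl
        linarith

theorem QQ_close {n : ℕ} (P : ℝ → Fin n → ℝ) (lo hi : ℝ → ℝ) (q τ : ℝ) (i : Fin n)
    (h1 : P (lo q) i ≤ P q i) (h2 : P q i ≤ P (hi q) i) (h3 : P (hi q) i - P (lo q) i ≤ τ) :
    |P q i - QQ P lo hi q i| ≤ τ := by
  have e1 : P (lo q) i ≤ QQ P lo hi q i := by
    simp only [QQ, SS, MM_succ]
    rcases max_choice (MM P (lo q) i) (MM P (hi q) i - (hi q - q)) with h | h <;> rw [h]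
    · linarith [le_max_left (MM P (lo q) i + P (lo q) i) (MM P (hi q) i + P (hi q) i - (hi q - q))]
    · linarith [le_max_right (MM P (lo q) i + P (lo q) i) (MM P (hi q) i + P (hi q) i - (hi q - q))]
  have e2 : QQ P lo hi q i ≤ P (hi q) i := by
    simp only [QQ, SS, MM_succ]
    have := le_max_left (MM P (lo q) i) (MM P (hi q) i - (hi q - q))
    have := le_max_right (MM P (lo q) i) (MM P (hi q) i - (hi q - q))
    rw [sub_le_iff_le_add]
    apply max_le <;> linarith
  rw [abs_le]; constructor <;> linarith

theorem gap_const (f : ℝ → ℝ) (s u c : ℝ) (hsu : s < u) (hf : ContinuousOn f (Icc s u))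
    (ha : ∀ x ∈ Ioo s u, AnalyticAt ℝ f x) (x0 : ℝ) (hx0 : x0 ∈ Ioo s u)
    (h0 : f =ᶠ[nhds x0] fun _ => c) : f s = c ∧ f u = c := by
  have hA : AnalyticOnNhd ℝ f (Ioo s u) := ha
  have hE : EqOn f (fun _ => c) (Ioo s u) :=
    hA.eqOn_of_preconnected_of_eventuallyEq (fun x _ => analyticAt_const) isPreconnected_Ioo hx0 h0
  have hE' : EqOn f (fun _ => c) (Icc s u) :=
    hE.of_subset_closure hf continuousOn_const Ioo_subset_Icc_self
      (by rw [closure_Ioo hsu.ne])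
  exact ⟨hE' (left_mem_Icc.2 hsu.le), hE' (right_mem_Icc.2 hsu.le)⟩

theorem stmt_4 (n : ℕ) (hn : 2 ≤ n) (I : Set ℝ) (hI0 : I ⊆ Ici 0)
    (hIclosed : IsClosed I) (hIconn : I.OrdConnected) (hIint : (interior I).Nonempty)
    (P : ℝ → Fin n → ℝ) (hP : IsGenNSystem n I P) (ε : ℝ) (hε : 0 < ε) :
    ∃ Q : ℝ → Fin n → ℝ, IsNSystem n I Q ∧
      ∀ q ∈ I, Real.sqrt (∑ i, (P q i - Q q i) ^ 2) ≤ ε := by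
  obtain ⟨hPc, hPl, hP0, hPm, hPG⟩ := hP
  have hn0 : (0 : ℝ) < n := by exact_mod_cast (by omega : 0 < n)
  obtain ⟨τ, hτ, hτε⟩ : ∃ τ : ℝ, 0 < τ ∧ n * (2 * τ) = ε :=
    ⟨ε / (2 * n), by positivity, by field_simp⟩
  set D : Set ℝ := {q | q ∈ I ∧ (q ∉ interior I ∨ (¬ ∀ i, AnalyticAt ℝ (fun t => P t i) q) ∨
    ∃ k : ℤ, q = k * τ)} with hD
  have hDI : D ⊆ I := fun x hx => hx.1
  have hsubint : ∀ a ∈ I, ∀ b ∈ I, Ioo a b ⊆ interior I := by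
    intro a ha b hb
    exact interior_maximal (fun x hx => hIconn.out ha hb ⟨hx.1.le, hx.2.le⟩) isOpen_Ioo
  -- isolation
  have hisoL : ∀ q ∈ I, ∃ δ > 0, ∀ x ∈ D, q - δ < x → ¬ x < q := by
    intro q hq
    by_cases hz : ∃ z ∈ I, z < q
    · obtain ⟨z, hz, hzq⟩ := hz
      obtain ⟨e, he, a, b, -, -, hab, -⟩ := hPl q hq
      set k : ℤ := ⌈q / τ⌉ - 1 with hk
      have hkq : (k : ℝ) * τ < q := by
        rw [← lt_div_iff₀ hτ, hk]; push_cast; linarith [Int.ceil_lt_add_one (q / τ)]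
      have hkq2 : q ≤ ((k : ℝ) + 1) * τ := by
        rw [← div_le_iff₀ hτ, hk]; push_cast; linarith [Int.le_ceil (q / τ)]
      refine ⟨min (q - z) (min e (q - k * τ)), lt_min (by linarith)
        (lt_min he (by linarith)), ?_⟩
      rintro x ⟨hxI, hx⟩ hx1 hxq
      have h1 : z < x := by linarith [min_le_left (q - z) (min e (q - k * τ))]
      have h2 : q - e < x := by
        linarith [min_le_right (q - z) (min e (q - k * τ)), min_le_left e (q - k * τ)]
      have h3 : k * τ < x := by
        linarith [min_le_right (q - z) (min e (q - k * τ)), min_le_right e (q - k * τ)]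
      rcases hx with hx | hx | ⟨m, hx⟩
      · exact hx (hsubint z hz q hq ⟨h1, hxq⟩)
      · apply hx
        intro i
        have : AnalyticAt ℝ (fun t => a i * t + b i) x := by fun_prop
        refine this.congr ?_
        filter_upwards [Ioo_mem_nhds (max_lt h1 h2) hxq] with t ht
        have ht1 := (max_lt_iff.1 ht.1).1
        have ht2 := (max_lt_iff.1 ht.1).2
        exact (hab t ⟨hIconn.out hz hq ⟨ht1.le, ht.2.le⟩, ht2.le, ht.2.le⟩ i).symm
      · rw [hx] at h3 hxq
        have h4 : (k : ℝ) < m := lt_of_mul_lt_mul_right h3 hτ.le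
        have h5 : (m : ℝ) < k + 1 := lt_of_mul_lt_mul_right (hxq.trans_le hkq2) hτ.le
        have h6 : k < m := by exact_mod_cast h4
        have h7 : m < k + 1 := by exact_mod_cast h5
        omega
    · refine ⟨1, one_pos, fun x hx _ hxq => hz ⟨x, hx.1, hxq⟩⟩
  have hisoR : ∀ q ∈ I, ∃ δ > 0, ∀ x ∈ D, x < q + δ → ¬ q < x := by
    intro q hq
    by_cases hz : ∃ z ∈ I, q < z
    · obtain ⟨z, hz, hzq⟩ := hz
      obtain ⟨e, he, -, -, a, b, -, hab⟩ := hPl q hq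
      set k : ℤ := ⌊q / τ⌋ + 1 with hk
      have hkq : q < (k : ℝ) * τ := by
        rw [← div_lt_iff₀ hτ, hk]; push_cast; linarith [Int.lt_floor_add_one (q / τ)]
      have hkq2 : ((k : ℝ) - 1) * τ ≤ q := by
        rw [← le_div_iff₀ hτ, hk]; push_cast; linarith [Int.floor_le (q / τ)]
      refine ⟨min (z - q) (min e (k * τ - q)), lt_min (by linarith)
        (lt_min he (by linarith)), ?_⟩
      rintro x ⟨hxI, hx⟩ hx1 hxq
      have h1 : x < z := by linarith [min_le_left (z - q) (min e (k * τ - q))]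
      have h2 : x < q + e := by
        linarith [min_le_right (z - q) (min e (k * τ - q)), min_le_left e (k * τ - q)]
      have h3 : x < k * τ := by
        linarith [min_le_right (z - q) (min e (k * τ - q)), min_le_right e (k * τ - q)]
      rcases hx with hx | hx | ⟨m, hx⟩
      · exact hx (hsubint q hq z hz ⟨hxq, h1⟩)
      · apply hx
        intro i
        have : AnalyticAt ℝ (fun t => a i * t + b i) x := by fun_prop
        refine this.congr ?_
        filter_upwards [Ioo_mem_nhds hxq (lt_min h1 h2)] with t ht
        have ht1 := (lt_min_iff.1 ht.2).1
        have ht2 := (lt_min_iff.1 ht.2).2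
        exact (hab t ⟨hIconn.out hq hz ⟨ht.1.le, ht1.le⟩, ht.1.le, ht2.le⟩ i).symm
      · rw [hx] at h3 hxq
        have h4 : (m : ℝ) < k := lt_of_mul_lt_mul_right h3 hτ.le
        have h5 : (k : ℝ) - 1 < m := lt_of_mul_lt_mul_right (hkq2.trans_lt hxq) hτ.le
        have h6 : m < k := by exact_mod_cast h4
        have h7 : k - 1 < m := by exact_mod_cast h5
        omega
    · refine ⟨1, one_pos, fun x hx _ hxq => hz ⟨x, hx.1, hxq⟩⟩
  have hiso : ∀ q ∈ I, ∃ δ > 0, ∀ x ∈ D, |x - q| < δ → x = q := by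
    intro q hq
    obtain ⟨d1, hd1, h1⟩ := hisoL q hq
    obtain ⟨d2, hd2, h2⟩ := hisoR q hq
    refine ⟨min d1 d2, lt_min hd1 hd2, fun x hx hxq => ?_⟩
    rw [abs_lt] at hxq
    have h3 := h1 x hx (by linarith [min_le_left d1 d2])
    have h4 := h2 x hx (by linarith [min_le_right d1 d2])
    linarith
  have hDclosed : IsClosed D := by
    rw [← isOpen_compl_iff, Metric.isOpen_iff]
    intro q hq
    by_cases hqI : q ∈ I
    · obtain ⟨δ, hδ, h⟩ := hiso q hqI
      refine ⟨δ, hδ, fun x hx hxD => hq ?_⟩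
      rw [Metric.mem_ball, Real.dist_eq] at hx
      rw [← h x hxD hx]; exact hxD
    · obtain ⟨δ, hδ, h⟩ := Metric.isOpen_iff.1 hIclosed.isOpen_compl q hqI
      exact ⟨δ, hδ, fun x hx hxD => h hx hxD.1⟩
  -- cofinality
  have hup : ∀ q ∈ I, ∃ x ∈ D, q ≤ x ∧ x ≤ q + τ := by
    intro q hq
    set y : ℝ := ⌈q / τ⌉ * τ with hy
    have hy1 : q ≤ y := by rw [hy, ← div_le_iff₀ hτ]; exact Int.le_ceil _
    have hy2 : y ≤ q + τ := by
      have := mul_le_mul_of_nonneg_right (Int.ceil_lt_add_one (q / τ)).le hτ.le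
      rw [add_mul, div_mul_cancel₀ _ hτ.ne'] at this
      linarith
    by_cases hyI : y ∈ I
    · exact ⟨y, ⟨hyI, Or.inr (Or.inr ⟨_, hy⟩)⟩, hy1, hy2⟩
    · have hcomp : IsCompact (I ∩ Icc q y) := isCompact_Icc.inter_left hIclosed
      obtain ⟨b, ⟨hbI, hb1, hb2⟩, hbmax⟩ := hcomp.exists_isGreatest ⟨q, hq, le_rfl, hy1⟩
      refine ⟨b, ⟨hbI, Or.inl fun hbint => ?_⟩, hb1, by linarith⟩
      obtain ⟨δ, hδ, hball⟩ := Metric.isOpen_iff.1 isOpen_interior b hbint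
      have hby : b < y := lt_of_le_of_ne hb2 (fun h => hyI (h ▸ hbI))
      have hlt : b < min y (b + δ / 2) := lt_min hby (by linarith)
      have hmem : min y (b + δ / 2) ∈ I := interior_subset (hball (by
        rw [Metric.mem_ball, Real.dist_eq, abs_lt]
        constructor <;> linarith [min_le_right y (b + δ / 2)]))
      have := hbmax ⟨hmem, by linarith, min_le_left _ _⟩
      linarith
  have hdown : ∀ q ∈ I, ∃ x ∈ D, x ≤ q ∧ q - τ ≤ x := by
    intro q hq
    set y : ℝ := ⌊q / τ⌋ * τ with hy
    have hy1 : y ≤ q := by rw [hy, ← le_div_iff₀ hτ]; exact Int.floor_le _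
    have hy2 : q - τ ≤ y := by
      have := mul_le_mul_of_nonneg_right (Int.lt_floor_add_one (q / τ)).le hτ.le
      rw [add_mul, div_mul_cancel₀ _ hτ.ne'] at this
      linarith
    by_cases hyI : y ∈ I
    · exact ⟨y, ⟨hyI, Or.inr (Or.inr ⟨_, hy⟩)⟩, hy1, hy2⟩
    · have hcomp : IsCompact (I ∩ Icc y q) := isCompact_Icc.inter_left hIclosed
      obtain ⟨b, ⟨hbI, hb1, hb2⟩, hbmin⟩ := hcomp.exists_isLeast ⟨q, hq, hy1, le_rfl⟩
      refine ⟨b, ⟨hbI, Or.inl fun hbint => ?_⟩, hb2, by linarith⟩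
      obtain ⟨δ, hδ, hball⟩ := Metric.isOpen_iff.1 isOpen_interior b hbint
      have hby : y < b := lt_of_le_of_ne hb1 (fun h => hyI (h ▸ hbI))
      have hlt : max y (b - δ / 2) < b := max_lt hby (by linarith)
      have hmem : max y (b - δ / 2) ∈ I := interior_subset (hball (by
        rw [Metric.mem_ball, Real.dist_eq, abs_lt]
        constructor <;> linarith [le_max_right y (b - δ / 2)]))
      have := hbmin ⟨hmem, le_max_left _ _, by linarith⟩
      linarith
  have hlo0 : ∀ q, ∃ x, q ∈ I → (x ∈ D ∧ x ≤ q ∧ ∀ y ∈ D, y ≤ q → y ≤ x) := by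
    intro q
    by_cases hq : q ∈ I
    · obtain ⟨x, hx, hxq, hxt⟩ := hdown q hq
      have hcomp : IsCompact (D ∩ Icc x q) := isCompact_Icc.inter_left hDclosed
      obtain ⟨b, ⟨hbI, hb1, hb2⟩, hbmax⟩ := hcomp.exists_isGreatest ⟨x, hx, le_rfl, hxq⟩
      refine ⟨b, fun _ => ⟨hbI, hb2, fun y hy hyq => ?_⟩⟩
      rcases le_total x y with h | h
      · exact hbmax ⟨hy, h, hyq⟩
      · linarith
    · exact ⟨0, fun h => absurd h hq⟩
  have hhi0 : ∀ q, ∃ x, q ∈ I → (x ∈ D ∧ q ≤ x ∧ ∀ y ∈ D, q ≤ y → x ≤ y) := by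
    intro q
    by_cases hq : q ∈ I
    · obtain ⟨x, hx, hxq, hxt⟩ := hup q hq
      have hcomp : IsCompact (D ∩ Icc q x) := isCompact_Icc.inter_left hDclosed
      obtain ⟨b, ⟨hbI, hb1, hb2⟩, hbmin⟩ := hcomp.exists_isLeast ⟨x, hx, hxq, le_rfl⟩
      refine ⟨b, fun _ => ⟨hbI, hb1, fun y hy hyq => ?_⟩⟩
      rcases le_total y x with h | h
      · exact hbmin ⟨hy, hyq, h⟩
      · linarith
    · exact ⟨0, fun h => absurd h hq⟩
  choose lo hlo using hlo0
  choose hi hhi using hhi0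
  have hMc : ∀ j, ContinuousOn (fun t => MM P t j) I := by
    intro j
    unfold MM
    apply continuousOn_finsetSum
    intro i _
    split_ifs
    · exact (continuous_apply i).comp_continuousOn hPc
    · exact continuousOn_const
  have hMa : ∀ s ∈ D, ∀ u ∈ D, (∀ x ∈ D, ¬ (s < x ∧ x < u)) → ∀ x ∈ Ioo s u, ∀ j,
      AnalyticAt ℝ (fun t => MM P t j) x := by
    intro s hs u hu hgap x hx j
    have hxi := hsubint s hs.1 u hu.1 hx
    have hxa : ∀ i, AnalyticAt ℝ (fun t => P t i) x := by
      by_contra h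
      exact hgap x ⟨interior_subset hxi, Or.inr (Or.inl h)⟩ hx
    unfold MM
    apply Finset.analyticAt_fun_sum
    intro i _
    split_ifs
    · exact hxa i
    · exact analyticAt_const
  refine ⟨QQ P lo hi, core n (by omega) I D P lo hi hIconn hP0 (fun i => (hPm i).1) hDI hlo hhi
    hiso ?_, ?_⟩
  · intro s hs q hq u hu hsq hqu hgap1 hgap2 j hj hm1 hm2
    by_contra hne
    have hlt : P q ⟨j, Nat.lt_of_succ_lt hj⟩ < P q ⟨j + 1, hj⟩ :=
      lt_of_le_of_ne ((hP0 q hq.1).2.1 (by simp)) hne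
    have hqi : q ∈ interior I := hsubint s hs.1 u hu.1 ⟨hsq, hqu⟩
    have hca : ContinuousAt P q := hPc.continuousAt (mem_interior_iff_mem_nhds.1 hqi)
    have hev : ∀ᶠ x in nhds q, P x ⟨j, Nat.lt_of_succ_lt hj⟩ < P x ⟨j + 1, hj⟩ :=
      ((continuous_apply _).continuousAt.comp hca).eventually_lt
        ((continuous_apply _).continuousAt.comp hca) hlt
    obtain ⟨δ, hδ, hball⟩ := Metric.eventually_nhds_iff.1 hev
    have hl : max s (q - δ) < q := max_lt hsq (by linarith)
    have hr : q < min u (q + δ) := lt_min hqu (by linarith)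
    set A := max s (q - δ) with hA
    set B := min u (q + δ) with hB
    have hAs : s ≤ A := le_max_left _ _
    have hBu : B ≤ u := min_le_left _ _
    have hAd : q - δ ≤ A := le_max_right _ _
    have hBd : B ≤ q + δ := min_le_right _ _
    obtain ⟨c, v, hcv⟩ := hPG j hj (Ioo A B)
      (fun x hx => hIconn.out hs.1 hu.1 ⟨by linarith [hx.1], by linarith [hx.2]⟩)
      ordConnected_Ioo (fun x hx => hball (by
        rw [Real.dist_eq, abs_lt]; constructor <;> linarith [hx.1, hx.2]))
    have hcv' : ∀ t ∈ Ioo A B, MM P t (j + 1) = v + max (t - c) 0 := by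
      intro t ht
      rw [← hcv t ht]
      simp [MM]
    rcases le_or_gt q c with hc | hc
    · have := gap_const (fun t => MM P t (j + 1)) s q v hsq
        ((hMc _).mono fun x hx => hIconn.out hs.1 hq.1 hx)
        (fun x hx => hMa s hs q hq hgap1 x hx _) ((A + q) / 2)
        ⟨by linarith, by linarith⟩ (by
          filter_upwards [Ioo_mem_nhds (show A < (A + q) / 2 by linarith)
            (show (A + q) / 2 < q by linarith)] with t ht
          rw [hcv' t ⟨ht.1, by linarith [ht.2]⟩, max_eq_right (by linarith [ht.2])]
          ring)
      linarith [this.1, this.2]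
    · have := gap_const (fun t => MM P t (j + 1) - t) q u (v - c) hqu
        (((hMc _).mono fun x hx => hIconn.out hq.1 hu.1 hx).sub continuousOn_id)
        (fun x hx => (hMa q hq u hu hgap2 x hx _).sub analyticAt_id) ((q + B) / 2)
        ⟨by linarith, by linarith⟩ (by
          filter_upwards [Ioo_mem_nhds (show q < (q + B) / 2 by linarith)
            (show (q + B) / 2 < B by linarith)] with t ht
          rw [hcv' t ⟨by linarith [ht.1], ht.2⟩, max_eq_left (by linarith [ht.1])]
          ring)
      linarith [this.1, this.2]
  · intro q hq
    obtain ⟨a1, a2, a3⟩ := hlo q hq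
    obtain ⟨b1, b2, b3⟩ := hhi q hq
    have hgap : hi q - lo q ≤ 2 * τ := by
      obtain ⟨x, hx, hx1, hx2⟩ := hup q hq
      obtain ⟨y, hy, hy1, hy2⟩ := hdown q hq
      linarith [a3 y hy hy1, b3 x hx hx1]
    have hb : ∀ i, |P q i - QQ P lo hi q i| ≤ 2 * τ := by
      intro i
      apply QQ_close
      · exact (hPm i).1 a1.1 hq a2
      · exact (hPm i).1 hq b1.1 b2
      · have := (hPm i).2.dist_le_mul _ b1.1 _ a1.1
        rw [Real.dist_eq, Real.dist_eq, abs_of_nonneg (by linarith : 0 ≤ hi q - lo q)] at this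
        simp only [NNReal.coe_one, one_mul] at this
        linarith [le_abs_self (P (hi q) i - P (lo q) i)]
    rw [← hτε]
    apply Real.sqrt_le_iff.2
    refine ⟨by positivity, ?_⟩
    calc ∑ i, (P q i - QQ P lo hi q i) ^ 2 ≤ ∑ i : Fin n, (2 * τ) ^ 2 :=
          Finset.sum_le_sum fun i _ => sq_le_sq' (by linarith [abs_le.1 (hb i)])
            (abs_le.1 (hb i)).2
      _ = n * (2 * τ) ^ 2 := by simp
      _ ≤ (n * (2 * τ)) ^ 2 := by
          rw [mul_pow (n : ℝ) (2 * τ)]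
          have h1 : (1 : ℝ) ≤ n := by exact_mod_cast (by omega : 1 ≤ n)
          have h2 : (n : ℝ) ≤ n ^ 2 := by nlinarith
          exact mul_le_mul_of_nonneg_right h2 (sq_nonneg (2 * τ))
end
end

section
/- Fix real numbers 1 < α < β. Suppose that a proper 4-system P on some interval [q₀,∞) satisfies B̄_1 ∈ K(P) ⊆ K, where K is the convex hull of {B̄_1, Ā_1, Ā_2, Ā_3, E_3}. Then K(P) ⊆ Δ̄_3, i.e. every point (x_1,x_2,x_3,x_4) of K(P) satisfies x_3 = x_4. -/
open Set Filter

noncomputable section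

/-- `F(P)`: the set of accumulation points of `q⁻¹ P(q)` as `q → ∞`. -/
def accPts (n : ℕ) (P : ℝ → Fin n → ℝ) : Set (Fin n → ℝ) :=
  {x | MapClusterPt x atTop fun q : ℝ => q⁻¹ • P q}

/-- `K(P)`: the convex hull of `F(P)`. -/
def Kset (n : ℕ) (P : ℝ → Fin n → ℝ) : Set (Fin n → ℝ) :=
  convexHull ℝ (accPts n P)

def ptA1 (α : ℝ) : Fin 4 → ℝ := ![1, 1, 1, α]
def ptA2 (α : ℝ) : Fin 4 → ℝ := ![1, 1, α, α]
def ptA3 (α : ℝ) : Fin 4 → ℝ := ![1, 1, α, α ^ 2]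
def ptB1 (β : ℝ) : Fin 4 → ℝ := ![1, β, β, β]
noncomputable def ptE3 : Fin 4 → ℝ := ![0, 0, 1/2, 1/2]

/-- `Ā₁ = A₁/|A₁|`, where `|X|` is the sum of the coordinates of `X`. -/
noncomputable def nA1 (α : ℝ) : Fin 4 → ℝ := (3 + α)⁻¹ • ptA1 α
noncomputable def nA2 (α : ℝ) : Fin 4 → ℝ := (2 + 2 * α)⁻¹ • ptA2 α
noncomputable def nA3 (α : ℝ) : Fin 4 → ℝ := (2 + α + α ^ 2)⁻¹ • ptA3 α
noncomputable def nB1 (β : ℝ) : Fin 4 → ℝ := (1 + 3 * β)⁻¹ • ptB1 β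

/-- The convex hull `K` of `{B̄₁, Ā₁, Ā₂, Ā₃, E₃}`. -/
noncomputable def Kbig (α β : ℝ) : Set (Fin 4 → ℝ) :=
  convexHull ℝ {nB1 β, nA1 α, nA2 α, nA3 α, ptE3}

lemma nsys_nhd {P : ℝ → Fin 4 → ℝ} {q₀ : ℝ} (hP : IsNSystem 4 (Ici q₀) P) (i : Fin 4) :
    ContinuousOn (fun t => P t i) (Ici q₀) := by
  intro q hq
  obtain ⟨-, e, he, k, l, hl, hk, -⟩ := hP q hq
  rw [ContinuousWithinAt, Metric.tendsto_nhdsWithin_nhds]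
  intro d hd
  refine ⟨min e d, lt_min he hd, fun {t} ht hdist => ?_⟩
  rw [Real.dist_eq] at hdist ⊢
  have h1 := lt_of_lt_of_le hdist (min_le_left _ _)
  have h2 := lt_of_lt_of_le hdist (min_le_right _ _)
  rw [abs_lt] at h1
  have key : ∀ j : Fin 4, |(P q + Pi.single j (t - q) : Fin 4 → ℝ) i - P q i| < d := by
    intro j
    by_cases h : i = j
    · subst h; simpa using h2
    · simp [Pi.single_apply, h, hd]
  rcases le_total t q with h | h
  · simp only [hl t ⟨ht, by constructor <;> linarith⟩]; exact key l
  · simp only [hk t ⟨ht, by constructor <;> linarith⟩]; exact key k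

lemma nsys_mono {P : ℝ → Fin 4 → ℝ} {q₀ : ℝ} (hP : IsNSystem 4 (Ici q₀) P) (i : Fin 4)
    {a b : ℝ} (ha : q₀ ≤ a) (hab : a ≤ b) : P a i ≤ P b i := by
  have hsub : Icc a b ⊆ Ici q₀ := fun t ht => le_trans ha ht.1
  have hc : IsClosed ({t | P a i ≤ P t i} ∩ Icc a b) := by
    have := (((nsys_nhd hP i).mono hsub)).preimage_isClosed_of_isClosed isClosed_Icc
      (isClosed_Ici (a := P a i))
    rw [inter_comm]; exact this
  refine hc.Icc_subset_of_forall_exists_gt (a := a) (b := b) (le_refl (P a i)) ?_ ⟨hab, le_rfl⟩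
  rintro x ⟨hx, hx1, hx2⟩ y hy
  obtain ⟨-, e, he, k, l, hl, hk, -⟩ := hP x (ha.trans hx1)
  have hy : x < y := hy
  refine ⟨min y (x + e), ?_, lt_min hy (by linarith), min_le_left _ _⟩
  have hlt : x < min y (x + e) := lt_min hy (by linarith)
  have := hk (min y (x + e)) ⟨(ha.trans hx1).trans hlt.le, hlt.le, min_le_right _ _⟩
  simp only [mem_ofPred_eq] at hx ⊢
  rw [this]
  simp only [Pi.add_apply, Pi.single_apply]
  split_ifs <;> linarith

lemma nsys_slope {P : ℝ → Fin 4 → ℝ} {q₀ : ℝ} (hP : IsNSystem 4 (Ici q₀) P) (j j' : Fin 4)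
    (hj : j < j') (hjj : ∀ i, i ≤ j ∨ j' ≤ i) {a b : ℝ} (ha : q₀ ≤ a)
    (hdir : ∃ e > 0, ∀ t ∈ Icc a (a + e), ∀ i, j' ≤ i → P t i = P a i)
    (hlt : ∀ t ∈ Ico a b, P t j < P t j') :
    ∀ t ∈ Icc a b, ∀ i, j' ≤ i → P t i = P a i := by
  have hsub : Icc a b ⊆ Ici q₀ := fun t ht => le_trans ha ht.1
  have hc : IsClosed ({t | ∀ i, j' ≤ i → P t i = P a i} ∩ Icc a b) := by
    have h1 : ∀ i, IsClosed (Icc a b ∩ {t | j' ≤ i → P t i = P a i}) := by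
      intro i
      by_cases hi : j' ≤ i
      · simp only [hi, forall_const]
        exact (((nsys_nhd hP i).mono hsub)).preimage_isClosed_of_isClosed isClosed_Icc
          (isClosed_singleton (x := P a i))
      · simp only [hi, false_imp_iff, ofPred_true, inter_univ]; exact isClosed_Icc
    have h2 := isClosed_iInter h1
    convert h2 using 1
    ext t
    simp only [mem_inter_iff, mem_ofPred_eq, mem_iInter]
    constructor
    · rintro ⟨h, h'⟩ i; exact ⟨h', h i⟩
    · intro h; exact ⟨fun i => (h i).2, (h 0).1⟩
  refine hc.Icc_subset_of_forall_exists_gt (a := a) (b := b) (fun _ _ => rfl) ?_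
  rintro x ⟨hx, hx1, hx2⟩ y hy
  have hy : x < y := hy
  rcases hx1.eq_or_lt with rfl | hax
  · obtain ⟨e, he, h⟩ := hdir
    have hlt : a < min y (a + e) := lt_min hy (by linarith)
    exact ⟨min y (a + e), h _ ⟨hlt.le, min_le_right _ _⟩, hlt, min_le_left _ _⟩
  obtain ⟨-, e, he, k, l, hl, hk, h3⟩ := hP x (ha.trans hx1)
  have hll : l ≤ j := by
    rcases hjj l with h | h
    · exact h
    exfalso
    have hu : max a (x - e) < x := max_lt hax (by linarith)
    have h1 := hl (max a (x - e)) ⟨ha.trans (le_max_left _ _), le_max_right _ _, hu.le⟩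
    have h2 := congrFun h1 l
    simp only [Pi.add_apply, Pi.single_eq_same] at h2
    have h4 := nsys_mono hP l ha (le_max_left a (x - e))
    have h5 := hx l h
    linarith
  have hkk : k ≤ j := by
    rcases hjj k with h | h
    · exact h
    exfalso
    have h4 := h3 (by rw [interior_Ici]; exact lt_of_le_of_lt ha hax)
      (lt_of_le_of_lt hll (lt_of_lt_of_le hj h))
    have h5 := h4 j hll (hj.le.trans h)
    have h6 := h4 j' (hll.trans hj.le) h
    have := hlt x ⟨hx1, hx2⟩
    linarith
  have hlt' : x < min y (x + e) := lt_min hy (by linarith)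
  refine ⟨min y (x + e), ?_, hlt', min_le_left _ _⟩
  intro i hi
  rw [hk _ ⟨(ha.trans hx1).trans hlt'.le, hlt'.le, min_le_right _ _⟩]
  have : i ≠ k := (lt_of_le_of_lt hkk (lt_of_lt_of_le hj hi)).ne'
  simp [Pi.single_apply, this, hx i hi]

lemma nsys_hit {P : ℝ → Fin 4 → ℝ} {q₀ : ℝ} (hP : IsNSystem 4 (Ici q₀) P)
    (hprop : IsProper 4 P) (j j' : Fin 4)
    (hj : j < j') (hjj : ∀ i, i ≤ j ∨ j' ≤ i) {a : ℝ} (ha : q₀ ≤ a)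
    (hdir : ∃ e > 0, ∀ t ∈ Icc a (a + e), ∀ i, j' ≤ i → P t i = P a i)
    (hlt : P a j < P a j') :
    ∃ b, a < b ∧ P b j = P b j' ∧ (∀ t ∈ Ico a b, P t j < P t j') ∧
      ∀ t ∈ Icc a b, ∀ i, j' ≤ i → P t i = P a i := by
  have hle : ∀ t, a ≤ t → P t j ≤ P t j' := fun t ht =>
    (hP t (ha.trans ht)).1.2.1 hj.le
  set H : Set ℝ := Ici a ∩ {t | P t j' - P t j = 0} with hH
  have hHc : IsClosed H := by
    have : ContinuousOn (fun t => P t j' - P t j) (Ici a) :=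
      ((nsys_nhd hP j').sub (nsys_nhd hP j)).mono (Ici_subset_Ici.2 ha)
    exact this.preimage_isClosed_of_isClosed isClosed_Ici (isClosed_singleton (x := (0:ℝ)))
  have hne : H.Nonempty := by
    by_contra hcon
    rw [not_nonempty_iff_eq_empty] at hcon
    have hall : ∀ t, a ≤ t → P t j < P t j' := by
      intro t ht
      refine lt_of_le_of_ne (hle t ht) fun h => ?_
      have : t ∈ H := ⟨ht, by simp [h]⟩
      rw [hcon] at this; exact this
    obtain ⟨b, hb, hb'⟩ := ((hprop j').eventually_gt_atTop (P a j')).and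
      (eventually_ge_atTop a) |>.exists
    have := nsys_slope hP j j' hj hjj (b := b) ha hdir (fun t ht => hall t ht.1) b
      ⟨hb', le_rfl⟩ j' le_rfl
    linarith
  have hbd : BddBelow H := ⟨a, fun t ht => ht.1⟩
  have hmem := hHc.csInf_mem hne hbd
  have heq : P (sInf H) j = P (sInf H) j' := by
    have : P (sInf H) j' - P (sInf H) j = 0 := hmem.2
    linarith
  have hlt' : ∀ t ∈ Ico a (sInf H), P t j < P t j' := by
    intro t ht
    refine lt_of_le_of_ne (hle t ht.1) fun h => ?_
    have : t ∈ H := ⟨ht.1, by simp [h]⟩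
    have := csInf_le hbd this
    linarith [ht.2]
  refine ⟨sInf H, lt_of_le_of_ne hmem.1 ?_, heq, hlt', nsys_slope hP j j' hj hjj ha hdir hlt'⟩
  intro h
  rw [← h] at heq
  linarith

lemma ev_lin {P : ℝ → Fin 4 → ℝ} {q₀ : ℝ} (hP : IsNSystem 4 (Ici q₀) P)
    (w : Fin 4 → ℝ) (hw : ∀ x ∈ accPts 4 P, ∑ i, w i * x i ≤ 0) {ε : ℝ} (hε : 0 < ε) :
    ∀ᶠ q in atTop, ∑ i, w i * P q i ≤ ε * q := by
  by_contra hcon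
  rw [not_eventually] at hcon
  have hcomp : IsCompact (Icc (0 : Fin 4 → ℝ) 1 ∩ {x | ε ≤ ∑ i, w i * x i}) := by
    apply isCompact_Icc.inter_right
    exact isClosed_le continuous_const (by fun_prop)
  have hfr : ∃ᶠ q in atTop, q⁻¹ • P q ∈ Icc (0 : Fin 4 → ℝ) 1 ∩ {x | ε ≤ ∑ i, w i * x i} := by
    refine (hcon.and_eventually ((eventually_ge_atTop q₀).and (eventually_gt_atTop 0))).mono ?_
    rintro q ⟨h1, h2, h3⟩
    obtain ⟨⟨hn, -, hs⟩, -⟩ := hP q h2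
    refine ⟨⟨fun i => ?_, fun i => ?_⟩, ?_⟩
    · have := hn i
      simp only [Pi.zero_apply, Pi.smul_apply, smul_eq_mul]; positivity
    · simp only [Pi.one_apply, Pi.smul_apply, smul_eq_mul]
      rw [inv_mul_le_iff₀ h3, mul_one]
      calc P q i ≤ ∑ i, P q i := Finset.single_le_sum (fun i _ => hn i) (Finset.mem_univ i)
        _ = q := hs
    · simp only [mem_ofPred_eq, Pi.smul_apply, smul_eq_mul]
      have : ∑ i, w i * (q⁻¹ * P q i) = q⁻¹ * ∑ i, w i * P q i := by
        rw [Finset.mul_sum]; exact Finset.sum_congr rfl fun i _ => by ring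
      rw [this, le_inv_mul_iff₀ h3]
      linarith
  obtain ⟨x, hx, hx'⟩ := hcomp.exists_mapClusterPt_of_frequently hfr
  have := hw x hx'
  have h2 : ε ≤ ∑ i, w i * x i := hx.2
  linarith

lemma K_lin {α β : ℝ} (hα : 1 < α) (hαβ : α < β) (w : Fin 4 → ℝ)
    (h1 : w 0 + w 1 * β + w 2 * β + w 3 * β ≤ 0)
    (h2 : w 0 + w 1 + w 2 + w 3 * α ≤ 0)
    (h3 : w 0 + w 1 + w 2 * α + w 3 * α ≤ 0)
    (h4 : w 0 + w 1 + w 2 * α + w 3 * α ^ 2 ≤ 0)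
    (h5 : w 2 + w 3 ≤ 0) : ∀ x ∈ Kbig α β, ∑ i, w i * x i ≤ 0 := by
  have hconv : Convex ℝ {x : Fin 4 → ℝ | ∑ i, w i * x i ≤ 0} := by
    apply convex_halfSpace_le
    constructor
    · intro x y; simp [Finset.sum_add_distrib, mul_add]
    · intro c x; simp [Finset.mul_sum, mul_left_comm]
  have hs : Kbig α β ⊆ {x : Fin 4 → ℝ | ∑ i, w i * x i ≤ 0} := by
    apply convexHull_min _ hconv
    have key : ∀ (r : ℝ) (v : Fin 4 → ℝ), 0 < r → ∑ i, w i * v i ≤ 0 →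
        ∑ i, w i * (r⁻¹ • v) i ≤ 0 := by
      intro r v hr hv
      have : ∑ i, w i * (r⁻¹ • v) i = r⁻¹ * ∑ i, w i * v i := by
        simp [Finset.mul_sum, mul_left_comm]
      rw [this]
      exact mul_nonpos_of_nonneg_of_nonpos (by positivity) hv
    have hα0 : 0 < α := by linarith
    have hβ0 : 0 < β := by linarith
    intro x hx
    simp only [mem_insert_iff, mem_singleton_iff] at hx
    simp only [mem_ofPred_eq]
    rcases hx with rfl | rfl | rfl | rfl | rfl
    · exact key _ _ (by positivity) (by simp [Fin.sum_univ_four, ptB1]; linarith)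
    · exact key _ _ (by positivity) (by simp [Fin.sum_univ_four, ptA1]; linarith)
    · exact key _ _ (by positivity) (by simp [Fin.sum_univ_four, ptA2]; linarith)
    · exact key _ _ (by positivity) (by simp [Fin.sum_univ_four, ptA3]; linarith)
    · simp [Fin.sum_univ_four, ptE3]; linarith
  exact fun x hx => hs hx

lemma arith_contra {α a c η ε p r v t1 t2 : ℝ} (ha : 0 < a) (hc : 0 < c)
    (hr : 0 < r) (hpr : p ≤ r) (hv : 0 ≤ v) (hα : 0 < α) (hη : 0 < η) (hε : 0 < ε)
    (hη2 : α * η ≤ c / 4) (hε1 : ε ≤ c / 4) (hε2 : ε ≤ a * c / 48)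
    (h1 : a * c * r - ε * t2 ≤ c * v) (h2 : c * v ≤ α * a * η * p + ε * t1)
    (ht12 : t1 ≤ t2) (ht2 : t2 = 4 * r + v) : False := by
  have e1 : ε * t1 ≤ ε * t2 := by gcongr
  have e2 : α * a * η * p ≤ a * c / 4 * r := by
    have : α * η * (a * r) ≤ c / 4 * (a * r) := by gcongr
    have : α * a * η * p ≤ α * a * η * r := by gcongr
    linarith
  have e3 : ε * t2 = 4 * (ε * r) + ε * v := by rw [ht2]; ring
  have e4 : ε * v ≤ c / 4 * v := by gcongr
  have e5 : ε * r ≤ a * c / 48 * r := by gcongr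
  have : 0 < a * c * r := by positivity
  nlinarith

lemma arith_next {α β a c η ε p p' z v t3 C : ℝ} (ha : 0 < a) (hc : 0 < c)
    (hp : 0 < p) (hv : 0 ≤ v) (hα : 0 < α) (hαβ : α < β) (hη : 0 < η) (hε : 0 < ε)
    (hη1 : η ≤ (β - α) / 2) (hη2 : α * η ≤ c / 4) (hε1 : ε ≤ c / 4) (hε3 : ε ≤ 1 / 12)
    (hC : C = 2 * (1 + 3 * β + a / 4))
    (hε4 : 2 * ε * C * (α + β) ≤ a * η * (β - α))
    (hp' : (β - η) * p ≤ p') (hpp : p ≤ p')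
    (ht3 : t3 = p' + 3 * z + v) (hz : z ≤ β * p' + ε * t3)
    (h2 : c * v ≤ α * a * η * p + ε * t3)
    (h1 : a * (β * p' - z) - ε * t3 ≤ c * v) (ht : 0 < t3) :
    β * p' - z ≤ η * p' := by
  have hp0 : 0 < p' := by linarith
  have e2 : α * a * η * p ≤ a * c / 4 * p' := by
    have : α * η * (a * p') ≤ c / 4 * (a * p') := by gcongr
    have : α * a * η * p ≤ α * a * η * p' := by gcongr
    linarith
  have e3 : ε * t3 ≤ c / 4 * t3 := by gcongr
  have e3' : ε * t3 ≤ 1 / 12 * t3 := by gcongr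
  have e4 : v ≤ a / 4 * p' + t3 / 4 := by
    have : c * v ≤ c * (a / 4 * p' + t3 / 4) := by linarith
    exact le_of_mul_le_mul_left this hc
  have e5 : t3 ≤ C * p' := by rw [hC]; linarith
  have e6 : a * (β * p' - z) ≤ α * a * η * p + 2 * (ε * (C * p')) := by
    have : ε * t3 ≤ ε * (C * p') := by gcongr
    linarith
  have e7 : (α + β) / 2 * p ≤ p' := by
    refine le_trans ?_ hp'
    gcongr; linarith
  have e8 : (a * (α + β)) * (β * p' - z) ≤ (a * (α + β)) * (η * p') := by
    have f1 : (α + β) * (a * (β * p' - z)) ≤ (α + β) * (α * a * η * p + 2 * (ε * (C * p'))) := by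
      gcongr; linarith
    have f2 : (2 * α * a * η) * ((α + β) / 2 * p) ≤ (2 * α * a * η) * p' := by gcongr
    have f3 : (2 * ε * C * (α + β)) * p' ≤ (a * η * (β - α)) * p' := by gcongr
    linarith
  have : 0 < a * (α + β) := by apply mul_pos ha; linarith
  exact le_of_mul_le_mul_left e8 this

lemma step {P : ℝ → Fin 4 → ℝ} {q₀ : ℝ} (hq₀ : 0 ≤ q₀) (hP : IsNSystem 4 (Ici q₀) P)
    (hprop : IsProper 4 P) {α β η ε C Q : ℝ} (hα1 : 1 < α) (hαβ : α < β)
    (hη : 0 < η) (hε : 0 < ε)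
    (hη1 : η ≤ (β - α) / 2) (hη2 : α * η ≤ (β - 1) / 4) (hε1 : ε ≤ (β - 1) / 4)
    (hε2 : ε ≤ (α - 1) * (β - 1) / 48) (hε3 : ε ≤ 1 / 12)
    (hC : C = 2 * (1 + 3 * β + (α - 1) / 4))
    (hε4 : 2 * ε * C * (α + β) ≤ (α - 1) * η * (β - α)) (hQ : q₀ ≤ Q)
    (hbig : ∀ t, Q ≤ t → 1 ≤ P t 0)
    (I0 : ∀ t, Q ≤ t → P t 1 - β * P t 0 ≤ ε * t)
    (I1 : ∀ t, Q ≤ t → (α - 1) * (β * P t 0 - P t 1) - (β - 1) * (P t 3 - P t 1) ≤ ε * t)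
    (I2 : ∀ t, Q ≤ t → (β - 1) * (P t 3 - P t 2) - α * (α - 1) * (β * P t 0 - P t 1) ≤ ε * t)
    {T : ℝ} (hT : Q ≤ T) (hgood : β * P T 0 - P T 1 ≤ η * P T 0) :
    ∃ T', T + ((α + β) / 2 - 1) ≤ T' ∧ β * P T' 0 - P T' 1 ≤ η * P T' 0 ∧
      ∀ t ∈ Icc T T', (β - 1) * (P t 3 - P t 2) ≤ (α * (α - 1) * η + ε) * t := by
  have hTq : q₀ ≤ T := hQ.trans hT
  have ha : 0 < α - 1 := by linarith
  have hc : 0 < β - 1 := by linarith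
  have hα0 : 0 < α := by linarith
  have hβη : (α + β) / 2 ≤ β - η := by linarith
  have hsum : ∀ t, q₀ ≤ t → P t 0 + P t 1 + P t 2 + P t 3 = t := by
    intro t ht
    have := (hP t ht).1.2.2
    rwa [Fin.sum_univ_four] at this
  have hord : ∀ t, q₀ ≤ t → ∀ i j : Fin 4, i ≤ j → P t i ≤ P t j := fun t ht i j hij =>
    (hP t ht).1.2.1 hij
  have hnn : ∀ t, q₀ ≤ t → ∀ i : Fin 4, 0 ≤ P t i := fun t ht i => (hP t ht).1.1 i
  obtain ⟨p, hp⟩ : ∃ p, p = P T 0 := ⟨_, rfl⟩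
  have hp1 : 1 ≤ p := hp ▸ hbig T hT
  -- phase I
  set H : Set ℝ := Ici T ∩ {t | P t 0 = p} with hH
  have hHc : IsClosed H :=
    ((nsys_nhd hP 0).mono (Ici_subset_Ici.2 hTq)).preimage_isClosed_of_isClosed isClosed_Ici
      (isClosed_singleton (x := p))
  have hne : H.Nonempty := ⟨T, self_mem_Ici, hp.symm⟩
  have hbd : BddAbove H := by
    obtain ⟨b, hb, hb'⟩ := ((hprop 0).eventually_gt_atTop p).and
      (eventually_ge_atTop T) |>.exists
    refine ⟨b, fun t ht => ?_⟩
    by_contra hlt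
    push Not at hlt
    have h1 := nsys_mono hP 0 (hTq.trans hb') hlt.le
    have h2 : P t 0 = p := ht.2
    linarith
  obtain ⟨τ, hτ⟩ : ∃ τ, τ = sSup H := ⟨_, rfl⟩
  have hτmem : τ ∈ H := hτ ▸ hHc.csSup_mem hne hbd
  have hτT : T ≤ τ := hτmem.1
  have hτp : P τ 0 = p := hτmem.2
  have hτq : q₀ ≤ τ := hTq.trans hτT
  have phI : ∀ t ∈ Icc T τ, P t 0 = p ∧ β * p - P t 1 ≤ η * p := by
    intro t ht
    have h1 := nsys_mono hP 0 hTq ht.1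
    have h2 := nsys_mono hP 0 (hTq.trans ht.1) ht.2
    have h3 := nsys_mono hP 1 hTq ht.1
    rw [← hp] at hgood h1
    constructor <;> linarith
  have phIv : ∀ t ∈ Icc T τ, (β - 1) * (P t 3 - P t 2) ≤ α * (α - 1) * η * p + ε * t := by
    intro t ht
    obtain ⟨h1, h2⟩ := phI t ht
    have h3 := I2 t (hT.trans ht.1)
    rw [h1] at h3
    have h4 : α * (α - 1) * (β * p - P t 1) ≤ α * (α - 1) * (η * p) := by gcongr
    linarith
  have hdir : ∀ j' : Fin 4, 1 ≤ j' → ∃ e > 0, ∀ t ∈ Icc τ (τ + e), ∀ i, j' ≤ i → P t i = P τ i := by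
    intro j' hj'
    obtain ⟨-, e, he, k, l, hl, hk, -⟩ := hP τ hτq
    have hk0 : k = 0 := by
      by_contra hne0
      have h1 := hk (τ + e) ⟨hτq.trans (by linarith), by linarith, le_rfl⟩
      have h2 : P (τ + e) 0 = p := by
        rw [h1]; simp [Ne.symm hne0, hτp]
      have h3 : τ + e ∈ H := ⟨hτT.trans (by linarith), h2⟩
      have h4 := le_csSup hbd h3
      linarith
    refine ⟨e, he, fun t ht i hi => ?_⟩
    rw [hk t ⟨hτq.trans ht.1, ht⟩, hk0]
    have : i ≠ 0 := by
      rintro rfl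
      have := hj'.trans hi
      exact absurd this (by decide)
    simp [this]
  obtain ⟨r, hr⟩ : ∃ r, r = P τ 1 := ⟨_, rfl⟩
  obtain ⟨z, hz⟩ : ∃ z, z = P τ 2 := ⟨_, rfl⟩
  obtain ⟨y, hy⟩ : ∃ y, y = P τ 3 := ⟨_, rfl⟩
  have hrp : (β - η) * p ≤ r := by
    have := (phI τ ⟨hτT, le_rfl⟩).2
    rw [hr]; linarith
  have hrp' : (α + β) / 2 * p ≤ r := le_trans (by gcongr) hrp
  have hpr : p < r := by nlinarith
  have hv0 : 0 ≤ y - z := by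
    have := hord τ hτq 2 3 (by decide)
    rw [hy, hz]; linarith
  have hvτ : (β - 1) * (y - z) ≤ α * (α - 1) * η * p + ε * τ := by
    have := phIv τ ⟨hτT, le_rfl⟩
    rwa [← hy, ← hz] at this
  -- phase II
  obtain ⟨τ₂, hτ₂, heq₂, -, hcst₂⟩ := nsys_hit hP hprop 0 1 (by decide) (by decide) hτq
    (hdir 1 le_rfl) (by rw [hτp, ← hr]; exact hpr)
  have c1 : ∀ t ∈ Icc τ τ₂, P t 1 = r := fun t ht => by rw [hr]; exact hcst₂ t ht 1 le_rfl
  have c2 : ∀ t ∈ Icc τ τ₂, P t 2 = z := fun t ht => by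
    rw [hz]; exact hcst₂ t ht 2 (by decide)
  have c3 : ∀ t ∈ Icc τ τ₂, P t 3 = y := fun t ht => by
    rw [hy]; exact hcst₂ t ht 3 (by decide)
  have m₂ : τ₂ ∈ Icc τ τ₂ := ⟨hτ₂.le, le_rfl⟩
  have hrz : r < z := by
    have hle : r ≤ z := by rw [hr, hz]; exact hord τ hτq 1 2 (by decide)
    refine lt_of_le_of_ne hle fun hEq => ?_
    have h1 := I1 τ₂ (hT.trans (hτT.trans hτ₂.le))
    have hs := hsum τ₂ (hτq.trans hτ₂.le)
    rw [heq₂, c1 _ m₂, c3 _ m₂] at h1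
    rw [heq₂, c1 _ m₂, c2 _ m₂, c3 _ m₂] at hs
    exact arith_contra (α := α) (a := α - 1) (c := β - 1) (η := η) (ε := ε) (p := p) (r := r)
      (v := y - z) (t1 := τ) (t2 := τ₂) ha hc (by linarith) hpr.le hv0 hα0 hη hε hη2 hε1 hε2
      (by rw [hEq] at h1 ⊢; linarith) hvτ hτ₂.le (by linarith)
  -- phase III
  obtain ⟨τ₃, hτ₃, heq₃, -, hcst₃⟩ := nsys_hit hP hprop 1 2 (by decide) (by decide) hτq
    (hdir 2 (by decide)) (by rw [← hz, ← hr]; exact hrz)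
  have d2 : ∀ t ∈ Icc τ τ₃, P t 2 = z := fun t ht => by rw [hz]; exact hcst₃ t ht 2 le_rfl
  have d3 : ∀ t ∈ Icc τ τ₃, P t 3 = y := fun t ht => by
    rw [hy]; exact hcst₃ t ht 3 (by decide)
  have m₃ : τ₃ ∈ Icc τ τ₃ := ⟨hτ₃.le, le_rfl⟩
  have h23 : τ₂ < τ₃ := by
    by_contra hcon
    push Not at hcon
    have h1 := c1 τ₃ ⟨hτ₃.le, hcon⟩
    have h2 := d2 τ₃ m₃
    linarith
  obtain ⟨p', hp'⟩ : ∃ p', p' = P τ₃ 0 := ⟨_, rfl⟩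
  have hrp₃ : r ≤ p' := by
    have := nsys_mono hP 0 (hτq.trans hτ₂.le) h23.le
    rw [heq₂, c1 _ m₂] at this
    linarith
  have hT3 : T ≤ τ₃ := hτT.trans hτ₃.le
  have hq3 : q₀ ≤ τ₃ := hTq.trans hT3
  have hz3 : P τ₃ 1 = z := by rw [heq₃, d2 _ m₃]
  have hs3 := hsum τ₃ hq3
  rw [← hp', hz3, d2 _ m₃, d3 _ m₃] at hs3
  have ετ : ε * τ ≤ ε * τ₃ := by gcongr
  refine ⟨τ₃, ?_, ?_, ?_⟩
  · have h1 := nsys_mono hP 1 hTq hT3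
    have h2 := nsys_mono hP 2 hTq hT3
    have h3 := nsys_mono hP 3 hTq hT3
    have h4 := hsum T hTq
    have h5 := hsum τ₃ hq3
    rw [← hp] at h4
    rw [← hp'] at h5
    nlinarith
  · have h0 := I0 τ₃ (hT.trans hT3)
    have h1 := I1 τ₃ (hT.trans hT3)
    rw [← hp', hz3] at h0 ⊢
    rw [← hp', hz3, d3 _ m₃] at h1
    exact arith_next (α := α) (β := β) (a := α - 1) (c := β - 1) (η := η) (ε := ε) (p := p)
      (p' := p') (z := z) (v := y - z) (t3 := τ₃) (C := C) ha hc (by linarith) hv0 hα0 hαβ hη hε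
      hη1 hη2 hε1 hε3 hC hε4 (by linarith) (by linarith) (by linarith) (by linarith)
      (by linarith) (by linarith) (by linarith)
  · intro t ht
    have hpt : p ≤ t := by
      have h4 := hsum T hTq
      rw [← hp] at h4
      linarith [hnn T hTq 1, hnn T hTq 2, hnn T hTq 3, ht.1]
    have h6 : α * (α - 1) * η * p ≤ α * (α - 1) * η * t := by gcongr
    rcases le_total t τ with h | h
    · have := phIv t ⟨ht.1, h⟩
      linarith
    · rw [d2 t ⟨h, ht.2⟩, d3 t ⟨h, ht.2⟩]
      have : ε * τ ≤ ε * t := by gcongr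
      linarith

lemma acc_closed {P : ℝ → Fin 4 → ℝ} {x : Fin 4 → ℝ} (hx : x ∈ accPts 4 P)
    {S : Set (Fin 4 → ℝ)} (hS : IsClosed S) (h : ∀ᶠ q : ℝ in atTop, q⁻¹ • P q ∈ S) : x ∈ S := by
  by_contra hn
  have hx' : MapClusterPt x atTop fun q : ℝ => q⁻¹ • P q := hx
  have h1 := hx'.frequently (p := fun y => y ∉ S) (hS.isOpen_compl.mem_nhds hn)
  obtain ⟨q, h2, h3⟩ := (h1.and_eventually h).exists
  exact h2 h3

lemma acc_small {α β : ℝ} (hα : 1 < α) (hαβ : α < β) {q₀ : ℝ} (hq₀ : 0 ≤ q₀)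
    {P : ℝ → Fin 4 → ℝ} (hP : IsNSystem 4 (Ici q₀) P) (hprop : IsProper 4 P)
    (hB : nB1 β ∈ Kset 4 P) (hK : Kset 4 P ⊆ Kbig α β) {δ : ℝ} (hδ : 0 < δ) :
    ∀ᶠ t in atTop, P t 3 - P t 2 ≤ δ * t := by
  have ha : 0 < α - 1 := by linarith
  have hc : 0 < β - 1 := by linarith
  have hα0 : 0 < α := by linarith
  have hβα : 0 < β - α := by linarith
  have hac : 0 < (α - 1) * (β - 1) := mul_pos ha hc
  have hF : accPts 4 P ⊆ Kbig α β := (subset_convexHull ℝ _).trans hK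
  obtain ⟨η, hη, hη1, hη2, hη3⟩ : ∃ η > 0, η ≤ (β - α) / 2 ∧ α * η ≤ (β - 1) / 4 ∧
      α * (α - 1) * η ≤ (β - 1) * δ / 2 := by
    refine ⟨min ((β - α) / 2) (min ((β - 1) / 4 / α) ((β - 1) * δ / 2 / (α * (α - 1)))),
      by positivity, min_le_left _ _, ?_, ?_⟩
    · rw [mul_comm, ← le_div_iff₀ hα0]
      exact (min_le_right _ _).trans (min_le_left _ _)
    · rw [mul_comm, ← le_div_iff₀ (by positivity)]
      exact (min_le_right _ _).trans (min_le_right _ _)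
  obtain ⟨C, hC⟩ : ∃ C, C = 2 * (1 + 3 * β + (α - 1) / 4) := ⟨_, rfl⟩
  have hC0 : 0 < C := by rw [hC]; linarith
  have hab : 0 < α + β := by linarith
  obtain ⟨ε, hε, hε1, hε2, hε3, hε4, hε5⟩ : ∃ ε > 0, ε ≤ (β - 1) / 4 ∧
      ε ≤ (α - 1) * (β - 1) / 48 ∧ ε ≤ 1 / 12 ∧
      2 * ε * C * (α + β) ≤ (α - 1) * η * (β - α) ∧ ε ≤ (β - 1) * δ / 2 := by
    refine ⟨min ((β - 1) / 4) (min ((α - 1) * (β - 1) / 48) (min (1 / 12)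
      (min ((α - 1) * η * (β - α) / (2 * C * (α + β))) ((β - 1) * δ / 2)))), by positivity,
      ?_, ?_, ?_, ?_, ?_⟩
    · exact min_le_left _ _
    · exact (min_le_right _ _).trans (min_le_left _ _)
    · exact (min_le_right _ _).trans ((min_le_right _ _).trans (min_le_left _ _))
    · have : ∀ e, e ≤ (α - 1) * η * (β - α) / (2 * C * (α + β)) →
          2 * e * C * (α + β) ≤ (α - 1) * η * (β - α) := by
        intro e he
        rw [le_div_iff₀ (by positivity)] at he
        linarith
      apply this
      exact (min_le_right _ _).trans ((min_le_right _ _).trans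
        ((min_le_right _ _).trans (min_le_left _ _)))
    · exact (min_le_right _ _).trans ((min_le_right _ _).trans
        ((min_le_right _ _).trans (min_le_right _ _)))
  have E0 := ev_lin hP ![-β, 1, 0, 0] (fun x hx => K_lin hα hαβ _ (by simp) (by simp; linarith)
    (by simp; linarith) (by simp; linarith) (by simp) x (hF hx)) hε
  have E1 := ev_lin hP ![(α - 1) * β, (β - 1) - (α - 1), 0, -(β - 1)]
    (fun x hx => K_lin hα hαβ _ (by simp; nlinarith) (by simp; nlinarith)
    (by simp; nlinarith) (by simp; nlinarith) (by simp; linarith) x (hF hx)) hε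
  have E2 := ev_lin hP ![-(α * (α - 1) * β), α * (α - 1), -(β - 1), β - 1]
    (fun x hx => K_lin hα hαβ _ (by simp; nlinarith) (by simp; nlinarith)
    (by simp; nlinarith) (by simp; nlinarith) (by simp) x (hF hx)) hε
  simp only [Fin.sum_univ_four, Matrix.cons_val] at E0 E1 E2
  obtain ⟨Q, hQ⟩ := eventually_atTop.1 (E0.and (E1.and (E2.and
    (((hprop 0).eventually_ge_atTop 1).and ((eventually_ge_atTop q₀))))))
  have hQq : q₀ ≤ Q := (hQ Q le_rfl).2.2.2.2
  -- a good starting time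
  obtain ⟨x, hx, hxm⟩ : ∃ x ∈ accPts 4 P, (β - 1) / (1 + 3 * β) ≤ x 1 - x 0 := by
    by_contra hcon
    push Not at hcon
    have hconv : Convex ℝ {x : Fin 4 → ℝ | x 1 - x 0 < (β - 1) / (1 + 3 * β)} := by
      apply convex_halfSpace_lt
      constructor
      · intro x y; simp; ring
      · intro c x; simp; ring
    have h1 : nB1 β ∈ {x : Fin 4 → ℝ | x 1 - x 0 < (β - 1) / (1 + 3 * β)} :=
      convexHull_min hcon hconv hB
    have h2 : (nB1 β) 1 - (nB1 β) 0 = (β - 1) / (1 + 3 * β) := by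
      simp [nB1, ptB1]; ring
    exact absurd h2 (ne_of_lt h1)
  have hb0 : 0 < 1 + 3 * β := by linarith
  have hxs : x ∈ {x : Fin 4 → ℝ | x 0 + x 1 + x 2 + x 3 = 1} := by
    apply acc_closed hx (isClosed_eq (by fun_prop) continuous_const)
    filter_upwards [eventually_ge_atTop q₀, eventually_gt_atTop 0] with q h1 h2
    have := (hP q h1).1.2.2
    rw [Fin.sum_univ_four] at this
    simp only [mem_ofPred_eq, Pi.smul_apply, smul_eq_mul, ← mul_add, this]
    exact inv_mul_cancel₀ h2.ne'
  have hxs : x 0 + x 1 + x 2 + x 3 = 1 := hxs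
  have hx0 := K_lin hα hαβ ![-β, 1, 0, 0] (by simp) (by simp; linarith)
    (by simp; linarith) (by simp; linarith) (by simp) x (hF hx)
  have hx1 := K_lin hα hαβ ![β - (β - 1) - (1 + 3 * β), -1 - (β - 1) + (1 + 3 * β), -(β - 1),
    -(β - 1)] (by simp; nlinarith) (by simp; nlinarith)
    (by simp; nlinarith) (by simp; nlinarith) (by simp; linarith) x (hF hx)
  simp only [Fin.sum_univ_four, Matrix.cons_val] at hx0 hx1
  have hm : 0 < (β - 1) / (1 + 3 * β) := by positivity
  have hxpos : 0 < x 0 := by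
    have : 0 < (β - 1) * x 0 := by linarith
    exact (mul_pos_iff_of_pos_left hc).1 this
  have hxm' : β - 1 ≤ (1 + 3 * β) * (x 1 - x 0) := by
    rwa [div_le_iff₀' hb0] at hxm
  have hxS : β * x 0 - x 1 < η * x 0 := by
    have h1 : 0 < η * x 0 := by positivity
    have h2 : (β - 1) * (x 0 + x 1 + x 2 + x 3) = (β - 1) * 1 := by rw [hxs]
    linarith
  have hx' : MapClusterPt x atTop fun q : ℝ => q⁻¹ • P q := hx
  have hfr := hx'.frequently (p := fun y => β * y 0 - y 1 < η * y 0)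
    ((isOpen_lt (by fun_prop) (by fun_prop)).mem_nhds hxS)
  obtain ⟨T₀, hT₀, hT₀Q, hT₀p⟩ := (hfr.and_eventually
    ((eventually_ge_atTop Q).and (eventually_gt_atTop 0))).exists
  have hgood₀ : β * P T₀ 0 - P T₀ 1 ≤ η * P T₀ 0 := by
    simp only [Pi.smul_apply, smul_eq_mul] at hT₀
    have h1 : T₀⁻¹ * (β * P T₀ 0 - P T₀ 1) < T₀⁻¹ * (η * P T₀ 0) := by linarith
    exact (lt_of_mul_lt_mul_left h1 (by positivity)).le
  have hstep : ∀ T, Q ≤ T → β * P T 0 - P T 1 ≤ η * P T 0 →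
      ∃ T', T + ((α + β) / 2 - 1) ≤ T' ∧ β * P T' 0 - P T' 1 ≤ η * P T' 0 ∧
      ∀ t ∈ Icc T T', (β - 1) * (P t 3 - P t 2) ≤ (α * (α - 1) * η + ε) * t := by
    intro T hT hg
    refine step hq₀ hP hprop hα hαβ hη hε hη1 hη2 hε1 hε2 hε3 hC hε4 hQq
      (fun t ht => (hQ t ht).2.2.2.1) (fun t ht => ?_) (fun t ht => ?_) (fun t ht => ?_) hT hg
    · linarith [(hQ t ht).1]
    · linarith [(hQ t ht).2.1]
    · linarith [(hQ t ht).2.2.1]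
  have hμ : 0 < (α + β) / 2 - 1 := by linarith
  have hiter : ∀ n : ℕ, ∃ T, T₀ + n * ((α + β) / 2 - 1) ≤ T ∧ Q ≤ T ∧
      β * P T 0 - P T 1 ≤ η * P T 0 ∧
      ∀ t ∈ Icc T₀ T, (β - 1) * (P t 3 - P t 2) ≤ (α * (α - 1) * η + ε) * t := by
    intro n
    induction n with
    | zero =>
      obtain ⟨T', h1, h2, h3⟩ := hstep T₀ hT₀Q hgood₀
      refine ⟨T₀, by simp, hT₀Q, hgood₀, fun t ht => h3 t ⟨ht.1, ht.2.trans (by linarith)⟩⟩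
    | succ n ih =>
      obtain ⟨T, h1, h2, h3, h4⟩ := ih
      obtain ⟨T', h5, h6, h7⟩ := hstep T h2 h3
      refine ⟨T', by push_cast; linarith, by linarith, h6, fun t ht => ?_⟩
      rcases le_total t T with h | h
      · exact h4 t ⟨ht.1, h⟩
      · exact h7 t ⟨h, ht.2⟩
  filter_upwards [eventually_ge_atTop T₀] with t ht
  obtain ⟨n, hn⟩ := exists_nat_ge ((t - T₀) / ((α + β) / 2 - 1))
  rw [div_le_iff₀ hμ] at hn
  obtain ⟨T, h1, -, -, h4⟩ := hiter n
  have h5 := h4 t ⟨ht, by linarith⟩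
  have ht0 : 0 < t := by linarith
  have h6 : (α * (α - 1) * η + ε) * t ≤ ((β - 1) * δ) * t := by gcongr; linarith
  have h7 : (β - 1) * (P t 3 - P t 2) ≤ (β - 1) * (δ * t) := by linarith
  exact le_of_mul_le_mul_left h7 hc

theorem stmt_9 (α β : ℝ) (hα : 1 < α) (hαβ : α < β) (q₀ : ℝ) (hq₀ : 0 ≤ q₀)
    (P : ℝ → Fin 4 → ℝ) (hP : IsNSystem 4 (Ici q₀) P) (hprop : IsProper 4 P)
    (hB : nB1 β ∈ Kset 4 P) (hK : Kset 4 P ⊆ Kbig α β) :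
    ∀ x ∈ Kset 4 P, x 2 = x 3 := by
  have hacc : ∀ x ∈ accPts 4 P, x 2 = x 3 := by
    intro x hx
    apply le_antisymm
    · have hm : x ∈ {x : Fin 4 → ℝ | x 2 ≤ x 3} := by
        apply acc_closed hx (isClosed_le (by fun_prop) (by fun_prop))
        filter_upwards [eventually_ge_atTop q₀, eventually_gt_atTop 0] with q h1 h2
        have h3 : P q 2 ≤ P q 3 := (hP q h1).1.2.1 (by decide)
        simp only [mem_ofPred_eq, Pi.smul_apply, smul_eq_mul]
        gcongr
      exact hm
    · apply le_of_forall_pos_le_add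
      intro δ hδ
      have hm : x ∈ {x : Fin 4 → ℝ | x 3 ≤ x 2 + δ} := by
        apply acc_closed hx (isClosed_le (by fun_prop) (by fun_prop))
        filter_upwards [acc_small hα hαβ hq₀ hP hprop hB hK hδ, eventually_gt_atTop 0]
          with q h1 h2
        simp only [mem_ofPred_eq, Pi.smul_apply, smul_eq_mul]
        have h3 : q⁻¹ * (P q 3 - P q 2) ≤ q⁻¹ * (δ * q) := by gcongr
        have h4 : q⁻¹ * (δ * q) = δ := by field_simp
        linarith
      exact hm
  have hconv : Convex ℝ {x : Fin 4 → ℝ | x 2 = x 3} := by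
    intro x hx y hy a b _ _ _
    have hx : x 2 = x 3 := hx
    have hy : y 2 = y 3 := hy
    simp [hx, hy]
  exact fun x hx => convexHull_min hacc hconv hx
end
end
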